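/- Let F(x,y) = h_n·x^n + h_k·x^k·y^(n−k) + h_0·y^n be an irreducible trinomial binary form of degree n ≥ 6. Then the number of pairs (x,y) ∈ ℤ × ℤ with |F(x,y)| = 1 is at most 2·v(n)·z(n) + 8. -/

import Mathlib

/-- `v(n) = 3` if `n` is odd, `4` if `n` is even. -/
def v (n : ℕ) : ℕ := if Odd n then 3 else 4

/-- The function `z(n)` from the paper. -/
def z (n : ℕ) : ℕ :=
  if n = 6 then 15
  else if n = 7 then 12
  else if n = 8 then 11
  else if n = 9 then 9
  else if n ≤ 11 then 8
  else if n ≤ 16 then 7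
  else if n ≤ 38 then 6
  else if n ≤ 218 then 5
  else 4

open Polynomial

theorem eval_hasseDeriv_eq_sum {R : Type*} [CommRing R] (p : R[X]) {D : ℕ}
    (hp : p.natDegree < D) (j : ℕ) (x : R) :
    (hasseDeriv j p).eval x
      = ∑ i ∈ Finset.range D, (i.choose j : R) * p.coeff i * x ^ (i - j) := by
  conv_lhs => rw [as_sum_range' p D hp]
  rw [map_sum, eval_finsetSum]
  refine Finset.sum_congr rfl fun i _ => ?_
  rw [hasseDeriv_monomial, eval_monomial]

theorem exists_reduced_power {a b c : ℤ} {n k : ℕ} (hk : 0 < k) (hkn : k < n) {α H : ℝ}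
    (hα : a * α ^ n + b * α ^ k + c = 0) (ha : |(a : ℝ)| ≤ H) (hb : |(b : ℝ)| ≤ H)
    (hc : |(c : ℝ)| ≤ H) (m : ℕ) :
    ∃ g : ℕ → ℤ, (∀ i, |(g i : ℝ)| ≤ (2 * H) ^ m) ∧
      (a : ℝ) ^ m * α ^ m = ∑ i ∈ Finset.range n, (g i : ℝ) * α ^ i := by
  have hH : 0 ≤ H := (abs_nonneg _).trans ha
  obtain ⟨N, rfl⟩ : ∃ N, n = N + 1 := ⟨n - 1, by omega⟩
  induction m with
  | zero =>
    refine ⟨fun i => if i = 0 then 1 else 0, fun i => ?_, ?_⟩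
    · dsimp only
      split_ifs <;> simp
    · simp
  | succ m ih =>
    obtain ⟨g, hg, hs⟩ := ih
    refine ⟨fun i => (if i = 0 then -(c * g N) else a * g (i - 1)) - if i = k then b * g N else 0,
      fun i => ?_, ?_⟩
    · have hmul : ∀ u : ℤ, |(u : ℝ)| ≤ H → ∀ l, |((u * g l : ℤ) : ℝ)| ≤ H * (2 * H) ^ m := by
        intro u hu l
        push_cast
        rw [abs_mul]
        exact mul_le_mul hu (hg l) (abs_nonneg _) hH
      have h1 := hmul c hc N
      have h2 := hmul a ha (i - 1)
      have h3 := hmul b hb N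
      have h4 : 0 ≤ H * (2 * H) ^ m := by positivity
      have h5 : (2 * H) ^ (m + 1) = H * (2 * H) ^ m + H * (2 * H) ^ m := by ring
      rw [h5]
      rw [abs_le] at *
      dsimp only
      split_ifs <;> first | omega |
        (push_cast at *; constructor <;> linarith [h1.1, h1.2, h2.1, h2.2, h3.1, h3.2])
    · have e1 : (a : ℝ) ^ (m + 1) * α ^ (m + 1) = a * α * (a ^ m * α ^ m) := by ring
      have e2 : ∑ x ∈ Finset.range (N + 1), (((if x = k then b * g N else 0 : ℤ)) : ℝ) * α ^ x
          = b * g N * α ^ k := by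
        rw [Finset.sum_eq_single k]
        · simp
        · intro x _ hx; simp [hx]
        · intro h; exact absurd (Finset.mem_range.2 hkn) h
      have e3 : ∑ x ∈ Finset.range (N + 1),
          (((if x = 0 then -(c * g N) else a * g (x - 1) : ℤ)) : ℝ) * α ^ x
          = a * α * (∑ x ∈ Finset.range N, (g x : ℝ) * α ^ x) - c * g N := by
        rw [Finset.sum_range_succ', Finset.mul_sum, sub_eq_add_neg]
        congr 1
        · refine Finset.sum_congr rfl fun x _ => ?_
          rw [if_neg (Nat.succ_ne_zero x), Nat.add_sub_cancel]
          push_cast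
          ring
        · simp
      simp only [Int.cast_sub, sub_mul, Finset.sum_sub_distrib]
      rw [e1, hs, e2, e3, Finset.sum_range_succ]
      linear_combination (g N : ℝ) * hα

open scoped Matrix.Norms.Elementwise in
theorem exists_small_kernel_vector {n t D : ℕ} (hn : 2 ≤ n) (ht : 0 < t) (hD : D = 2 * n * t)
    {H : ℝ} (hH1 : 1 ≤ H) (M : Matrix (Fin (3 * t) × Fin n) (Fin D ⊕ Fin D) ℤ)
    (hM : ∀ i s, |(M i s : ℝ)| ≤ (4 * H) ^ D) :
    ∃ v : Fin D ⊕ Fin D → ℤ, v ≠ 0 ∧ M.mulVec v = 0 ∧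
      ∀ s, |(v s : ℝ)| ≤ (8 * H) ^ (3 * D) := by
  have hMn : ‖M‖ ≤ (4 * H) ^ D := (Matrix.norm_le_iff (by positivity)).2 fun i s => by
    rw [Int.norm_eq_abs]; exact hM i s
  have hn0 : 0 < n := by omega
  have hnt0 : 0 < n * t := mul_pos hn0 ht
  obtain ⟨v, hv0, hv, hvn⟩ := Int.Matrix.exists_ne_zero_int_vec_norm_le M
    (by simp only [Fintype.card_prod, Fintype.card_sum, Fintype.card_fin]; rw [hD]; nlinarith)
    (by simp only [Fintype.card_prod, Fintype.card_fin]; positivity)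
  refine ⟨v, hv0, hv, fun s => ?_⟩
  rw [← Int.norm_eq_abs]
  refine (norm_le_pi_norm v s).trans (hvn.trans ?_)
  have hnt : (0 : ℝ) < n * t := by exact_mod_cast hnt0
  have hexp : ((Fintype.card (Fin (3 * t) × Fin n) : ℕ) : ℝ)
      / (((Fintype.card (Fin D ⊕ Fin D) : ℕ) : ℝ)
        - ((Fintype.card (Fin (3 * t) × Fin n) : ℕ) : ℝ)) = (3 : ℕ) := by
    simp only [Fintype.card_prod, Fintype.card_sum, Fintype.card_fin, hD]
    push_cast
    have : (2 * n * t + 2 * n * t - 3 * t * n : ℝ) = n * t := by ring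
    rw [this, div_eq_iff hnt.ne']
    ring
  rw [hexp, Real.rpow_natCast, mul_comm 3 D, pow_mul]
  apply pow_le_pow_left₀ (by positivity)
  have h2 : ((Fintype.card (Fin D ⊕ Fin D) : ℕ) : ℝ) ≤ 2 ^ D := by
    simp only [Fintype.card_sum, Fintype.card_fin]
    have : D + D ≤ 2 ^ D := by
      have hD4 : 4 ≤ D := by rw [hD]; nlinarith
      clear * - hD4
      induction D, hD4 using Nat.le_induction with
      | base => norm_num
      | succ m hm ih => rw [pow_succ]; omega
    exact_mod_cast this
  calc _ ≤ (2 : ℝ) ^ D * (4 * H) ^ D := by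
        apply mul_le_mul h2 _ (by positivity) (by positivity)
        exact max_le (one_le_pow₀ (by linarith)) hMn
    _ = (8 * H) ^ D := by rw [← mul_pow]; ring_nf

/-- Siegel's lemma applied to the vanishing of `A - α B` at `α`. -/
theorem exists_auxiliary_polynomials {a b c : ℤ} {n k : ℕ} (hk : 0 < k) (hkn : k < n) {α H : ℝ}
    (hα : a * α ^ n + b * α ^ k + c = 0) (ha0 : a ≠ 0)
    (ha : |(a : ℝ)| ≤ H) (hb : |(b : ℝ)| ≤ H) (hc : |(c : ℝ)| ≤ H)
    {t D : ℕ} (ht : 0 < t) (hD : D = 2 * n * t) :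
    ∃ A B : ℤ[X], (A ≠ 0 ∨ B ≠ 0) ∧ A.natDegree < D ∧ B.natDegree < D ∧
      (∀ i, |(A.coeff i : ℝ)| ≤ (8 * H) ^ (3 * D)) ∧
      (∀ i, |(B.coeff i : ℝ)| ≤ (8 * H) ^ (3 * D)) ∧
      ∀ j < 3 * t, (hasseDeriv j (A.map (Int.castRingHom ℝ))).eval α
        = α * (hasseDeriv j (B.map (Int.castRingHom ℝ))).eval α := by
  have hH1 : 1 ≤ H := by
    refine le_trans ?_ ha
    rw [← Int.cast_abs]
    exact_mod_cast Int.one_le_abs ha0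
  have hH : 0 ≤ H := by linarith
  have hDpos : 0 < D := by rw [hD]; exact mul_pos (by omega) ht
  choose g hg hgs using exists_reduced_power hk hkn hα ha hb hc
  obtain ⟨M, hMl, hMr⟩ : ∃ M : Matrix (Fin (3 * t) × Fin n) (Fin D ⊕ Fin D) ℤ,
      (∀ ji (m : Fin D), M ji (.inl m)
        = ((m : ℕ).choose ji.1 : ℤ) * (a ^ (D - (m - ji.1)) * g (m - ji.1) ji.2)) ∧
      ∀ ji (m : Fin D), M ji (.inr m)
        = -(((m : ℕ).choose ji.1 : ℤ) * (a ^ (D - (m - ji.1 + 1)) * g (m - ji.1 + 1) ji.2)) :=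
    ⟨fun ji => Sum.elim _ _, fun ji m => rfl, fun ji m => rfl⟩
  have hentry : ∀ (m j l e : ℕ), m < D → e ≤ D →
      |(((m.choose j : ℤ) * (a ^ (D - e) * g e l) : ℤ) : ℝ)| ≤ (4 * H) ^ D := by
    intro m j l e hm he
    push_cast
    rw [abs_mul, abs_mul, abs_pow, Nat.abs_cast]
    have h1 : ((m.choose j : ℕ) : ℝ) ≤ 2 ^ D := by
      have : m.choose j ≤ 2 ^ D := (Nat.choose_le_two_pow m j).trans
        (Nat.pow_le_pow_right (by norm_num) hm.le)
      exact_mod_cast this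
    have h2 : |(a : ℝ)| ^ (D - e) * |(g e l : ℝ)| ≤ (2 * H) ^ (D - e) * (2 * H) ^ e := by
      apply mul_le_mul _ (hg e l) (abs_nonneg _) (by positivity)
      exact pow_le_pow_left₀ (abs_nonneg _) (by linarith) _
    rw [← pow_add, Nat.sub_add_cancel he] at h2
    calc _ ≤ (2 : ℝ) ^ D * (2 * H) ^ D := mul_le_mul h1 h2 (by positivity) (by positivity)
      _ = (4 * H) ^ D := by rw [← mul_pow]; ring_nf
  have hM : ∀ i s, |(M i s : ℝ)| ≤ (4 * H) ^ D := by
    intro i s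
    rcases s with m | m
    · rw [hMl]
      exact hentry m i.1 i.2 _ m.2 ((Nat.sub_le _ _).trans m.2.le)
    · rw [hMr, Int.cast_neg, abs_neg]
      exact hentry m i.1 i.2 _ m.2 (by have := m.2; omega)
  have hn0 : 0 < n := by omega
  obtain ⟨v, hv0, hv, hvb⟩ := exists_small_kernel_vector (by omega) ht hD hH1 M hM
  obtain ⟨w, hwc⟩ : ∃ w : (Fin D → ℤ) → ℤ[X],
      ∀ u i, (w u).coeff i = if h : i < D then u ⟨i, h⟩ else 0 := by
    refine ⟨fun u => ∑ i ∈ Finset.range D, monomial i (if h : i < D then u ⟨i, h⟩ else 0),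
      fun u i => ?_⟩
    simp only [finsetSum_coeff, coeff_monomial]
    rw [Finset.sum_ite_eq' (Finset.range D) i]
    by_cases h : i < D <;> simp [h]
  have hwd : ∀ u, (w u).natDegree < D := by
    intro u
    have : (w u).natDegree ≤ D - 1 := by
      rw [natDegree_le_iff_coeff_eq_zero]
      intro N hN
      rw [hwc, dif_neg (by omega)]
    omega
  have hwb : ∀ u : Fin D → ℤ, (∀ i, |(u i : ℝ)| ≤ (8 * H) ^ (3 * D)) →
      ∀ i, |((w u).coeff i : ℝ)| ≤ (8 * H) ^ (3 * D) := by
    intro u hu i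
    rw [hwc]
    split_ifs with h
    · exact hu _
    · simp; positivity
  refine ⟨w fun i => v (.inl i), w fun i => v (.inr i), ?_, hwd _, hwd _,
    hwb _ fun i => hvb _, hwb _ fun i => hvb _, ?_⟩
  · by_contra! hcon
    apply hv0
    funext s
    rcases s with m | m
    · have := congrArg (fun p => coeff p (m : ℕ)) hcon.1
      simpa [hwc] using this
    · have := congrArg (fun p => coeff p (m : ℕ)) hcon.2
      simpa [hwc] using this
  · intro j hj
    have hA0 : (a : ℝ) ^ D ≠ 0 := pow_ne_zero _ (by exact_mod_cast ha0)
    have hmap : ∀ u, ((w u).map (Int.castRingHom ℝ)).natDegree < D :=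
      fun u => (natDegree_map_le).trans_lt (hwd u)
    rw [eval_hasseDeriv_eq_sum _ (hmap _), eval_hasseDeriv_eq_sum _ (hmap _)]
    have hrow : ∀ l : Fin n, ∑ m : Fin D, (M (⟨j, hj⟩, l) (.inl m) : ℝ) * v (.inl m)
        + ∑ m : Fin D, (M (⟨j, hj⟩, l) (.inr m) : ℝ) * v (.inr m) = 0 := by
      intro l
      have := congrFun hv (⟨j, hj⟩, l)
      simp only [Matrix.mulVec, dotProduct, Fintype.sum_sum_type, Pi.zero_apply] at this
      exact_mod_cast this
    have hpow : ∀ e ≤ D, ∑ l : Fin n, ((a : ℝ) ^ (D - e) * g e l) * α ^ (l : ℕ)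
        = a ^ D * α ^ e := by
      intro e he
      rw [← Finset.sum_range fun l => ((a : ℝ) ^ (D - e) * g e l) * α ^ l]
      simp only [mul_assoc]
      rw [← Finset.mul_sum, ← hgs e, ← mul_assoc, ← pow_add, Nat.sub_add_cancel he]
    have hsum : ∑ l : Fin n, (∑ m : Fin D, (M (⟨j, hj⟩, l) (.inl m) : ℝ) * v (.inl m)
        + ∑ m : Fin D, (M (⟨j, hj⟩, l) (.inr m) : ℝ) * v (.inr m)) * α ^ (l : ℕ) = 0 := by
      simp [hrow]
    simp only [add_mul, Finset.sum_add_distrib, Finset.sum_mul] at hsum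
    rw [Finset.sum_comm, Finset.sum_comm (s := Finset.univ (α := Fin n))] at hsum
    have hl : ∀ m : Fin D, ∑ l : Fin n, (M (⟨j, hj⟩, l) (.inl m) : ℝ) * v (.inl m) * α ^ (l : ℕ)
        = a ^ D * (((m : ℕ).choose j : ℝ) * v (.inl m) * α ^ ((m : ℕ) - j)) := by
      intro m
      have := hpow (m - j) ((Nat.sub_le _ _).trans m.2.le)
      calc _ = ((m : ℕ).choose j : ℝ) * v (.inl m) *
            ∑ l : Fin n, ((a : ℝ) ^ (D - (m - j)) * g (m - j) l) * α ^ (l : ℕ) := by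
            rw [Finset.mul_sum]
            refine Finset.sum_congr rfl fun l _ => ?_
            rw [hMl]; push_cast; ring
        _ = _ := by rw [this]; ring
    have hr : ∀ m : Fin D, ∑ l : Fin n, (M (⟨j, hj⟩, l) (.inr m) : ℝ) * v (.inr m) * α ^ (l : ℕ)
        = -(a ^ D * (α * (((m : ℕ).choose j : ℝ) * v (.inr m) * α ^ ((m : ℕ) - j)))) := by
      intro m
      have := hpow (m - j + 1) (by have := m.2; omega)
      calc _ = -(((m : ℕ).choose j : ℝ) * v (.inr m) *
            ∑ l : Fin n, ((a : ℝ) ^ (D - (m - j + 1)) * g (m - j + 1) l) * α ^ (l : ℕ)) := by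
            rw [Finset.mul_sum, ← Finset.sum_neg_distrib]
            refine Finset.sum_congr rfl fun l _ => ?_
            rw [hMr]; push_cast; ring
        _ = _ := by rw [this]; ring
    simp only [hl, hr, Finset.sum_neg_distrib, ← Finset.mul_sum] at hsum
    have h0 := mul_left_cancel₀ hA0 (add_neg_eq_zero.1 hsum)
    rw [Finset.sum_range, Finset.sum_range]
    simpa [hwc] using h0

/-- If an integer polynomial vanishes to order `r` at a root of an irreducible polynomial `f`,
then its degree is at least `r * deg f`. -/
theorem natDegree_mul_le_of_pow_dvd {f : ℤ[X]} (hf : Irreducible f) (hf0 : f.natDegree ≠ 0)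
    {α : ℝ} (hα : (f.map (Int.castRingHom ℝ)).IsRoot α) (r : ℕ) (B : ℤ[X]) (hB : B ≠ 0)
    (hdvd : (X - C α) ^ r ∣ B.map (Int.castRingHom ℝ)) : f.natDegree * r ≤ B.natDegree := by
  have hprim := hf.isPrimitive hf0
  have hfQ : Irreducible (f.map (Int.castRingHom ℚ)) :=
    (IsPrimitive.Int.irreducible_iff_irreducible_map_cast hprim).1 hf
  have hcomp : ∀ p : ℤ[X], (p.map (Int.castRingHom ℚ)).map (algebraMap ℚ ℝ)
      = p.map (Int.castRingHom ℝ) := by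
    intro p
    rw [map_map]
    congr 1
  have hfR0 : f.map (Int.castRingHom ℝ) ≠ 0 :=
    (Polynomial.map_ne_zero_iff (Int.cast_injective)).2 hf.ne_zero
  have hmult : (f.map (Int.castRingHom ℝ)).rootMultiplicity α = 1 := by
    apply le_antisymm
    · have hsep : (f.map (Int.castRingHom ℝ)).Separable := by
        rw [← hcomp]
        exact hfQ.separable.map
      exact rootMultiplicity_le_one_of_separable hsep α
    · exact (rootMultiplicity_pos hfR0).2 hα
  induction r generalizing B with
  | zero => simp
  | succ r ih =>
    have hBR : B.map (Int.castRingHom ℝ) ≠ 0 :=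
      (Polynomial.map_ne_zero_iff (Int.cast_injective)).2 hB
    have hroot : (B.map (Int.castRingHom ℝ)).eval α = 0 := by
      rw [← IsRoot, ← dvd_iff_isRoot]
      exact (dvd_pow_self _ (Nat.succ_ne_zero r)).trans hdvd
    have hfB : f ∣ B := by
      rw [IsPrimitive.Int.dvd_iff_map_cast_dvd_map_cast _ _ hprim]
      have hmin : minpoly ℚ α ∣ B.map (Int.castRingHom ℚ) := by
        apply minpoly.dvd
        rw [aeval_def, ← eval_map, hcomp, hroot]
      have hmin' : minpoly ℚ α ∣ f.map (Int.castRingHom ℚ) := by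
        apply minpoly.dvd
        rw [aeval_def, ← eval_map, hcomp, hα]
      have h_int : IsIntegral ℚ α := by
        by_contra hni
        rw [minpoly.eq_zero hni, zero_dvd_iff] at hmin'
        exact hfQ.ne_zero hmin'
      exact ((minpoly.irreducible h_int).dvd_symm hfQ hmin').trans hmin
    obtain ⟨B', rfl⟩ := hfB
    have hB' : B' ≠ 0 := right_ne_zero_of_mul hB
    have hB'R : B'.map (Int.castRingHom ℝ) ≠ 0 :=
      (Polynomial.map_ne_zero_iff (Int.cast_injective)).2 hB'
    rw [natDegree_mul hf.ne_zero hB']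
    have h1 := (le_rootMultiplicity_iff hBR).2 hdvd
    rw [Polynomial.map_mul] at h1 hBR
    rw [rootMultiplicity_mul hBR, hmult] at h1
    have := ih B' hB' ((le_rootMultiplicity_iff hB'R).1 (by omega))
    rw [mul_add, mul_one]
    omega

theorem wronskian_mul_mul {R : Type*} [CommRing R] (d p q : R[X]) :
    wronskian (d * p) (d * q) = d ^ 2 * wronskian p q := by
  simp only [wronskian, derivative_mul]
  ring

theorem wronskian_ne_zero_of_pow_dvd {f : ℤ[X]} (hf : Irreducible f) (hf0 : 2 ≤ f.natDegree)
    {α : ℝ} (hα : (f.map (Int.castRingHom ℝ)).IsRoot α) {r : ℕ} {A B : ℤ[X]}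
    (hAB : A ≠ 0 ∨ B ≠ 0) (hA : A.natDegree < f.natDegree * r) (hB : B.natDegree < f.natDegree * r)
    (hdvd : (X - C α) ^ r ∣ A.map (Int.castRingHom ℝ) - C α * B.map (Int.castRingHom ℝ)) :
    wronskian A B ≠ 0 := by
  intro hW
  set ι := Int.castRingHom ℚ with hι
  have hinj : Function.Injective ι := Int.cast_injective
  have hcomp : ∀ p : ℤ[X], (p.map ι).map (algebraMap ℚ ℝ) = p.map (Int.castRingHom ℝ) := by
    intro p
    rw [map_map]
    congr 1
  have hABQ : ¬ (A.map ι = 0 ∧ B.map ι = 0) := by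
    rw [Polynomial.map_eq_zero_iff hinj, Polynomial.map_eq_zero_iff hinj]
    tauto
  obtain ⟨d, p, q, hpq, hAp, hBq⟩ : ∃ d p q : ℚ[X], IsCoprime p q ∧
      A.map ι = d * p ∧ B.map ι = d * q := by
    obtain ⟨p, q, hp, hq, hu⟩ := extract_gcd (A.map ι) (B.map ι)
    exact ⟨_, p, q, (gcd_isUnit_iff p q).1 hu, hp, hq⟩
  have hd0 : d ≠ 0 := by
    rintro rfl
    exact hABQ ⟨by simpa using hAp, by simpa using hBq⟩
  have hW' : wronskian p q = 0 := by
    have h1 : (wronskian A B).map ι = wronskian (A.map ι) (B.map ι) := by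
      simp [wronskian, derivative_map]
    rw [hW, hAp, hBq, wronskian_mul_mul, Polynomial.map_zero] at h1
    exact (mul_eq_zero.1 h1.symm).resolve_left (pow_ne_zero 2 hd0)
  obtain ⟨hp', hq'⟩ := hpq.wronskian_eq_zero_iff.1 hW'
  obtain ⟨u, hu⟩ : ∃ u, C u = p := ⟨_, (eq_C_of_derivative_eq_zero hp').symm⟩
  obtain ⟨v, hv⟩ : ∃ v, C v = q := ⟨_, (eq_C_of_derivative_eq_zero hq').symm⟩
  subst hu hv
  have huv : (u : ℝ) - α * v ≠ 0 := by
    intro h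
    have hv0 : v ≠ 0 := by
      rintro rfl
      have hu0 : u = 0 := by simpa using h
      subst hu0
      exact hABQ ⟨by simpa using hAp, by simpa using hBq⟩
    have hlin : C (v.num * u.den : ℤ) * X - C (u.num * v.den : ℤ) ≠ (0 : ℤ[X]) := by
      intro h0
      have := congrArg (fun p => coeff p 1) h0
      rw [coeff_sub, coeff_C_mul, coeff_X_one, coeff_C, if_neg one_ne_zero] at this
      simp [hv0] at this
    have := natDegree_mul_le_of_pow_dvd hf (by omega) hα 1 _ hlin (by
      rw [pow_one, dvd_iff_isRoot, IsRoot]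
      have hu' : (u : ℝ) = u.num / u.den := by exact_mod_cast (Rat.num_div_den u).symm
      have hv' : (v : ℝ) = v.num / v.den := by exact_mod_cast (Rat.num_div_den v).symm
      have h1 : (u.den : ℝ) ≠ 0 := by exact_mod_cast u.den_ne_zero
      have h2 : (v.den : ℝ) ≠ 0 := by exact_mod_cast v.den_ne_zero
      rw [hu', hv'] at h
      field_simp at h
      simp
      linarith)
    have hdeg : (C (v.num * u.den : ℤ) * X - C (u.num * v.den : ℤ) : ℤ[X]).natDegree ≤ 1 := by
      compute_degree
    omega
  have hfac : A.map (Int.castRingHom ℝ) - C α * B.map (Int.castRingHom ℝ)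
      = C ((u : ℝ) - α * v) * d.map (algebraMap ℚ ℝ) := by
    rw [← hcomp, ← hcomp, hAp, hBq]
    simp only [Polynomial.map_mul, map_C, C_sub, C_mul, eq_ratCast]
    ring
  rw [hfac, (isUnit_C.2 huv.isUnit).dvd_mul_left] at hdvd
  rcases hAB with h | h
  · refine absurd (natDegree_mul_le_of_pow_dvd hf (by omega) hα r A h ?_) (by omega)
    rw [← hcomp, hAp, Polynomial.map_mul]
    exact hdvd.mul_right _
  · refine absurd (natDegree_mul_le_of_pow_dvd hf (by omega) hα r B h ?_) (by omega)
    rw [← hcomp, hBq, Polynomial.map_mul]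
    exact hdvd.mul_right _

theorem abs_coeff_wronskian_le {A B : ℤ[X]} {D : ℕ} {M : ℝ} (hA : A.natDegree < D)
    (hB : B.natDegree < D) (hAc : ∀ i, |(A.coeff i : ℝ)| ≤ M) (hBc : ∀ i, |(B.coeff i : ℝ)| ≤ M)
    (m : ℕ) : |((wronskian A B).coeff m : ℝ)| ≤ 4 * D ^ 2 * M ^ 2 := by
  have hM : 0 ≤ M := (abs_nonneg _).trans (hAc 0)
  by_cases hW : wronskian A B = 0
  · rw [hW]; simp; positivity
  by_cases hm : 2 * D ≤ m
  · have := natDegree_wronskian_lt_add hW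
    rw [coeff_eq_zero_of_natDegree_lt (by omega)]
    simp; positivity
  have key : ∀ P Q : ℤ[X], Q.natDegree < D → (∀ i, |(P.coeff i : ℝ)| ≤ M) →
      (∀ i, |(Q.coeff i : ℝ)| ≤ M) → |((P * derivative Q).coeff m : ℝ)| ≤ 2 * D ^ 2 * M ^ 2 := by
    intro P Q hQ hP hQc
    rw [coeff_mul]
    push_cast
    refine (Finset.abs_sum_le_sum_abs _ _).trans ((Finset.sum_le_card_nsmul _ _ (D * M ^ 2)
      fun x _ => ?_).trans ?_)
    · rw [coeff_derivative, abs_mul]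
      push_cast
      rw [abs_mul]
      have h1 : |(Q.coeff (x.2 + 1) : ℝ)| * |((x.2 : ℝ) + 1)| ≤ M * D := by
        by_cases hx : x.2 + 1 < D
        · refine mul_le_mul (hQc _) ?_ (abs_nonneg _) hM
          rw [abs_of_nonneg (by positivity)]
          exact_mod_cast hx.le
        · rw [coeff_eq_zero_of_natDegree_lt (by omega)]
          simp; positivity
      calc _ ≤ M * (M * D) := mul_le_mul (hP _) h1 (by positivity) hM
        _ = _ := by ring
    · rw [Finset.Nat.card_antidiagonal, nsmul_eq_mul]
      have : ((m + 1 : ℕ) : ℝ) ≤ 2 * D := by exact_mod_cast (by omega : m + 1 ≤ 2 * D)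
      calc _ ≤ (2 * D : ℝ) * (D * M ^ 2) := mul_le_mul_of_nonneg_right this (by positivity)
        _ = _ := by ring
  rw [wronskian, mul_comm (derivative A), coeff_sub]
  push_cast
  refine (abs_sub _ _).trans ?_
  linarith [key A B hB hAc hBc, key B A hA hBc hAc]

theorem isPrimitive_linear {x y : ℤ} (h : IsCoprime x y) : (C y * X - C x : ℤ[X]).IsPrimitive := by
  intro r hr
  rw [C_dvd_iff_dvd_coeff] at hr
  have h0 := hr 0
  have h1 := hr 1
  rw [coeff_sub, coeff_C_mul, coeff_X_zero, coeff_C_zero, mul_zero, zero_sub, dvd_neg] at h0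
  rw [coeff_sub, coeff_C_mul, coeff_X_one, coeff_C, if_neg one_ne_zero, mul_one, sub_zero] at h1
  exact h.isUnit_of_dvd' h0 h1

theorem pow_le_of_linear_pow_dvd {x y : ℤ} (hx : x ≠ 0) {W : ℤ[X]} (hW : W ≠ 0) {J : ℕ} {M : ℝ}
    (hM : ∀ i, |(W.coeff i : ℝ)| ≤ M) (hdvd : (C y * X - C x) ^ J ∣ W) (hy : y ≠ 0) :
    |(x : ℝ)| ^ J ≤ M ∧ |(y : ℝ)| ^ J ≤ M := by
  obtain ⟨V, rfl⟩ := hdvd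
  have hV : V ≠ 0 := right_ne_zero_of_mul hW
  have hle : ∀ u v : ℤ, v ≠ 0 → |(u : ℝ)| ^ J ≤ |((u ^ J * v : ℤ) : ℝ)| := by
    intro u v hv
    push_cast
    rw [abs_mul, abs_pow]
    apply le_mul_of_one_le_right (by positivity)
    exact_mod_cast Int.one_le_abs hv
  have hlead : (C y * X - C x : ℤ[X]).leadingCoeff = y := by
    rw [sub_eq_add_neg, ← C_neg]; exact leadingCoeff_linear hy
  have htrail : (C y * X - C x : ℤ[X]).coeff 0 = -x := by simp
  have hpow0 : ((C y * X - C x : ℤ[X]) ^ J).coeff 0 = (-x) ^ J := by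
    rw [coeff_zero_eq_eval_zero]; simp
  have hT : ((C y * X - C x : ℤ[X]) ^ J).trailingCoeff = (-x) ^ J := by
    rw [trailingCoeff, natTrailingDegree_eq_zero.2 (Or.inr _), hpow0]
    rw [hpow0]; exact pow_ne_zero _ (neg_ne_zero.2 hx)
  constructor
  · have h := hM (((C y * X - C x) ^ J * V).natTrailingDegree)
    rw [← trailingCoeff, trailingCoeff_mul, hT] at h
    have := hle (-x) V.trailingCoeff (by simpa using hV)
    rw [Int.cast_neg, abs_neg] at this
    exact this.trans h
  · have h := hM (((C y * X - C x) ^ J * V).natDegree)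
    rw [coeff_natDegree, leadingCoeff_mul, leadingCoeff_pow, hlead] at h
    exact (hle y V.leadingCoeff (by simpa using hV)).trans h

theorem linear_pow_dvd_of_map {x y : ℤ} (hxy : IsCoprime x y) (hy : y ≠ 0) {W : ℤ[X]} {J : ℕ}
    (h : (X - C ((x : ℚ) / y)) ^ J ∣ W.map (Int.castRingHom ℚ)) : (C y * X - C x) ^ J ∣ W := by
  have hprim : ((C y * X - C x : ℤ[X]) ^ J).IsPrimitive := by
    induction J with
    | zero => simp
    | succ J ih =>
      rw [pow_succ]
      exact (ih ((pow_dvd_pow _ (Nat.le_succ J)).trans h)).mul (isPrimitive_linear hxy)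
  rw [IsPrimitive.Int.dvd_iff_map_cast_dvd_map_cast _ _ hprim]
  have hyQ : (y : ℚ) ≠ 0 := by exact_mod_cast hy
  have e : (C y * X - C x : ℤ[X]).map (Int.castRingHom ℚ)
      = C (y : ℚ) * (X - C ((x : ℚ) / y)) := by
    rw [mul_sub, ← C_mul, mul_div_cancel₀ _ hyQ]
    simp
  rw [Polynomial.map_pow, e, mul_pow, ← C_pow,
    (isUnit_C.2 (pow_ne_zero J hyQ).isUnit).mul_left_dvd]
  exact h

/-- A simultaneous zero of high order forces a high power of `y X - x` to divide the Wronskian. -/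
theorem exists_hasseDeriv_ne_zero {A B : ℤ[X]} (hW : wronskian A B ≠ 0) {D : ℕ} {M : ℝ}
    (hA : A.natDegree < D)
    (hB : B.natDegree < D) (hAc : ∀ i, |(A.coeff i : ℝ)| ≤ M) (hBc : ∀ i, |(B.coeff i : ℝ)| ≤ M)
    {x y : ℤ} (hx : x ≠ 0) (hy : y ≠ 0) (hxy : IsCoprime x y) (u : ℚ) {J : ℕ}
    (hJ : 4 * (D : ℝ) ^ 2 * M ^ 2 < |(x : ℝ)| ^ J ∨ 4 * (D : ℝ) ^ 2 * M ^ 2 < |(y : ℝ)| ^ J) :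
    ∃ j ≤ J, (hasseDeriv j (A.map (Int.castRingHom ℚ) - C u * B.map (Int.castRingHom ℚ))).eval
      ((x : ℚ) / y) ≠ 0 := by
  by_contra! hcon
  set ι := Int.castRingHom ℚ
  set P := A.map ι - C u * B.map ι with hP
  have h1 : (X - C ((x : ℚ) / y)) ^ (J + 1) ∣ P := by
    rw [X_sub_C_pow_dvd_iff, X_pow_dvd_iff]
    intro d hd
    rw [← taylor_apply, taylor_coeff]
    exact hcon d (by omega)
  have h2 : (X - C ((x : ℚ) / y)) ^ J ∣ (wronskian A B).map ι := by
    have e : (wronskian A B).map ι = P * derivative (B.map ι) - derivative P * B.map ι := by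
      simp [wronskian, derivative_map, hP]
      ring
    have h5 := pow_sub_one_dvd_derivative_of_pow_dvd h1
    rw [Nat.add_sub_cancel] at h5
    rw [e]
    exact dvd_sub (((pow_dvd_pow _ (Nat.le_succ J)).trans h1).mul_right _) (h5.mul_right _)
  have h3 := linear_pow_dvd_of_map hxy hy h2
  have h4 := pow_le_of_linear_pow_dvd hx hW (abs_coeff_wronskian_le hA hB hAc hBc) h3 hy
  rcases hJ with h | h <;> linarith [h4.1, h4.2]

theorem exists_int_eq_mul_eval_hasseDeriv {A : ℤ[X]} {D : ℕ} (hA : A.natDegree < D) (j : ℕ)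
    (x : ℤ) {y : ℤ} (hy : y ≠ 0) :
    ∃ m : ℤ, (y : ℝ) ^ D * (hasseDeriv j (A.map (Int.castRingHom ℝ))).eval ((x : ℝ) / y) = m := by
  refine ⟨∑ i ∈ Finset.range D, (i.choose j : ℤ) * A.coeff i * (x ^ (i - j) * y ^ (D - (i - j))),
    ?_⟩
  have hyR : (y : ℝ) ≠ 0 := by exact_mod_cast hy
  rw [eval_hasseDeriv_eq_sum _ (natDegree_map_le.trans_lt hA), Finset.mul_sum]
  push_cast
  refine Finset.sum_congr rfl fun i hi => ?_
  rw [Finset.mem_range] at hi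
  have e : (y : ℝ) ^ D = y ^ (D - (i - j)) * y ^ (i - j) := by
    rw [← pow_add]; congr 1; omega
  rw [coeff_map, e, div_pow]
  simp only [eq_intCast]
  field_simp

theorem cast_eval_hasseDeriv (A : ℤ[X]) (j : ℕ) (q : ℚ) :
    (((hasseDeriv j (A.map (Int.castRingHom ℚ))).eval q : ℚ) : ℝ)
      = (hasseDeriv j (A.map (Int.castRingHom ℝ))).eval (q : ℝ) := by
  rw [eval_hasseDeriv_eq_sum _ (natDegree_map_le.trans_lt (Nat.lt_succ_self _)),
    eval_hasseDeriv_eq_sum _ (natDegree_map_le.trans_lt (Nat.lt_succ_self _))]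
  push_cast
  simp

theorem abs_eval_hasseDeriv_le {P : ℝ[X]} {D : ℕ} (hP : P.natDegree < D) {N K : ℝ}
    (hN : ∀ i, |P.coeff i| ≤ N) (hK : 1 ≤ K) {u : ℝ} (hu : |u| ≤ K) (j : ℕ) :
    |(hasseDeriv j P).eval u| ≤ D * (2 ^ D * N * K ^ (D - 1)) := by
  have hN0 : 0 ≤ N := (abs_nonneg _).trans (hN 0)
  rw [eval_hasseDeriv_eq_sum _ hP]
  refine (Finset.abs_sum_le_sum_abs _ _).trans ((Finset.sum_le_card_nsmul _ _
    (2 ^ D * N * K ^ (D - 1)) fun i hi => ?_).trans (by simp))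
  rw [Finset.mem_range] at hi
  rw [abs_mul, abs_mul, Nat.abs_cast, abs_pow]
  have h1 : ((i.choose j : ℕ) : ℝ) ≤ 2 ^ D := by
    exact_mod_cast (Nat.choose_le_two_pow i j).trans (Nat.pow_le_pow_right (by norm_num) hi.le)
  have h2 : |u| ^ (i - j) ≤ K ^ (D - 1) :=
    (pow_le_pow_left₀ (abs_nonneg _) hu _).trans (pow_le_pow_right₀ hK (by omega))
  have h3 := hN i
  gcongr

theorem abs_eval_hasseDeriv_le_of_pow_dvd {P : ℝ[X]} {D : ℕ} (hP : P.natDegree < D) {N K : ℝ}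
    (hN : ∀ i, |P.coeff i| ≤ N) (hK : 1 ≤ K) {α u : ℝ} (hα : |α| ≤ K) {r : ℕ}
    (hr : (X - C α) ^ r ∣ P) (hu : |u - α| ≤ 1) {j J : ℕ} (hj : j ≤ J) :
    |(hasseDeriv j P).eval u|
      ≤ D ^ 2 * (4 ^ D * N * K ^ (D - 1)) * |u - α| ^ (r - J) := by
  have hN0 : 0 ≤ N := (abs_nonneg _).trans (hN 0)
  have e : (hasseDeriv j P).eval u = (hasseDeriv j (taylor α P)).eval (u - α) := by
    rw [← taylor_coeff, ← taylor_coeff, taylor_taylor, sub_add_cancel]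
  rw [X_sub_C_pow_dvd_iff, ← taylor_apply, X_pow_dvd_iff] at hr
  rw [e, eval_hasseDeriv_eq_sum _ (D := D) (by rwa [natDegree_taylor])]
  refine (Finset.abs_sum_le_sum_abs _ _).trans ((Finset.sum_le_card_nsmul _ _
    (2 ^ D * (D * (2 ^ D * N * K ^ (D - 1))) * |u - α| ^ (r - J)) fun i hi => ?_).trans
      (le_of_eq ?_))
  · rw [Finset.mem_range] at hi
    rw [abs_mul, abs_mul, Nat.abs_cast, abs_pow]
    by_cases hir : i < r
    · rw [hr i hir]
      simp only [abs_zero, mul_zero, zero_mul]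
      positivity
    have h1 : ((i.choose j : ℕ) : ℝ) ≤ 2 ^ D := by
      exact_mod_cast (Nat.choose_le_two_pow i j).trans (Nat.pow_le_pow_right (by norm_num) hi.le)
    have h2 : |u - α| ^ (i - j) ≤ |u - α| ^ (r - J) :=
      pow_le_pow_of_le_one (abs_nonneg _) hu (by omega)
    have h3 : |(taylor α P).coeff i| ≤ D * (2 ^ D * N * K ^ (D - 1)) := by
      rw [taylor_coeff]
      exact abs_eval_hasseDeriv_le hP hN hK hα i
    gcongr
  · rw [Finset.card_range, nsmul_eq_mul, (by norm_num : (4 : ℝ) = 2 * 2), mul_pow]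
    ring

theorem thue_principle {a b c : ℤ} {n k : ℕ} (hk : 0 < k) (hkn : k < n) (hn : 2 ≤ n) {α H : ℝ}
    (hirr : Irreducible (C a * X ^ n + C b * X ^ k + C c : ℤ[X]))
    (hα : a * α ^ n + b * α ^ k + c = 0) (ha0 : a ≠ 0)
    (ha : |(a : ℝ)| ≤ H) (hb : |(b : ℝ)| ≤ H) (hc : |(c : ℝ)| ≤ H) (hαH : |α| ≤ 2 * H)
    {t D J : ℕ} (ht : 0 < t) (hD : D = 2 * n * t)
    {x₀ y₀ x₁ y₁ : ℤ} (hx₀ : 0 < x₀) (hy₀ : 0 < y₀) (hy₁ : 0 < y₁)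
    (hco : IsCoprime x₀ y₀) (hδ : |(x₀ : ℝ) / y₀ - α| ≤ 1)
    (hJ : 4 * (D : ℝ) ^ 2 * ((8 * H) ^ (3 * D)) ^ 2 < (x₀ : ℝ) ^ J ∨
      4 * (D : ℝ) ^ 2 * ((8 * H) ^ (3 * D)) ^ 2 < (y₀ : ℝ) ^ J) :
    1 ≤ (y₀ : ℝ) ^ D * y₁ * ((16 * H) ^ (4 * D)
      * (|(x₀ : ℝ) / y₀ - α| ^ (3 * t - J) + |(x₁ : ℝ) / y₁ - α|)) := by
  have hH1 : 1 ≤ H := by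
    refine le_trans ?_ ha
    rw [← Int.cast_abs]
    exact_mod_cast Int.one_le_abs ha0
  obtain ⟨A, B, hAB, hA, hB, hAc, hBc, hvan⟩ :=
    exists_auxiliary_polynomials hk hkn hα ha0 ha hb hc ht hD
  set f : ℤ[X] := C a * X ^ n + C b * X ^ k + C c with hf
  have hdeg : f.natDegree = n := by
    have := trinomial_natDegree (k := 0) (u := c) (v := b) hk hkn ha0
    have e : f = trinomial 0 k n c b a := by rw [hf, trinomial]; ring
    rwa [← e] at this
  have hroot : (f.map (Int.castRingHom ℝ)).IsRoot α := by simp [hf, hα]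
  set A' := A.map (Int.castRingHom ℝ) with hA'
  set B' := B.map (Int.castRingHom ℝ) with hB'
  have hdvd : (X - C α) ^ (3 * t) ∣ A' - C α * B' := by
    rw [X_sub_C_pow_dvd_iff, X_pow_dvd_iff]
    intro d hd
    rw [← taylor_apply, taylor_coeff, ← smul_eq_C_mul, map_sub, map_smul, eval_sub, eval_smul,
      hvan d hd, smul_eq_mul, sub_self]
  have hDn : D < n * (3 * t) := by
    rw [hD]
    nlinarith [mul_pos (by omega : 0 < n) ht]
  have hW : wronskian A B ≠ 0 :=
    wronskian_ne_zero_of_pow_dvd hirr (by omega) hroot hAB (by rw [hdeg]; omega)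
      (by rw [hdeg]; omega) hdvd
  have hxy : ∀ w : ℤ, 0 < w → |(w : ℝ)| = w := fun w hw => abs_of_pos (by exact_mod_cast hw)
  obtain ⟨j, hj, hne⟩ := exists_hasseDeriv_ne_zero hW hA hB hAc hBc hx₀.ne' hy₀.ne' hco
    ((x₁ : ℚ) / y₁) (J := J) (by rwa [hxy _ hx₀, hxy _ hy₀])
  set u₀ : ℝ := (x₀ : ℝ) / y₀ with hu₀
  set u₁ : ℝ := (x₁ : ℝ) / y₁ with hu₁
  obtain ⟨mA, hmA⟩ := exists_int_eq_mul_eval_hasseDeriv hA j x₀ hy₀.ne'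
  obtain ⟨mB, hmB⟩ := exists_int_eq_mul_eval_hasseDeriv hB j x₀ hy₀.ne'
  rw [← hA', ← hu₀] at hmA
  rw [← hB', ← hu₀] at hmB
  set VA := (hasseDeriv j A').eval u₀ with hVA
  set VB := (hasseDeriv j B').eval u₀ with hVB
  have hy₀R : (0 : ℝ) < y₀ := by exact_mod_cast hy₀
  have hy₁R : (0 : ℝ) < y₁ := by exact_mod_cast hy₁
  have hneR : VA - u₁ * VB ≠ 0 := by
    intro h
    apply hne
    rw [← smul_eq_C_mul, map_sub, map_smul, eval_sub, eval_smul, smul_eq_mul]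
    have hq : (((x₀ : ℚ) / y₀ : ℚ) : ℝ) = u₀ := by push_cast; rfl
    rw [← (Rat.cast_injective (α := ℝ)).eq_iff]
    rw [Rat.cast_sub, Rat.cast_mul, cast_eval_hasseDeriv, cast_eval_hasseDeriv, hq]
    push_cast
    exact h
  have h_int : (y₀ : ℝ) ^ D * y₁ * (VA - u₁ * VB) = ((y₁ * mA - x₁ * mB : ℤ) : ℝ) := by
    push_cast
    rw [← hmA, ← hmB, hu₁]
    field_simp
  have hge : 1 ≤ (y₀ : ℝ) ^ D * y₁ * |VA - u₁ * VB| := by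
    have h1 : ((y₁ * mA - x₁ * mB : ℤ) : ℝ) ≠ 0 := by
      rw [← h_int]; positivity
    have h2 : (1 : ℝ) ≤ |((y₁ * mA - x₁ * mB : ℤ) : ℝ)| := by
      rw [← Int.cast_abs]
      exact_mod_cast Int.one_le_abs (by exact_mod_cast h1)
    rwa [← h_int, abs_mul, abs_of_pos (by positivity)] at h2
  have hc : ∀ (P : ℤ[X]) i, (P.map (Int.castRingHom ℝ)).coeff i = P.coeff i := by
    intro P i; simp
  set Y : ℝ := (8 * H) ^ (3 * D) with hY
  have hY0 : 0 < Y := by positivity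
  have hDpos : 0 < D := by rw [hD]; positivity
  have hD2 : (D : ℝ) ≤ 2 ^ D := by exact_mod_cast Nat.lt_two_pow_self.le
  have hsplit : ∀ z : ℝ, z * z ^ (D - 1) = z ^ D := fun z => by
    rw [← pow_succ', Nat.sub_add_cancel hDpos]
  have hδu : |u₀| ≤ 3 * H := by
    have := abs_add_le (u₀ - α) α
    rw [sub_add_cancel] at this
    linarith
  have hP : |VA - α * VB| ≤ (16 * H) ^ (4 * D) * |u₀ - α| ^ (3 * t - J) := by
    have h1 : (A' - C α * B').natDegree < D := by
      refine (natDegree_sub_le _ _).trans_lt (max_lt (natDegree_map_le.trans_lt hA) ?_)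
      exact (natDegree_C_mul_le _ _).trans_lt (natDegree_map_le.trans_lt hB)
    have h2 : ∀ i, |(A' - C α * B').coeff i| ≤ 3 * H * Y := by
      intro i
      rw [coeff_sub, coeff_C_mul, hc, hc]
      refine (abs_sub _ _).trans ?_
      rw [abs_mul]
      have := mul_le_mul hαH (hBc i) (abs_nonneg _) (by positivity)
      nlinarith [hAc i]
    have h3 := abs_eval_hasseDeriv_le_of_pow_dvd h1 h2 (by linarith : 1 ≤ 2 * H) hαH hdvd hδ hj
    rw [← smul_eq_C_mul, map_sub, map_smul, eval_sub, eval_smul, smul_eq_mul] at h3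
    refine h3.trans (mul_le_mul_of_nonneg_right ?_ (by positivity))
    calc (D : ℝ) ^ 2 * (4 ^ D * (3 * H * Y) * (2 * H) ^ (D - 1))
        ≤ (2 ^ D) ^ 2 * (4 ^ D * (4 * H * Y) * (2 * H) ^ (D - 1)) := by
          gcongr; norm_num
      _ = 2 * 2 ^ D * 4 ^ D * 2 ^ D * Y * ((2 * H) * (2 * H) ^ (D - 1)) := by ring
      _ = 2 ^ 1 * 2 ^ D * 4 ^ D * 2 ^ D * Y * (2 * H) ^ D := by rw [hsplit, pow_one]
      _ ≤ 2 ^ D * 2 ^ D * 4 ^ D * 2 ^ D * Y * (2 * H) ^ D := by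
          gcongr
          · norm_num
          · omega
      _ ≤ 2 ^ D * (2 ^ D * 2 ^ D * 4 ^ D * 2 ^ D * Y * (2 * H) ^ D) := by
          refine le_mul_of_one_le_left (by positivity) (one_le_pow₀ (by norm_num))
      _ = (16 * H) ^ (4 * D) := by
          rw [hY, pow_mul, pow_mul, ← mul_pow, ← mul_pow, ← mul_pow, ← mul_pow, ← mul_pow,
            ← mul_pow]
          congr 1; ring
  have hQ : |VB| ≤ (16 * H) ^ (4 * D) := by
    have h3 := abs_eval_hasseDeriv_le (natDegree_map_le.trans_lt hB) (P := B')
      (fun i => by rw [hc]; exact hBc i) (by linarith : 1 ≤ 3 * H) hδu j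
    refine h3.trans ?_
    calc (D : ℝ) * (2 ^ D * Y * (3 * H) ^ (D - 1))
        ≤ 2 ^ D * (2 ^ D * Y * (3 * H) ^ D) := by
          gcongr
          · linarith
          · omega
      _ ≤ 2 ^ D * (2 ^ D * Y * (32 * H) ^ D) := by gcongr; norm_num
      _ = (16 * H) ^ (4 * D) := by
          rw [hY, pow_mul, pow_mul, ← mul_pow, ← mul_pow, ← mul_pow]
          congr 1; ring
  refine hge.trans (mul_le_mul_of_nonneg_left ?_ (by positivity))
  calc |VA - u₁ * VB| = |(VA - α * VB) + (α - u₁) * VB| := by congr 1; ring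
    _ ≤ |VA - α * VB| + |u₁ - α| * |VB| := by
        refine (abs_add_le _ _).trans ?_
        rw [abs_mul, abs_sub_comm α]
    _ ≤ _ := by
        rw [mul_add, mul_comm |u₁ - α|]
        gcongr

theorem thue_gap {a b c : ℤ} {n k : ℕ} (hk : 0 < k) (hkn : k < n) (hn : 6 ≤ n) {α H : ℝ}
    (hirr : Irreducible (C a * X ^ n + C b * X ^ k + C c : ℤ[X]))
    (hα : a * α ^ n + b * α ^ k + c = 0) (ha0 : a ≠ 0)
    (ha : |(a : ℝ)| ≤ H) (hb : |(b : ℝ)| ≤ H) (hc : |(c : ℝ)| ≤ H) (hαH : |α| ≤ 2 * H)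
    {w L Λ : ℝ} (hw : 6 * n * H = Real.exp w)
    {s : ℕ} (hs : 0 < s) {x₀ y₀ x₁ y₁ : ℤ} (hx₀ : 0 < x₀) (hy₀ : 0 < y₀) (hy₁ : 0 < y₁)
    (hco : IsCoprime x₀ y₀) (hL : (x₀ : ℝ) = Real.exp L ∨ (y₀ : ℝ) = Real.exp L)
    (hyL : (y₀ : ℝ) ≤ Real.exp L) (hyΛ : (y₁ : ℝ) ≤ Real.exp Λ)
    (h₀ : |(x₀ : ℝ) / y₀ - α| ≤ Real.exp ((n + 1) * w - n * L))
    (h₁ : |(x₁ : ℝ) / y₁ - α| ≤ Real.exp ((n + 1) * w - n * Λ))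
    (hLw : 42 * n * w < L) (hΛ1 : 7.5 * s * L ≤ Λ) (hΛ2 : Λ ≤ (2 * n - 0.8) * s * L) : False := by
  have hH1 : 1 ≤ H := by
    refine le_trans ?_ ha
    rw [← Int.cast_abs]
    exact_mod_cast Int.one_le_abs ha0
  have hn' : (6 : ℝ) ≤ n := by exact_mod_cast hn
  have hs' : (1 : ℝ) ≤ s := by exact_mod_cast hs
  have hnH : 36 * H ≤ Real.exp w := by rw [← hw]; nlinarith
  have hw2 : Real.log 36 ≤ w := by
    rw [Real.log_le_iff_le_exp (by norm_num)]; linarith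
  have hlog36 : 2 ≤ Real.log 36 := by
    rw [Real.le_log_iff_exp_le (by norm_num)]
    have := Real.exp_one_lt_d9
    have e : Real.exp 2 = Real.exp 1 * Real.exp 1 := by rw [← Real.exp_add]; norm_num
    rw [e]; nlinarith [Real.exp_pos 1]
  have hL0 : 0 < L := by nlinarith
  have hnw : 42 * (n * w) ≤ L := by linarith
  have hnw0 : 12 ≤ n * w := by nlinarith
  obtain ⟨D, hD⟩ : ∃ D, D = 2 * n * (3 * s) := ⟨_, rfl⟩
  have hDR : (D : ℝ) = 6 * n * s := by rw [hD]; push_cast; ring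
  have hDpos : 0 < D := by rw [hD]; positivity
  have hbnd : (16 * H) ^ (4 * D) ≤ Real.exp (4 * D * w) := by
    rw [show (4 * D * w : ℝ) = ((4 * D : ℕ) : ℝ) * w by push_cast; ring, Real.exp_nat_mul]
    exact pow_le_pow_left₀ (by linarith) (by linarith) _
  have hJ' : 4 * (D : ℝ) ^ 2 * ((8 * H) ^ (3 * D)) ^ 2 < Real.exp L ^ s := by
    have h1 : (D : ℝ) ≤ 2 ^ D := by exact_mod_cast Nat.lt_two_pow_self.le
    have h2 : 4 * (D : ℝ) ^ 2 ≤ 36 ^ D := by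
      calc 4 * (D : ℝ) ^ 2 ≤ 4 ^ 1 * (2 ^ D) ^ 2 := by rw [pow_one]; gcongr
        _ ≤ 4 ^ D * (2 ^ D) ^ 2 := by 
          gcongr
          · norm_num
          · omega
        _ = 16 ^ D := by rw [← pow_mul, mul_comm D 2, pow_mul, ← mul_pow]; norm_num
        _ ≤ 36 ^ D := by gcongr; norm_num
    calc 4 * (D : ℝ) ^ 2 * ((8 * H) ^ (3 * D)) ^ 2
        ≤ Real.exp w ^ D * (Real.exp w ^ (3 * D)) ^ 2 := by
          gcongr
          · exact h2.trans (by gcongr; linarith)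
          · linarith
      _ = Real.exp ((7 * D) * w) := by
          rw [← pow_mul, ← pow_add, ← Real.exp_nat_mul]
          congr 1; push_cast; ring
      _ < Real.exp L ^ s := by
          rw [← Real.exp_nat_mul, Real.exp_lt_exp, hDR]
          nlinarith
  have hδ : |(x₀ : ℝ) / y₀ - α| ≤ 1 := by
    refine h₀.trans ?_
    rw [Real.exp_le_one_iff]
    nlinarith
  have key := thue_principle hk hkn (by omega) hirr hα ha0 ha hb hc hαH (t := 3 * s)
    (by omega) hD (J := s) (x₁ := x₁) hx₀ hy₀ hy₁ hco hδ
    (by rcases hL with h | h <;> rw [h] <;> tauto)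
  rw [show 3 * (3 * s) - s = 8 * s by omega] at key
  have hy0R : (0 : ℝ) < y₀ := by exact_mod_cast hy₀
  have hy1R : (0 : ℝ) < y₁ := by exact_mod_cast hy₁
  have hup : (y₀ : ℝ) ^ D * y₁ * ((16 * H) ^ (4 * D)
      * (|(x₀ : ℝ) / y₀ - α| ^ (8 * s) + |(x₁ : ℝ) / y₁ - α|))
      ≤ Real.exp L ^ D * Real.exp Λ * (Real.exp (4 * D * w)
      * (Real.exp ((n + 1) * w - n * L) ^ (8 * s) + Real.exp ((n + 1) * w - n * Λ))) := by
    gcongr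
  replace hup := key.trans hup
  rw [← Real.exp_nat_mul, ← Real.exp_nat_mul, ← Real.exp_add, mul_add, mul_add, ← Real.exp_add,
    ← Real.exp_add, ← Real.exp_add, ← Real.exp_add] at hup
  have hhalf : Real.exp (-1) < 1 / 2 := by
    rw [Real.exp_neg, one_div]
    apply inv_strictAnti₀ (by norm_num)
    have := Real.exp_one_gt_d9
    linarith
  have hw0 : 0 < w := by linarith
  have hn0 : (0 : ℝ) < n := by linarith
  have hsn0 : (0 : ℝ) ≤ s * n := by positivity
  have hsL0 : 0 < s * L := by positivity
  have hsw : 42 * (n * s * w) ≤ s * L := by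
    have := mul_le_mul_of_nonneg_left hnw (by linarith : (0 : ℝ) ≤ s)
    linarith
  have hsw6 : 6 * (s * w) ≤ n * s * w := by
    have := mul_le_mul_of_nonneg_right hn' (by positivity : 0 ≤ s * w)
    linarith
  have hsw1 : w ≤ s * w := le_mul_of_one_le_left hw0.le hs'
  have hnsw1 : n * w ≤ n * s * w := by
    have := le_mul_of_one_le_left (by positivity : 0 ≤ n * w) hs'
    linarith
  have hnsL : 6 * (s * L) ≤ n * (s * L) := mul_le_mul_of_nonneg_right hn' hsL0.le
  have hΛ3 : (n - 1) * (7.5 * s * L) ≤ (n - 1) * Λ :=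
    mul_le_mul_of_nonneg_left hΛ1 (by linarith)
  clear * - hw0 hsL0 hsw hsw6 hsw1 hnsw1 hnsL hΛ3 hΛ2 hDR hnw0 hup hhalf
  have b1 : (D : ℝ) * L + Λ + (4 * D * w + (8 * s : ℕ) * ((n + 1) * w - n * L)) ≤ -1 := by
    rw [hDR]; push_cast
    linarith
  have b2 : (D : ℝ) * L + Λ + (4 * D * w + ((n + 1) * w - n * Λ)) ≤ -1 := by
    rw [hDR]
    linarith
  have e1 := Real.exp_le_exp.2 b1
  have e2 := Real.exp_le_exp.2 b2
  linarith

/-- Positive solutions of `|F| = 1` other than `(1, 1)` on the branch where the logarithmic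
derivative of `F` is nonnegative. -/
structure IsBranchSolution (a b c : ℤ) (p q : ℕ) (x y : ℤ) : Prop where
  x_pos : 0 < x
  y_pos : 0 < y
  ne_one : ¬ (x = 1 ∧ y = 1)
  abs_eq_one : |a * x ^ (p + q) + b * (x ^ q * y ^ p) + c * y ^ (p + q)| = 1
  branch : q * (c * y ^ (p + q)) ≤ p * (a * x ^ (p + q))

namespace IsBranchSolution

variable {a b c : ℤ} {p q : ℕ} {x y x' y' : ℤ}

theorem isCoprime (hp : 0 < p) (hq : 0 < q) (h : IsBranchSolution a b c p q x y) :
    IsCoprime x y := by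
  rw [Int.isCoprime_iff_gcd_eq_one, ← Nat.dvd_one, ← Int.natCast_dvd_natCast]
  have hx : ((Int.gcd x y : ℕ) : ℤ) ∣ x := Int.gcd_dvd_left ..
  have hy : ((Int.gcd x y : ℕ) : ℤ) ∣ y := Int.gcd_dvd_right ..
  have h1 := h.abs_eq_one
  push_cast
  rw [← h1, dvd_abs]
  refine dvd_add (dvd_add ?_ ?_) ?_
  · exact (hx.trans (dvd_pow_self x (by omega))).mul_left _
  · exact ((hx.trans (dvd_pow_self x (by omega))).mul_right _).mul_left _
  · exact (hy.trans (dvd_pow_self y (by omega))).mul_left _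

theorem div_ne_div (hp : 0 < p) (hq : 0 < q) (h : IsBranchSolution a b c p q x y)
    (h' : IsBranchSolution a b c p q x' y') (hne : ¬ (x = x' ∧ y = y')) :
    x' * y ≠ x * y' := by
  intro he
  apply hne
  have c1 := h.isCoprime hp hq
  have c2 := h'.isCoprime hp hq
  have d1 : x ∣ x' := c1.dvd_of_dvd_mul_right (Dvd.intro _ he.symm)
  have d2 : x' ∣ x := c2.dvd_of_dvd_mul_right (Dvd.intro _ he)
  have e := Int.dvd_antisymm h.x_pos.le h'.x_pos.le d1 d2
  subst e
  exact ⟨rfl, mul_left_cancel₀ h.x_pos.ne' he⟩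

end IsBranchSolution

theorem mul_exp_sub_le {A C t p q : ℝ} (hA : 0 ≤ A) (ht : 0 ≤ t) (hp : 0 ≤ p) (hq : 0 ≤ q)
    (h : q * C ≤ p * A) :
    A * (Real.exp (p * t) - 1 - p * t)
      ≤ A * (Real.exp (p * t) - 1) + C * (Real.exp (-(q * t)) - 1) := by
  have h1 := Real.add_one_le_exp (-(q * t))
  have h2 : Real.exp (-(q * t)) ≤ 1 := Real.exp_le_one_iff.2 (by nlinarith [mul_nonneg hq ht])
  have h3 := mul_le_mul_of_nonneg_right h ht
  rcases le_total 0 C with hC | hC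
  · nlinarith [mul_le_mul_of_nonneg_left h1 hC]
  · nlinarith [mul_nonneg_of_nonpos_of_nonpos hC (sub_nonpos.2 h2),
      mul_nonneg (mul_nonneg hp ht) hA]

theorem gap_forward {A C t p q : ℝ} (hA : 0 ≤ A) (ht : 0 ≤ t) (hp : 0 ≤ p) (hq : 0 ≤ q)
    (h : q * C ≤ p * A)
    (hφ : A * (Real.exp (p * t) - 1) + C * (Real.exp (-(q * t)) - 1) ≤ 2) :
    A * (1 - (1 + p * t) * Real.exp (-(p * t))) ≤ 2 ∧
      (C < 0 → -C * (1 - Real.exp (-(q * t))) ≤ 2) := by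
  have h1 := mul_exp_sub_le hA ht hp hq h
  have hz : 0 ≤ p * t := mul_nonneg hp ht
  have h3 := Real.add_one_le_exp (p * t)
  constructor
  · refine le_trans (mul_le_mul_of_nonneg_left ?_ hA) (h1.trans hφ)
    have h2 : Real.exp (-(p * t)) * Real.exp (p * t) = 1 := by rw [← Real.exp_add]; simp
    have h4 : Real.exp (-(p * t)) ≤ 1 := Real.exp_le_one_iff.2 (by linarith)
    nlinarith [mul_nonneg (sub_nonneg.2 h4) (sub_nonneg.2 h3)]
  · intro _
    nlinarith [mul_nonneg hA (by linarith : 0 ≤ Real.exp (p * t) - 1)]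

theorem gap_backward {A C t p q : ℝ} (hA : 0 ≤ A) (ht : 0 ≤ t) (hp : 0 ≤ p) (hq : 0 ≤ q)
    (h : q * (C * Real.exp (q * t)) ≤ p * (A * Real.exp (-(p * t))))
    (hφ : A * (1 - Real.exp (-(p * t))) + C * (1 - Real.exp (q * t)) ≤ 2) :
    A * (1 - (1 + p * t) * Real.exp (-(p * t))) ≤ 2 ∧
      (C < 0 → -C * (1 - Real.exp (-(q * t))) ≤ 2) := by
  have hE : 0 < Real.exp (-(p * t)) := Real.exp_pos _
  have h1 := mul_exp_sub_le (mul_nonneg hA hE.le) ht hp hq h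
  have h2 : Real.exp (-(p * t)) * Real.exp (p * t) = 1 := by rw [← Real.exp_add]; simp
  have h3 : Real.exp (-(q * t)) * Real.exp (q * t) = 1 := by rw [← Real.exp_add]; simp
  constructor
  · have e1 : A * Real.exp (-(p * t)) * (Real.exp (p * t) - 1 - p * t)
        = A * (1 - (1 + p * t) * Real.exp (-(p * t))) := by linear_combination A * h2
    have e2 : A * Real.exp (-(p * t)) * (Real.exp (p * t) - 1)
        + C * Real.exp (q * t) * (Real.exp (-(q * t)) - 1)
        = A * (1 - Real.exp (-(p * t))) + C * (1 - Real.exp (q * t)) := by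
      linear_combination A * h2 + C * h3
    linarith
  · intro hC
    have hp0 : Real.exp (-(p * t)) ≤ 1 := Real.exp_le_one_iff.2 (by nlinarith [mul_nonneg hp ht])
    have h5 : -C * (1 - Real.exp (-(q * t))) ≤ C * (1 - Real.exp (q * t)) := by
      have : 2 ≤ Real.exp (-(q * t)) + Real.exp (q * t) := by
        nlinarith [sq_nonneg (Real.exp (-(q * t)) - Real.exp (q * t)), Real.exp_pos (-(q * t)),
          Real.exp_pos (q * t)]
      nlinarith
    nlinarith [mul_nonneg hA (sub_nonneg.2 hp0)]

theorem sq_le_of_le_one {z : ℝ} (hz : 0 ≤ z) (hz1 : z ≤ 1) :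
    z ^ 2 / 4 ≤ 1 - (1 + z) * Real.exp (-z) := by
  have h := Real.sum_le_exp_of_nonneg hz 4
  simp [Finset.sum_range_succ, Nat.factorial] at h
  have h2 : Real.exp (-z) * Real.exp z = 1 := by rw [← Real.exp_add]; simp
  have hpos := Real.exp_pos (-z)
  have h3 : Real.exp (-z) * (1 + z + z ^ 2 / 2 + z ^ 3 / 6) ≤ 1 := by nlinarith
  have h4 : (1 + z) ≤ (1 - z ^ 2 / 4) * (1 + z + z ^ 2 / 2 + z ^ 3 / 6) := by
    have : 0 ≤ 6 - 2 * z - 3 * z ^ 2 - z ^ 3 := by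
      nlinarith [pow_le_one₀ hz hz1 (n := 2), pow_le_one₀ hz hz1 (n := 3)]
    nlinarith [mul_nonneg (sq_nonneg z) this]
  nlinarith [mul_le_mul_of_nonneg_left h4 hpos.le, pow_le_one₀ hz hz1 (n := 2)]

theorem quarter_le_of_one_le {z : ℝ} (hz : 1 ≤ z) :
    1 / 4 < 1 - (1 + z) * Real.exp (-z) := by
  have h2 : Real.exp (-z) * Real.exp z = 1 := by rw [← Real.exp_add]; simp
  have hpos := Real.exp_pos (-z)
  have h3 := Real.add_one_le_exp (z - 1)
  have e : Real.exp z = Real.exp 1 * Real.exp (z - 1) := by rw [← Real.exp_add]; ring_nf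
  have h1 := Real.exp_one_gt_d9
  have h4 : 4 / 3 * (1 + z) < Real.exp z := by rw [e]; nlinarith
  nlinarith

theorem sq_mul_le_of_gap {A C t p q : ℝ} (hA : 1 ≤ A) (ht : 0 < t) (hp : 1 ≤ p) (hq : 1 ≤ q)
    (h : q * C ≤ p * A) (hA2 : A * (1 - (1 + p * t) * Real.exp (-(p * t))) ≤ 2)
    (hC2 : C < 0 → -C * (1 - Real.exp (-(q * t))) ≤ 2) :
    (A < 8 ∧ |C| * q < 8 * (p + q)) ∨ (t ≤ 1 ∧ A * t ^ 2 ≤ 8 ∧ |C| * t ^ 2 ≤ 8) := by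
  rcases le_or_gt 1 (p * t) with hz | hz
  · left
    have h1 := quarter_le_of_one_le hz
    have hA8 : A < 8 := by nlinarith
    refine ⟨hA8, ?_⟩
    rcases lt_or_ge C 0 with hC | hC
    · rw [abs_of_neg hC]
      have h2 := hC2 hC
      have h3 := Real.add_one_le_exp (q * t)
      have h4 : Real.exp (-(q * t)) * Real.exp (q * t) = 1 := by rw [← Real.exp_add]; simp
      have hpos := Real.exp_pos (-(q * t))
      have hqt : 0 < q * t := by positivity
      have h5 : Real.exp (-(q * t)) * (1 + q * t) ≤ 1 := by nlinarith
      have h6 : -C * (q * t) ≤ 2 * (1 + q * t) := by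
        have : -C * (1 - Real.exp (-(q * t))) * (1 + q * t) ≤ 2 * (1 + q * t) :=
          mul_le_mul_of_nonneg_right h2 (by linarith)
        nlinarith
      have h7 : -C * q ≤ 2 * p + 2 * q := by
        by_contra! hcon
        have := mul_lt_mul_of_pos_right hcon ht
        nlinarith
      linarith
    · rw [abs_of_nonneg hC]
      nlinarith
  · right
    have hpt : 0 ≤ p * t := by positivity
    have h1 := sq_le_of_le_one hpt hz.le
    have ht1 : t ≤ 1 := by nlinarith
    have hpA : p ^ 2 * (A * t ^ 2) ≤ 8 := by nlinarith
    refine ⟨ht1, ?_, ?_⟩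
    · exact (le_mul_of_one_le_left (by positivity) (one_le_pow₀ hp)).trans hpA
    rcases lt_or_ge C 0 with hC | hC
    · rw [abs_of_neg hC]
      have h2 := hC2 hC
      have hexp : t / 2 ≤ 1 - Real.exp (-(q * t)) := by
        have h3 := Real.add_one_le_exp t
        have h4 : Real.exp (-t) * Real.exp t = 1 := by rw [← Real.exp_add]; simp
        have h5 : Real.exp (-(q * t)) ≤ Real.exp (-t) := Real.exp_le_exp.2 (by nlinarith)
        have hpos := Real.exp_pos (-t)
        nlinarith
      nlinarith
    · rw [abs_of_nonneg hC]
      have : q * C * t ^ 2 ≤ p * A * t ^ 2 := mul_le_mul_of_nonneg_right h (sq_nonneg t)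
      have hCt : 0 ≤ C * t ^ 2 := by positivity
      have hAt : 0 ≤ A * t ^ 2 := by positivity
      have h3 : C * t ^ 2 ≤ q * (C * t ^ 2) := le_mul_of_one_le_left hCt hq
      have h4 : p * (A * t ^ 2) ≤ p ^ 2 * (A * t ^ 2) :=
        mul_le_mul_of_nonneg_right (by nlinarith) hAt
      linarith

namespace IsBranchSolution

variable {a b c : ℤ} {p q : ℕ} {x y x' y' : ℤ}

theorem eq_one_of_lt {n : ℕ} {a x : ℤ} (ha : 1 ≤ |a|) (hx : 0 < x)
    (h : |a| * x ^ n < 2 ^ n) : x = 1 := by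
  by_contra hne
  have h2 : (2 : ℤ) ≤ x := by omega
  have h3 : (2 : ℤ) ^ n ≤ x ^ n := pow_le_pow_left₀ (by norm_num) h2 n
  have h4 : x ^ n ≤ |a| * x ^ n := le_mul_of_one_le_left (by positivity) ha
  omega

/-- Rescaling `F` from one point to another. -/
theorem scale (hx : 0 < x) (hy : 0 < y) (hx' : 0 < x') (hy' : 0 < y') (E : ℝ)
    (hE : E = (x' * y : ℝ) / (y' * x)) :
    (a * x ^ (p + q) : ℝ) * E ^ p + b * (x ^ q * y ^ p) + c * y ^ (p + q) * (E⁻¹) ^ q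
      = (a * x' ^ (p + q) + b * (x' ^ q * y' ^ p) + c * y' ^ (p + q))
        * ((x ^ q * y ^ p) / (x' ^ q * y' ^ p)) := by
  have h1 : (x : ℝ) ≠ 0 := by exact_mod_cast hx.ne'
  have h2 : (y : ℝ) ≠ 0 := by exact_mod_cast hy.ne'
  have h3 : (x' : ℝ) ≠ 0 := by exact_mod_cast hx'.ne'
  have h4 : (y' : ℝ) ≠ 0 := by exact_mod_cast hy'.ne'
  rw [hE, inv_div, div_pow, div_pow, mul_pow, mul_pow, mul_pow, mul_pow]
  field_simp
  ring

theorem gap_first (hp : 0 < p) (hq : 0 < q) (hn : 6 ≤ p + q) (ha : 0 < a) (hc : c ≠ 0)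
    (h : IsBranchSolution a b c p q x y) (h' : IsBranchSolution a b c p q x' y')
    (hne : ¬ (x = x' ∧ y = y')) (hP : x ^ q * y ^ p ≤ x' ^ q * y' ^ p) :
    |Real.log ((x' * y : ℝ) / (y' * x))| ≤ 1 ∧
      (a * x ^ (p + q) : ℝ) * |Real.log ((x' * y : ℝ) / (y' * x))| ^ 2 ≤ 8 ∧
      |(c * y ^ (p + q) : ℝ)| * |Real.log ((x' * y : ℝ) / (y' * x))| ^ 2 ≤ 8 := by
  have hx : (0 : ℝ) < x := by exact_mod_cast h.x_pos
  have hy : (0 : ℝ) < y := by exact_mod_cast h.y_pos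
  have hx' : (0 : ℝ) < x' := by exact_mod_cast h'.x_pos
  have hy' : (0 : ℝ) < y' := by exact_mod_cast h'.y_pos
  have hpR : (1 : ℝ) ≤ p := by exact_mod_cast hp
  have hqR : (1 : ℝ) ≤ q := by exact_mod_cast hq
  set ρ := (x' * y : ℝ) / (y' * x) with hρ
  have hρ0 : 0 < ρ := by positivity
  have hρ1 : ρ ≠ 1 := by
    rw [hρ, Ne, div_eq_one_iff_eq (by positivity)]
    intro he
    apply h.div_ne_div hp hq h' hne
    have : x' * y = y' * x := by exact_mod_cast he
    linarith
  have hexp : Real.exp (Real.log ρ) = ρ := Real.exp_log hρ0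
  set u := Real.log ρ with hu
  have hu0 : u ≠ 0 := by
    intro hu0
    rw [hu0, Real.exp_zero] at hexp
    exact hρ1 hexp.symm
  set A : ℝ := a * x ^ (p + q) with hA
  set C : ℝ := c * y ^ (p + q) with hC
  have haR : (1 : ℝ) ≤ a := by exact_mod_cast ha
  have hx1 : (1 : ℝ) ≤ x := by exact_mod_cast h.x_pos
  have hA1 : 1 ≤ A := one_le_mul_of_one_le_of_one_le haR (one_le_pow₀ hx1)
  have hbr : q * C ≤ p * A := by have := h.branch; rw [hA, hC]; exact_mod_cast this
  have hbr' : (q * (c * y' ^ (p + q)) : ℝ) ≤ p * (a * x' ^ (p + q)) := by exact_mod_cast h'.branch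
  have hF : |A + b * (x ^ q * y ^ p) + C| = 1 := by
    rw [hA, hC]; exact_mod_cast h.abs_eq_one
  have hF' : |(a * x' ^ (p + q) + b * (x' ^ q * y' ^ p) + c * y' ^ (p + q) : ℝ)| = 1 := by
    exact_mod_cast h'.abs_eq_one
  have hPP : (x ^ q * y ^ p : ℝ) / (x' ^ q * y' ^ p) ≤ 1 := by
    rw [div_le_one (by positivity)]; exact_mod_cast hP
  have hPP0 : (0 : ℝ) < (x ^ q * y ^ p : ℝ) / (x' ^ q * y' ^ p) := by positivity
  have hsc := scale (a := a) (b := b) (c := c) (p := p) (q := q)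
    h.x_pos h.y_pos h'.x_pos h'.y_pos ρ hρ
  have hscb := scale (a := a) (b := 0) (c := 0) (p := p) (q := q)
    h.x_pos h.y_pos h'.x_pos h'.y_pos ρ hρ
  have hscc := scale (a := 0) (b := 0) (c := c) (p := p) (q := q)
    h.x_pos h.y_pos h'.x_pos h'.y_pos ρ hρ
  rw [← hA, ← hC] at hsc
  rw [← hA] at hscb
  rw [← hC] at hscc
  simp only [Int.cast_zero, zero_mul, add_zero, zero_add] at hscb hscc
  have hbrs : q * (C * (ρ⁻¹) ^ q) ≤ p * (A * ρ ^ p) := by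
    rw [hscb, hscc]
    nlinarith
  have hdiff : A * (ρ ^ p - 1) + C * ((ρ⁻¹) ^ q - 1) ≤ 2 := by
    set S : ℝ := a * x' ^ (p + q) + b * (x' ^ q * y' ^ p) + c * y' ^ (p + q)
    set κ : ℝ := (x ^ q * y ^ p : ℝ) / (x' ^ q * y' ^ p)
    have h1 : S * κ ≤ 1 := by
      rw [abs_eq one_pos.le] at hF'
      rcases hF' with h | h <;> rw [h] <;> linarith
    have h2 := abs_le.1 hF.le
    linarith [h2.1]
  have hdiff2 : A * (1 - ρ ^ p) + C * (1 - (ρ⁻¹) ^ q) ≤ 2 := by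
    set S : ℝ := a * x' ^ (p + q) + b * (x' ^ q * y' ^ p) + c * y' ^ (p + q)
    set κ : ℝ := (x ^ q * y ^ p : ℝ) / (x' ^ q * y' ^ p)
    have h1 : -1 ≤ S * κ := by
      rw [abs_eq one_pos.le] at hF'
      rcases hF' with h | h <;> rw [h] <;> linarith
    have h2 := abs_le.1 hF.le
    linarith [h2.2]
  have hmain : A * (1 - (1 + p * |u|) * Real.exp (-(p * |u|))) ≤ 2 ∧
      (C < 0 → -C * (1 - Real.exp (-(q * |u|))) ≤ 2) := by
    rw [← Real.exp_log hρ0, ← Real.exp_neg, ← hu] at hbrs hdiff hdiff2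
    rw [← Real.exp_nat_mul, ← Real.exp_nat_mul] at hbrs hdiff hdiff2
    rcases lt_or_gt_of_ne hu0 with hneg | hpos
    · rw [abs_of_neg hneg]
      apply gap_backward (by linarith) (by linarith) (by linarith) (by linarith)
      · simpa using hbrs
      · simpa using hdiff2
    · rw [abs_of_pos hpos]
      apply gap_forward (by linarith) (by linarith) (by linarith) (by linarith) hbr
      simpa using hdiff
  rcases sq_mul_le_of_gap hA1 (abs_pos.2 hu0) hpR hqR hbr hmain.1 hmain.2 with ⟨hA8, hC8⟩ | hres
  · exfalso
    apply h.ne_one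
    have h64 : ∀ m ≥ 6, 8 * m ≤ 2 ^ m := by
      intro m hm
      induction m, hm using Nat.le_induction with
      | base => norm_num
      | succ m hm ih => rw [pow_succ]; omega
    have h64' : (8 * (p + q) : ℤ) ≤ 2 ^ (p + q) := by exact_mod_cast h64 _ hn
    constructor
    · refine eq_one_of_lt (n := p + q) (abs_pos.2 ha.ne') h.x_pos ?_
      rw [abs_of_pos ha]
      have h8 : a * x ^ (p + q) < 8 := by rw [hA] at hA8; exact_mod_cast hA8
      omega
    · refine eq_one_of_lt (n := p + q) (abs_pos.2 hc) h.y_pos ?_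
      have h9 : |c * y ^ (p + q)| * q < 8 * (p + q) := by
        rw [hC] at hC8; exact_mod_cast hC8
      have h10 : |c * y ^ (p + q)| ≤ |c * y ^ (p + q)| * q :=
        le_mul_of_one_le_right (abs_nonneg _) (by exact_mod_cast hq)
      have h11 : |c * y ^ (p + q)| = |c| * y ^ (p + q) := by
        rw [abs_mul, abs_of_pos (pow_pos h.y_pos _)]
      omega
  · exact hres

end IsBranchSolution

theorem one_div_le_abs_log_div {N M K : ℤ} (hN : 0 < N) (hM : 0 < M) (hne : N ≠ M)
    (hNK : N ≤ K) (hMK : M ≤ K) : 1 / (K : ℝ) ≤ |Real.log ((N : ℝ) / M)| := by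
  have key : ∀ {N M : ℤ}, 0 < M → M < N → N ≤ K → 1 / (K : ℝ) ≤ Real.log ((N : ℝ) / M) := by
    intro N M hM hlt hNK
    have hM' : (0 : ℝ) < M := by exact_mod_cast hM
    have hN' : (0 : ℝ) < N := by exact_mod_cast hM.trans hlt
    have hlt' : (M : ℝ) + 1 ≤ N := by exact_mod_cast hlt
    have hK' : (N : ℝ) ≤ K := by exact_mod_cast hNK
    have h1 := Real.one_sub_inv_le_log_of_pos (div_pos hN' hM')
    rw [inv_div] at h1
    refine le_trans ?_ h1
    have : 1 - (M : ℝ) / N = (N - M) / N := by field_simp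
    rw [this]
    calc 1 / (K : ℝ) ≤ 1 / N := one_div_le_one_div_of_le hN' hK'
      _ ≤ _ := by gcongr; linarith
  rcases lt_or_gt_of_ne hne with h | h
  · rw [← abs_neg, ← Real.log_inv, inv_div]
    exact (key hN h hMK).trans (le_abs_self _)
  · exact (key hM h hNK).trans (le_abs_self _)

namespace IsBranchSolution

variable {a b c : ℤ} {p q : ℕ} {x y x' y' : ℤ}

theorem two_le_max (h : IsBranchSolution a b c p q x y) : 2 ≤ max x y := by
  have h1 := h.x_pos
  have h2 := h.y_pos
  have h3 := h.ne_one
  omega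

theorem one_div_le_abs_log (hp : 0 < p) (hq : 0 < q)
    (h : IsBranchSolution a b c p q x y) (h' : IsBranchSolution a b c p q x' y')
    (hne : ¬ (x = x' ∧ y = y')) :
    1 / ((max x y * max x' y' : ℤ) : ℝ) ≤ |Real.log ((x' * y : ℝ) / (y' * x))| := by
  have h0 := one_div_le_abs_log_div (N := x' * y) (M := y' * x) (K := max x y * max x' y')
    (mul_pos h'.x_pos h.y_pos) (mul_pos h'.y_pos h.x_pos)
    (fun he => h.div_ne_div hp hq h' hne (by linarith)) ?_ ?_
  · push_cast at h0 ⊢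
    exact h0
  · rw [mul_comm (max x y)]
    exact mul_le_mul (le_max_left _ _) (le_max_right _ _) h.y_pos.le
      (h'.x_pos.le.trans (le_max_left _ _))
  · rw [mul_comm (max x y)]
    exact mul_le_mul (le_max_right _ _) (le_max_left _ _) h.x_pos.le
      (h'.x_pos.le.trans (le_max_left _ _))

theorem two_le_monomial (hp : 0 < p) (hq : 0 < q) (h : IsBranchSolution a b c p q x y) :
    2 ≤ x ^ q * y ^ p := by
  have hx : 1 ≤ x ^ q := one_le_pow₀ h.x_pos
  have hy : 1 ≤ y ^ p := one_le_pow₀ h.y_pos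
  have h2 := h.two_le_max
  rcases max_choice x y with hm | hm
  · have : x ≤ x ^ q := le_self_pow₀ h.x_pos hq.ne'
    nlinarith
  · have : y ≤ y ^ p := le_self_pow₀ h.y_pos hp.ne'
    nlinarith

theorem middle_le (h : IsBranchSolution a b c p q x y) :
    |b| * (x ^ q * y ^ p) ≤ |a * x ^ (p + q)| + |c * y ^ (p + q)| + 1 := by
  have h1 := h.abs_eq_one
  have hP : 0 < x ^ q * y ^ p := mul_pos (pow_pos h.x_pos _) (pow_pos h.y_pos _)
  have h2 : |b| * (x ^ q * y ^ p) = |b * (x ^ q * y ^ p)| := by rw [abs_mul, abs_of_pos hP]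
  rw [h2]
  calc |b * (x ^ q * y ^ p)|
      = |(a * x ^ (p + q) + b * (x ^ q * y ^ p) + c * y ^ (p + q)) - a * x ^ (p + q)
          - c * y ^ (p + q)| := by congr 1; ring
    _ ≤ _ := by
        have := abs_sub (a * x ^ (p + q) + b * (x ^ q * y ^ p) + c * y ^ (p + q)
          - a * x ^ (p + q)) (c * y ^ (p + q))
        have := abs_sub (a * x ^ (p + q) + b * (x ^ q * y ^ p) + c * y ^ (p + q))
          (a * x ^ (p + q))
        linarith

theorem coeff_le (hp : 0 < p) (hq : 0 < q) (h : IsBranchSolution a b c p q x y) {T : ℤ}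
    (hA : |a * x ^ (p + q)| ≤ T) (hC : |c * y ^ (p + q)| ≤ T) :
    |a| ≤ T ∧ |b| ≤ T ∧ |c| ≤ T := by
  have hx : 1 ≤ x ^ (p + q) := one_le_pow₀ h.x_pos
  have hy : 1 ≤ y ^ (p + q) := one_le_pow₀ h.y_pos
  refine ⟨?_, ?_, ?_⟩
  · rw [abs_mul, abs_of_pos (by linarith : 0 < x ^ (p + q))] at hA
    exact (le_mul_of_one_le_right (abs_nonneg _) hx).trans hA
  · have h1 := h.middle_le
    have h2 := h.two_le_monomial hp hq
    nlinarith [mul_le_mul_of_nonneg_left h2 (abs_nonneg b)]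
  · rw [abs_mul, abs_of_pos (by linarith : 0 < y ^ (p + q))] at hC
    exact (le_mul_of_one_le_right (abs_nonneg _) hy).trans hC

theorem max_pow_le (ha : a ≠ 0) (hc : c ≠ 0) (h : IsBranchSolution a b c p q x y) {T : ℤ}
    (hA : |a * x ^ (p + q)| ≤ T) (hC : |c * y ^ (p + q)| ≤ T) :
    max x y ^ (p + q) ≤ T := by
  have hx : 0 < x ^ (p + q) := pow_pos h.x_pos _
  have hy : 0 < y ^ (p + q) := pow_pos h.y_pos _
  rw [abs_mul, abs_of_pos hx] at hA
  rw [abs_mul, abs_of_pos hy] at hC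
  rcases max_choice x y with hm | hm <;> rw [hm]
  · exact (le_mul_of_one_le_left hx.le (abs_pos.2 ha)).trans hA
  · exact (le_mul_of_one_le_left hy.le (abs_pos.2 hc)).trans hC

/-- The gap principle for small solutions. -/
theorem gap_le (hp : 0 < p) (hq : 0 < q) (hn : 6 ≤ p + q) (ha : 0 < a) (hc : c ≠ 0)
    (h : IsBranchSolution a b c p q x y) (h' : IsBranchSolution a b c p q x' y')
    (hne : ¬ (x = x' ∧ y = y')) (hP : x ^ q * y ^ p ≤ x' ^ q * y' ^ p) :
    |a * x ^ (p + q)| ≤ 8 * (max x y * max x' y') ^ 2 ∧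
      |c * y ^ (p + q)| ≤ 8 * (max x y * max x' y') ^ 2 := by
  obtain ⟨-, h1, h2⟩ := gap_first hp hq hn ha hc h h' hne hP
  have h3 := one_div_le_abs_log hp hq h h' hne
  obtain ⟨K, hK⟩ : ∃ K, K = max x y * max x' y' := ⟨_, rfl⟩
  rw [← hK] at h3 ⊢
  have hK0 : (0 : ℝ) < K := by
    have := h.two_le_max
    have := h'.two_le_max
    rw [hK]
    exact_mod_cast mul_pos (by omega) (by omega)
  have key : ∀ X : ℝ, 0 ≤ X → X * |Real.log ((x' * y : ℝ) / (y' * x))| ^ 2 ≤ 8 →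
      X ≤ 8 * (K : ℝ) ^ 2 := by
    intro X hX hle
    have h4 : (1 / (K : ℝ)) ^ 2 ≤ |Real.log ((x' * y : ℝ) / (y' * x))| ^ 2 :=
      pow_le_pow_left₀ (by positivity) h3 2
    have h5 := (mul_le_mul_of_nonneg_left h4 hX).trans hle
    have : X * (1 / (K : ℝ)) ^ 2 = X / K ^ 2 := by field_simp
    rw [this, div_le_iff₀ (by positivity)] at h5
    exact h5
  constructor
  · have hpos : 0 ≤ a * x ^ (p + q) := mul_nonneg ha.le (pow_pos h.x_pos _).le
    rw [abs_of_nonneg hpos]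
    have := key _ (by exact_mod_cast hpos) h1
    exact_mod_cast this
  · have := key _ (abs_nonneg _) h2
    exact_mod_cast this

theorem max_ne_two (hp : 0 < p) (hq : 0 < q) (hn : 6 ≤ p + q) (ha : 0 < a) (hc : c ≠ 0)
    (h : IsBranchSolution a b c p q x y) (h' : IsBranchSolution a b c p q x' y')
    (hne : ¬ (x = x' ∧ y = y')) (hP : x ^ q * y ^ p ≤ x' ^ q * y' ^ p) :
    ¬ (max x y = 2 ∧ max x' y' = 2) := by
  rintro ⟨hm, hm'⟩
  obtain ⟨h1, -, -⟩ := gap_first hp hq hn ha hc h h' hne hP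
  have aux : ∀ {x y : ℤ}, IsBranchSolution a b c p q x y → max x y = 2 →
      (x = 1 ∧ y = 2) ∨ (x = 2 ∧ y = 1) := by
    intro x y h hm
    have h4 := h.x_pos
    have h5 := h.y_pos
    have h6 := h.ne_one
    have h7 : ¬ (x = 2 ∧ y = 2) := by
      rintro ⟨rfl, rfl⟩
      have := h.isCoprime hp hq
      rw [Int.isCoprime_iff_gcd_eq_one] at this
      norm_num at this
    omega
  have h4 : (1 : ℝ) < Real.log 4 := by
    have : (4 : ℝ) = 2 ^ 2 := by norm_num
    rw [this, Real.log_pow]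
    have := Real.log_two_gt_d9
    push_cast
    linarith
  rcases aux h hm with ⟨rfl, rfl⟩ | ⟨rfl, rfl⟩ <;> rcases aux h' hm' with ⟨rfl, rfl⟩ | ⟨rfl, rfl⟩
  · exact hne ⟨rfl, rfl⟩
  · norm_num at h1
    have := le_abs_self (Real.log 4)
    linarith
  · norm_num at h1
    rw [one_div, Real.log_inv, abs_neg] at h1
    have := le_abs_self (Real.log 4)
    linarith
  · exact hne ⟨rfl, rfl⟩

end IsBranchSolution

theorem abs_pow_mul_pow_sub_le {X Y X' Y' B d : ℝ} {p q : ℕ} (hp : 0 < p) (hq : 0 < q)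
    (hX : |X| ≤ B) (hY : |Y| ≤ B) (hX' : |X'| ≤ B) (hY' : |Y'| ≤ B)
    (h1 : |X - X'| ≤ d) (h2 : |Y - Y'| ≤ d) :
    |X ^ q * Y ^ p - X' ^ q * Y' ^ p| ≤ ((p + q : ℕ) : ℝ) * B ^ (p + q - 1) * d := by
  have hB : 0 ≤ B := (abs_nonneg _).trans hX
  have hd : 0 ≤ d := (abs_nonneg _).trans h1
  have key : ∀ {X X' : ℝ} {m : ℕ}, |X| ≤ B → |X'| ≤ B → |X - X'| ≤ d →
      |X ^ m - X' ^ m| ≤ d * m * B ^ (m - 1) := by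
    intro X X' m h h' hd
    refine (abs_pow_sub_pow_le X X' m).trans ?_
    gcongr
    exact max_le h h'
  have e1 : X ^ q * Y ^ p - X' ^ q * Y' ^ p
      = (X ^ q - X' ^ q) * Y ^ p + X' ^ q * (Y ^ p - Y' ^ p) := by ring
  rw [e1]
  refine (abs_add_le _ _).trans ?_
  rw [abs_mul, abs_mul, abs_pow, abs_pow]
  have k1 := key (m := q) hX hX' h1
  have k2 := key (m := p) hY hY' h2
  calc |X ^ q - X' ^ q| * |Y| ^ p + |X'| ^ q * |Y ^ p - Y' ^ p|
      ≤ (d * q * B ^ (q - 1)) * B ^ p + B ^ q * (d * p * B ^ (p - 1)) := by gcongr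
    _ = _ := by
        obtain ⟨p', rfl⟩ := Nat.exists_eq_succ_of_ne_zero hp.ne'
        obtain ⟨q', rfl⟩ := Nat.exists_eq_succ_of_ne_zero hq.ne'
        have e2 : p'.succ + q'.succ - 1 = p' + q' + 1 := by omega
        rw [e2]
        simp only [Nat.succ_eq_add_one, Nat.add_sub_cancel]
        push_cast
        ring

theorem discr_ne_zero {a b c : ℤ} {p q : ℕ} (hp : 0 < p) (hq : 0 < q) (ha : 0 < a) (hb : b < 0)
    (hc : 0 < c)
    (hirr : Irreducible (C a * X ^ (p + q) + C b * X ^ q + C c : ℤ[X])) :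
    ((p + q : ℕ) : ℤ) ^ (p + q) * (a ^ q * c ^ p) - q ^ q * p ^ p * (-b) ^ (p + q) ≠ 0 := by
  intro h0
  have haR : (0 : ℝ) < a := by exact_mod_cast ha
  have hbR : (0 : ℝ) < -b := by exact_mod_cast neg_pos.2 hb
  have hcR : (0 : ℝ) < c := by exact_mod_cast hc
  have hpR : (0 : ℝ) < p := by exact_mod_cast hp
  have hqR : (0 : ℝ) < q := by exact_mod_cast hq
  have h0R : ((p : ℝ) + q) ^ (p + q) * (a ^ q * c ^ p) = q ^ q * p ^ p * (-b) ^ (p + q) := by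
    have := sub_eq_zero.1 h0
    exact_mod_cast this
  have hn0 : p + q ≠ 0 := by omega
  obtain ⟨α, hα0, hα⟩ : ∃ α : ℝ, 0 < α ∧ α ^ (p + q) = q * c / (p * a) :=
    ⟨(q * c / (p * a)) ^ (1 / ((p + q : ℕ) : ℝ)), by positivity, by
      rw [← Real.rpow_natCast, ← Real.rpow_mul (by positivity)]
      rw [one_div_mul_cancel (by exact_mod_cast hn0), Real.rpow_one]⟩
  have hbα : -b * α ^ q = (p + q) * c / p := by
    have e1 : (α ^ q) ^ (p + q) = (α ^ (p + q)) ^ q := by rw [← pow_mul, ← pow_mul, mul_comm]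
    refine (pow_left_inj₀ (by positivity) (by positivity) hn0).1 ?_
    rw [mul_pow, e1, hα, div_pow, div_pow, mul_pow, mul_pow, mul_pow]
    have e2 : (-b : ℝ) ^ (p + q) = (p + q) ^ (p + q) * (a ^ q * c ^ p) / (q ^ q * p ^ p) := by
      rw [h0R]; field_simp
    rw [e2, pow_add (c : ℝ), pow_add (p : ℝ)]
    field_simp
  obtain ⟨f, hf⟩ : ∃ f : ℤ[X], f = C a * X ^ (p + q) + C b * X ^ q + C c := ⟨_, rfl⟩
  have hdeg : f.natDegree = p + q := by
    have := trinomial_natDegree (k := 0) (m := q) (n := p + q) (u := c) (v := b) hq (by omega)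
      ha.ne'
    have e : f = trinomial 0 q (p + q) c b a := by rw [hf, trinomial]; ring
    rw [e, this]
  rw [← hf] at hirr
  have hf0 : f.map (Int.castRingHom ℝ) ≠ 0 := by
    rw [Ne, Polynomial.map_eq_zero_iff Int.cast_injective]
    exact hirr.ne_zero
  have haα : (a : ℝ) * α ^ (p + q) = q * c / p := by rw [hα]; field_simp
  have hroot : (f.map (Int.castRingHom ℝ)).IsRoot α := by
    rw [hf]
    simp only [Polynomial.map_add, Polynomial.map_mul, Polynomial.map_pow, map_C, map_X, IsRoot,
      eval_add, eval_mul, eval_C, eval_pow, eval_X, Int.coe_castRingHom]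
    have : (b : ℝ) * α ^ q = -((p + q) * c / p) := by linarith
    rw [haα, this]
    field_simp
    ring
  have hroot' : (derivative (f.map (Int.castRingHom ℝ))).IsRoot α := by
    rw [hf]
    simp only [Polynomial.map_add, Polynomial.map_mul, Polynomial.map_pow, map_C, map_X, IsRoot,
      Int.coe_castRingHom, derivative_add, derivative_C_mul, derivative_X_pow, derivative_C,
      eval_add, eval_mul, eval_C, eval_pow, eval_X, add_zero]
    have e1 : α ^ (p + q - 1) * α = α ^ (p + q) := pow_sub_one_mul hn0 α
    have e2 : α ^ (q - 1) * α = α ^ q := pow_sub_one_mul hq.ne' α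
    have : (b : ℝ) * α ^ q = -((p + q) * c / p) := by linarith
    refine (mul_eq_zero.1 (?_ : _ * α = 0)).resolve_right hα0.ne'
    calc (a * (((p + q : ℕ) : ℝ) * α ^ (p + q - 1)) + b * (q * α ^ (q - 1))) * α
        = (p + q) * (a * (α ^ (p + q - 1) * α)) + q * (b * (α ^ (q - 1) * α)) := by
          push_cast; ring
      _ = 0 := by rw [e1, e2, haα, this]; field_simp; ring
  have hm := (one_lt_rootMultiplicity_iff_isRoot hf0).2 ⟨hroot, hroot'⟩
  have hdvd := (le_rootMultiplicity_iff hf0).1 hm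
  have := natDegree_mul_le_of_pow_dvd hirr (by omega) hroot 2 f hirr.ne_zero hdvd
  omega

theorem abs_sub_le_logDeriv {A M D p q : ℝ} (h1 : -1 ≤ A + M + D) (h2 : A + M + D ≤ 1)
    (hp : 0 ≤ p) (hq : 0 ≤ q) (hE : 0 ≤ p * A - q * D) :
    |(p + q) * A - q * (-M)| ≤ p * A - q * D + (p + q) ∧
      |(p + q) * D - p * (-M)| ≤ p * A - q * D + (p + q) := by
  have e1 := mul_le_mul_of_nonneg_left h1 hp
  have e2 := mul_le_mul_of_nonneg_left h2 hp
  have e3 := mul_le_mul_of_nonneg_left h1 hq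
  have e4 := mul_le_mul_of_nonneg_left h2 hq
  constructor <;> rw [abs_le] <;> constructor <;> linarith

theorem abs_mul_le_three {n m X T : ℝ} (hm : 0 ≤ m) (hmn : m ≤ n) (hX : 0 ≤ X)
    (hXT : X ≤ 3 * T) : |m * X| ≤ 3 * n * T := by
  rw [abs_of_nonneg (mul_nonneg hm hX), mul_comm 3, mul_assoc]
  exact mul_le_mul hmn hXT hX (hm.trans hmn)

namespace IsBranchSolution

variable {a b c : ℤ} {p q : ℕ} {x y : ℤ}

/-- Away from a double root, the logarithmic derivative of `F` is large. -/
theorem le_logDeriv (hp : 0 < p) (hq : 0 < q) (ha : 0 < a) (hc : c ≠ 0)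
    (hirr : Irreducible (C a * X ^ (p + q) + C b * X ^ q + C c : ℤ[X]))
    (h : IsBranchSolution a b c p q x y) {H T : ℝ} (hH : |(b : ℝ)| ≤ H) (hH1 : 1 ≤ H)
    (hTA : a * x ^ (p + q) ≤ T) (hTC : |(c * y ^ (p + q) : ℝ)| ≤ T)
    (hT : T ≤ a * x ^ (p + q) ∨ T ≤ |(c * y ^ (p + q) : ℝ)|)
    (hTR : (p + q : ℕ) * (6 * (p + q : ℕ) * H) ^ (p + q) ≤ T) :
    2 * T ≤ (6 * (p + q : ℕ) * H) ^ (p + q) * (p * (a * x ^ (p + q)) - q * (c * y ^ (p + q))) := by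
  have hx : (1 : ℝ) ≤ x := by exact_mod_cast h.x_pos
  have hy : (1 : ℝ) ≤ y := by exact_mod_cast h.y_pos
  have haR : (1 : ℝ) ≤ a := by exact_mod_cast ha
  have hpR : (1 : ℝ) ≤ p := by exact_mod_cast hp
  have hqR : (1 : ℝ) ≤ q := by exact_mod_cast hq
  have hA1 : (1 : ℝ) ≤ a * x ^ (p + q) := one_le_mul_of_one_le_of_one_le haR (one_le_pow₀ hx)
  have hbr : (q * (c * y ^ (p + q)) : ℝ) ≤ p * (a * x ^ (p + q)) := by exact_mod_cast h.branch
  have hF : |(a * x ^ (p + q) + b * (x ^ q * y ^ p) + c * y ^ (p + q) : ℝ)| ≤ 1 := by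
    exact_mod_cast h.abs_eq_one.le
  have hT1 : 1 ≤ T := hA1.trans hTA
  obtain ⟨R, hR⟩ : ∃ R, R = (6 * (p + q : ℕ) * H) ^ (p + q) := ⟨_, rfl⟩
  have h6 : (2 : ℝ) ≤ 6 * (p + q : ℕ) * H := by push_cast; nlinarith
  have hR2 : 2 ≤ R := by
    rw [hR]; exact h6.trans (le_self_pow₀ (by linarith) (by omega))
  rcases lt_or_gt_of_ne hc with hc0 | hc0
  · rw [← hR]
    have hC0 : (c * y ^ (p + q) : ℝ) < 0 :=
      mul_neg_of_neg_of_pos (by exact_mod_cast hc0) (by positivity)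
    obtain ⟨A, hA⟩ : ∃ A : ℝ, A = a * x ^ (p + q) := ⟨_, rfl⟩
    obtain ⟨D, hD⟩ : ∃ D : ℝ, D = c * y ^ (p + q) := ⟨_, rfl⟩
    rw [abs_of_neg hC0] at hT
    simp only [← hA, ← hD] at hT hA1 hC0 ⊢
    have h2 : A ≤ p * A := le_mul_of_one_le_left (by linarith) hpR
    have h3 : -D ≤ q * (-D) := le_mul_of_one_le_left (by linarith) hqR
    have h1 : T ≤ p * A - q * D := by
      rcases hT with hT | hT <;> linarith
    exact mul_le_mul hR2 h1 (by linarith) (by linarith)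
  have hcR : (1 : ℝ) ≤ c := by exact_mod_cast hc0
  have hC1 : (1 : ℝ) ≤ c * y ^ (p + q) := one_le_mul_of_one_le_of_one_le hcR (one_le_pow₀ hy)
  obtain ⟨P, hP⟩ : ∃ P : ℝ, P = x ^ q * y ^ p := ⟨_, rfl⟩
  have hP0 : 0 < P := by rw [hP]; positivity
  obtain ⟨A, hA⟩ : ∃ A : ℝ, A = a * x ^ (p + q) := ⟨_, rfl⟩
  obtain ⟨D, hD⟩ : ∃ D : ℝ, D = c * y ^ (p + q) := ⟨_, rfl⟩
  have hPn : P ^ (p + q) * (((p + q : ℕ) : ℝ) ^ (p + q) * (a ^ q * c ^ p)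
      - q ^ q * p ^ p * (-b) ^ (p + q))
      = ((p + q : ℕ) * A) ^ q * ((p + q : ℕ) * D) ^ p -
          (q * (-b * P)) ^ q * (p * (-b * P)) ^ p := by
    rw [hA, hD, hP]
    simp only [mul_pow, pow_add, ← pow_mul]
    ring
  simp only [← hA, ← hD] at hTA hTC hT hA1 hC1 hbr hF ⊢
  rw [abs_of_pos (by linarith)] at hTC hT
  have hF' := abs_le.1 hF
  rw [← hP] at hF'
  have hDT : T ≤ -b * P := by rcases hT with hT | hT <;> linarith [hF'.1, hF'.2]
  have hb0 : (b : ℝ) < 0 := by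
    by_contra! hb
    have := mul_nonneg hb hP0.le
    linarith
  have hTP : T ≤ H * P := by
    rw [abs_of_neg hb0] at hH
    exact hDT.trans (mul_le_mul_of_nonneg_right hH hP0.le)
  have hΔ := discr_ne_zero hp hq ha (by exact_mod_cast hb0) hc0 hirr
  have hΔR : (1 : ℝ) ≤ |((p + q : ℕ) : ℝ) ^ (p + q) * (a ^ q * c ^ p)
      - q ^ q * p ^ p * (-b) ^ (p + q)| := by
    have := Int.one_le_abs hΔ
    exact_mod_cast this
  have hE : 0 ≤ p * A - q * D := by linarith
  have hkey : P ^ (p + q) ≤ ((p + q : ℕ) : ℝ) * (3 * (p + q : ℕ) * T) ^ (p + q - 1)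
      * (p * A - q * D + (p + q : ℕ)) := by
    calc P ^ (p + q) ≤ P ^ (p + q) * |((p + q : ℕ) : ℝ) ^ (p + q) * (a ^ q * c ^ p)
          - q ^ q * p ^ p * (-b) ^ (p + q)| := le_mul_of_one_le_right (by positivity) hΔR
      _ = |((p + q : ℕ) * A) ^ q * ((p + q : ℕ) * D) ^ p
            - (q * (-b * P)) ^ q * (p * (-b * P)) ^ p| := by
          rw [← hPn, abs_mul, abs_of_pos (by positivity : 0 < P ^ (p + q))]
      _ ≤ _ := by
          have hDT' : -b * P ≤ 3 * T := by linarith [hF'.1, hF'.2]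
          have hn1 : (1 : ℝ) ≤ (p + q : ℕ) := by push_cast; linarith
          have b0 : 0 ≤ -b * P := by linarith
          have hpn : (p : ℝ) ≤ (p + q : ℕ) := by push_cast; linarith
          have hqn : (q : ℝ) ≤ (p + q : ℕ) := by push_cast; linarith
          have hnn : (0 : ℝ) ≤ (p + q : ℕ) := by linarith
          obtain ⟨k1, k2⟩ := abs_sub_le_logDeriv (p := p) (q := q) hF'.1 hF'.2 (by linarith)
            (by linarith) hE
          rw [← neg_mul] at k1 k2
          exact abs_pow_mul_pow_sub_le hp hq
            (abs_mul_le_three hnn le_rfl (by linarith) (by linarith))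
            (abs_mul_le_three hnn le_rfl (by linarith) (by linarith))
            (abs_mul_le_three (by linarith) hqn b0 hDT')
            (abs_mul_le_three (by linarith) hpn b0 hDT')
            (by push_cast; exact k1) (by push_cast; exact k2)
  obtain ⟨m, hm⟩ : ∃ m, p + q = m + 1 := ⟨p + q - 1, by omega⟩
  have h3 : T ^ (m + 1) ≤ H ^ (m + 1) * (((m + 1 : ℕ) : ℝ) * (3 * (m + 1 : ℕ) * T) ^ m
      * (p * A - q * D + (m + 1 : ℕ))) := by
    rw [hm] at hkey
    calc T ^ (m + 1) ≤ (H * P) ^ (m + 1) := pow_le_pow_left₀ (by linarith) hTP _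
      _ = H ^ (m + 1) * P ^ (m + 1) := mul_pow ..
      _ ≤ _ := by gcongr; exact hkey
  have h4 : 3 * 2 ^ (m + 1) * T ≤ R * (p * A - q * D + (m + 1 : ℕ)) := by
    refine le_of_mul_le_mul_right ?_ (by positivity : 0 < T ^ m)
    calc 3 * 2 ^ (m + 1) * T * T ^ m = 3 * 2 ^ (m + 1) * T ^ (m + 1) := by ring
      _ ≤ 3 * 2 ^ (m + 1) * _ := mul_le_mul_of_nonneg_left h3 (by positivity)
      _ = _ := by
        rw [hR, hm]
        have : (6 : ℝ) = 2 * 3 := by norm_num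
        rw [this]
        simp only [mul_pow, pow_succ]
        ring
  rw [← hR] at hTR ⊢
  rw [hm] at hTR
  have h5 : (2 : ℝ) ≤ 2 ^ (m + 1) := le_self_pow₀ (by norm_num) (by omega)
  nlinarith

end IsBranchSolution

theorem exists_exp_root {A M D p q T : ℝ} (hp : 1 ≤ p) (hq : 1 ≤ q) (hT : 1 ≤ T)
    (hA : |A| ≤ T) (hD : |D| ≤ T) (h1 : -1 ≤ A + M + D) (h2 : A + M + D ≤ 1)
    (hE0 : 0 < p * A - q * D) (hE : 4 * (p + q) ^ 2 * T ≤ (p * A - q * D) ^ 2) :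
    ∃ s : ℝ, |s| ≤ 2 / (p * A - q * D) ∧ |s| * (p + q) ≤ 1 ∧
      A * Real.exp (p * s) + M + D * Real.exp (-(q * s)) = 0 ∧
      q * (D * Real.exp (-(q * s))) ≤ p * (A * Real.exp (p * s)) := by
  obtain ⟨E, hEdef⟩ : ∃ E, E = p * A - q * D := ⟨_, rfl⟩
  rw [← hEdef] at hE0 hE ⊢
  obtain ⟨δ, hδ⟩ : ∃ δ, δ = 2 / E := ⟨_, rfl⟩
  have hδ0 : 0 < δ := by rw [hδ]; positivity
  have hδE : δ * E = 2 := by rw [hδ]; field_simp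
  have hT0 : 0 ≤ T := by linarith
  have hEn : 2 * (p + q) ≤ E := by
    refine le_of_sq_le_sq ?_ hE0.le
    nlinarith [mul_nonneg (sq_nonneg (p + q)) (sub_nonneg.2 hT)]
  have hδn : δ * (p + q) ≤ 1 := by nlinarith
  have hδT : (p + q) ^ 2 * T * δ ^ 2 ≤ 1 := by
    have : 4 * (p + q) ^ 2 * T * δ ^ 2 ≤ E ^ 2 * δ ^ 2 :=
      mul_le_mul_of_nonneg_right hE (sq_nonneg _)
    have e : E ^ 2 * δ ^ 2 = 4 := by rw [← mul_pow, mul_comm, hδE]; norm_num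
    linarith
  have hbound : ∀ s, |s| ≤ δ →
      |A * Real.exp (p * s) + M + D * Real.exp (-(q * s)) - (A + M + D) - s * E| ≤ 1 := by
    intro s hs
    have hs1 : |p * s| ≤ 1 := by
      rw [abs_mul, abs_of_pos (by linarith)]; nlinarith [abs_nonneg s]
    have hs2 : |-(q * s)| ≤ 1 := by
      rw [abs_neg, abs_mul, abs_of_pos (by linarith)]; nlinarith [abs_nonneg s]
    have k1 := Real.abs_exp_sub_one_sub_id_le hs1
    have k2 := Real.abs_exp_sub_one_sub_id_le hs2
    have hss : s ^ 2 ≤ δ ^ 2 := sq_le_sq' (by linarith [neg_abs_le s]) ((le_abs_self s).trans hs)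
    have e : A * Real.exp (p * s) + M + D * Real.exp (-(q * s)) - (A + M + D) - s * E
        = A * (Real.exp (p * s) - 1 - p * s)
          + D * (Real.exp (-(q * s)) - 1 - -(q * s)) := by rw [hEdef]; ring
    rw [e]
    calc _ ≤ |A| * |Real.exp (p * s) - 1 - p * s|
            + |D| * |Real.exp (-(q * s)) - 1 - -(q * s)| := by
          rw [← abs_mul, ← abs_mul]; exact abs_add_le _ _
      _ ≤ T * (p * s) ^ 2 + T * (-(q * s)) ^ 2 := by gcongr
      _ = T * (p ^ 2 + q ^ 2) * s ^ 2 := by ring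
      _ ≤ T * (p + q) ^ 2 * δ ^ 2 := by gcongr; nlinarith
      _ ≤ 1 := by linarith
  have hcont : Continuous fun s : ℝ => A * Real.exp (p * s) + M + D * Real.exp (-(q * s)) := by
    fun_prop
  have hlow : A * Real.exp (p * -δ) + M + D * Real.exp (-(q * -δ)) ≤ 0 := by
    have := abs_le.1 (hbound (-δ) (by rw [abs_neg, abs_of_pos hδ0]))
    linarith [this.2]
  have hup : 0 ≤ A * Real.exp (p * δ) + M + D * Real.exp (-(q * δ)) := by
    have := abs_le.1 (hbound δ (by rw [abs_of_pos hδ0]))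
    linarith [this.1]
  obtain ⟨s, hs, hs0⟩ := intermediate_value_Icc (by linarith : -δ ≤ δ) hcont.continuousOn
    ⟨hlow, hup⟩
  have hsδ : |s| ≤ δ := abs_le.2 hs
  refine ⟨s, hδ ▸ hsδ, le_trans (by gcongr) hδn, hs0, ?_⟩
  have hs1 : |p * s| ≤ 1 := by
    rw [abs_mul, abs_of_pos (by linarith)]; nlinarith [abs_nonneg s]
  have hs2 : |-(q * s)| ≤ 1 := by
    rw [abs_neg, abs_mul, abs_of_pos (by linarith)]; nlinarith [abs_nonneg s]
  have k1 := Real.abs_exp_sub_one_le hs1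
  have k2 := Real.abs_exp_sub_one_le hs2
  have k3 : |A * (Real.exp (p * s) - 1)| ≤ T * (2 * (p * δ)) := by
    rw [abs_mul]
    refine mul_le_mul hA (k1.trans ?_) (abs_nonneg _) hT0
    rw [abs_mul, abs_of_pos (by linarith : 0 < p)]
    gcongr
  have k4 : |D * (Real.exp (-(q * s)) - 1)| ≤ T * (2 * (q * δ)) := by
    rw [abs_mul]
    refine mul_le_mul hD (k2.trans ?_) (abs_nonneg _) hT0
    rw [abs_neg, abs_mul, abs_of_pos (by linarith : 0 < q)]
    gcongr
  have k5 := mul_le_mul_of_nonneg_left (abs_le.1 k3).1 (by linarith : 0 ≤ p)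
  have k6 := mul_le_mul_of_nonneg_left (abs_le.1 k4).2 (by linarith : 0 ≤ q)
  have k7 : 2 * T * (p ^ 2 + q ^ 2) * δ ≤ E := by
    have h5 : 2 * T * (p ^ 2 + q ^ 2) * δ ≤ 2 * T * (p + q) ^ 2 * δ := by gcongr; nlinarith
    have h6 : 2 * T * (p + q) ^ 2 * δ ≤ E := by
      have h7 : (p + q) ^ 2 * T * δ ^ 2 * E = 2 * T * (p + q) ^ 2 * δ := by
        calc (p + q) ^ 2 * T * δ ^ 2 * E = (p + q) ^ 2 * T * δ * (δ * E) := by ring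
          _ = _ := by rw [hδE]; ring
      have h8 := mul_le_mul_of_nonneg_right hδT hE0.le
      linarith
    linarith
  linarith

theorem root_unique {a b c : ℝ} {p q : ℕ} (ha : 0 < a) (hp : 0 < p) {α β : ℝ} (hα : 0 < α)
    (hβ : 0 < β) (h1 : a * α ^ (p + q) + b * α ^ q + c = 0)
    (h2 : a * β ^ (p + q) + b * β ^ q + c = 0)
    (hbr1 : q * c ≤ p * (a * α ^ (p + q))) (hbr2 : q * c ≤ p * (a * β ^ (p + q))) : α = β := by
  have key : ∀ {α β : ℝ}, 0 < α → α < β → a * α ^ (p + q) + b * α ^ q + c = 0 →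
      a * β ^ (p + q) + b * β ^ q + c = 0 → q * c ≤ p * (a * α ^ (p + q)) → False := by
    intro α β hα hlt h1 h2 hbr
    have hβ : 0 < β := hα.trans hlt
    obtain ⟨t, ht⟩ : ∃ t, t = Real.log (β / α) := ⟨_, rfl⟩
    have ht0 : 0 < t := by rw [ht]; exact Real.log_pos (by rw [lt_div_iff₀ hα]; linarith)
    have hE : Real.exp t = β / α := by rw [ht, Real.exp_log (by positivity)]
    have hpt : 0 < (p : ℝ) * t := mul_pos (by exact_mod_cast hp) ht0
    have h3 : q * (c / α ^ q) ≤ p * (a * α ^ p) := by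
      rw [← mul_div_assoc, div_le_iff₀ (by positivity)]
      calc _ ≤ _ := hbr
        _ = _ := by ring
    have h4 := mul_exp_sub_le (A := a * α ^ p) (C := c / α ^ q) (t := t) (p := p) (q := q)
      (by positivity) ht0.le (by positivity) (by positivity) h3
    have e1 : Real.exp (p * t) = β ^ p / α ^ p := by rw [Real.exp_nat_mul, hE, div_pow]
    have e2 : Real.exp (-(q * t)) = α ^ q / β ^ q := by
      rw [Real.exp_neg, Real.exp_nat_mul, hE, div_pow, inv_div]
    have h5 : a * α ^ p * (Real.exp (p * t) - 1) + c / α ^ q * (Real.exp (-(q * t)) - 1) = 0 := by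
      rw [e1, e2]
      have h1' : b = -(a * α ^ p) - c / α ^ q := by
        field_simp
        rw [pow_add] at h1
        linarith
      have h2' : b = -(a * β ^ p) - c / β ^ q := by
        field_simp
        rw [pow_add] at h2
        linarith
      have : a * α ^ p * (β ^ p / α ^ p - 1) + c / α ^ q * (α ^ q / β ^ q - 1)
          = (a * β ^ p + c / β ^ q) - (a * α ^ p + c / α ^ q) := by
        field_simp
        ring
      rw [this]
      linarith
    have h6 := Real.add_one_lt_exp hpt.ne'
    have : 0 < a * α ^ p * (Real.exp (p * t) - 1 - p * t) := by
      apply mul_pos (by positivity); linarith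
    linarith
  rcases lt_trichotomy α β with h | h | h
  · exact (key hα h h1 h2 hbr1).elim
  · exact h
  · exact (key hβ h h2 h1 hbr2).elim

theorem root_le {a b c H : ℝ} {p q : ℕ} (ha : 1 ≤ a) (hp : 0 < p) {α : ℝ} (hα : 0 < α)
    (h1 : a * α ^ (p + q) + b * α ^ q + c = 0) (hH : 1 ≤ H) (hb : |b| ≤ H) (hc : |c| ≤ H) :
    α ≤ 2 * H := by
  by_contra! hlt
  have hα1 : 1 ≤ α := by linarith
  obtain ⟨m, rfl⟩ : ∃ m, p = m + 1 := ⟨p - 1, by omega⟩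
  have e : α ^ (m + 1 + q) = α * α ^ (m + q) := by ring
  have h2 : α ^ q ≤ α ^ (m + q) := pow_le_pow_right₀ hα1 (by omega)
  have h3 : 1 ≤ α ^ (m + q) := one_le_pow₀ hα1
  have h4 : a * α ^ (m + 1 + q) ≤ H * α ^ q + H := by
    have h5 : -b * α ^ q ≤ H * α ^ q :=
      mul_le_mul_of_nonneg_right ((neg_le_abs b).trans hb) (by positivity)
    have h6 := (neg_le_abs c).trans hc
    linarith
  have h5 : α * α ^ (m + q) ≤ 2 * H * α ^ (m + q) := by
    rw [e] at h4
    have : α * α ^ (m + q) ≤ a * (α * α ^ (m + q)) := le_mul_of_one_le_left (by positivity) ha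
    nlinarith
  have := le_of_mul_le_mul_right h5 (by linarith)
  linarith

theorem sq_le_two_pow {n : ℕ} (hn : 4 ≤ n) : n ^ 2 ≤ 2 ^ n := by
  induction n, hn using Nat.le_induction with
  | base => norm_num
  | succ m hm ih => rw [pow_succ 2]; nlinarith

namespace IsBranchSolution

variable {a b c : ℤ} {p q : ℕ} {x y x' y' : ℤ}

/-- A large solution is close to a root lying on the same branch. -/
theorem exists_root_near (hp : 0 < p) (hq : 0 < q) (hn : 6 ≤ p + q) (ha : 0 < a) (hc : c ≠ 0)
    (hirr : Irreducible (C a * X ^ (p + q) + C b * X ^ q + C c : ℤ[X]))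
    (h : IsBranchSolution a b c p q x y) {H : ℝ} (hbH : |(b : ℝ)| ≤ H) (hH1 : 1 ≤ H)
    (hlarge : 2 * (6 * (p + q : ℕ) * H) ^ 2 ≤ max x y) :
    ∃ α : ℝ, 0 < α ∧ a * α ^ (p + q) + b * α ^ q + c = 0 ∧ q * c ≤ p * (a * α ^ (p + q)) ∧
      |Real.log (x / y) - Real.log α|
        ≤ (6 * (p + q : ℕ) * H) ^ (p + q) / (max x y : ℤ) ^ (p + q) := by
  have hx : (0 : ℝ) < x := by exact_mod_cast h.x_pos
  have hy : (0 : ℝ) < y := by exact_mod_cast h.y_pos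
  have hF := abs_le.1 h.abs_eq_one.le
  have hF1 : (-1 : ℝ) ≤ a * x ^ (p + q) + b * (x ^ q * y ^ p) + c * y ^ (p + q) := by
    exact_mod_cast hF.1
  have hF2 : (a * x ^ (p + q) + b * (x ^ q * y ^ p) + c * y ^ (p + q) : ℝ) ≤ 1 := by
    exact_mod_cast hF.2
  obtain ⟨R, hR⟩ : ∃ R, R = (6 * (p + q : ℕ) * H) ^ (p + q) := ⟨_, rfl⟩
  have hn1 : (6 : ℝ) ≤ (p + q : ℕ) := by exact_mod_cast hn
  have hw1 : 1 ≤ 6 * (p + q : ℕ) * H := by nlinarith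
  have hR1 : 1 ≤ R := by rw [hR]; exact one_le_pow₀ hw1
  obtain ⟨T, hT⟩ : ∃ T : ℤ, T = max |a * x ^ (p + q)| |c * y ^ (p + q)| := ⟨_, rfl⟩
  have hTA : |a * x ^ (p + q)| ≤ T := hT ▸ le_max_left _ _
  have hTC : |c * y ^ (p + q)| ≤ T := hT ▸ le_max_right _ _
  have hQT : (max x y) ^ (p + q) ≤ T := h.max_pow_le ha.ne' hc hTA hTC
  have hQTR : ((max x y : ℤ) : ℝ) ^ (p + q) ≤ T := by exact_mod_cast hQT
  have hlarge' : 2 * (6 * (p + q : ℕ) * H) ^ 2 ≤ ((max x y : ℤ) : ℝ) := hlarge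
  have hnR : ((p + q : ℕ) : ℝ) ^ 2 * R ^ 2 ≤ T := by
    refine le_trans ?_ hQTR
    calc ((p + q : ℕ) : ℝ) ^ 2 * R ^ 2 ≤ 2 ^ (p + q) * R ^ 2 := by
          gcongr; exact_mod_cast sq_le_two_pow (by omega)
      _ = (2 * (6 * (p + q : ℕ) * H) ^ 2) ^ (p + q) := by
          rw [hR, mul_pow 2, ← pow_mul, ← pow_mul, mul_comm 2 (p + q)]
      _ ≤ _ := pow_le_pow_left₀ (by positivity) hlarge' _
  have hnR1 : (p + q : ℕ) * R ≤ (T : ℝ) := by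
    have : 1 ≤ (p + q : ℕ) * R := by nlinarith
    refine le_trans ?_ hnR
    rw [← mul_pow]
    exact le_self_pow₀ this (by norm_num)
  have hApos : 0 ≤ a * x ^ (p + q) := mul_nonneg ha.le (pow_pos h.x_pos _).le
  have hTAR : |(a * x ^ (p + q) : ℝ)| ≤ T := by exact_mod_cast hTA
  have hTCR : |(c * y ^ (p + q) : ℝ)| ≤ T := by exact_mod_cast hTC
  have hTor : (T : ℝ) ≤ a * x ^ (p + q) ∨ (T : ℝ) ≤ |(c * y ^ (p + q) : ℝ)| := by
    rw [abs_of_nonneg hApos] at hT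
    rcases max_choice (a * x ^ (p + q)) |c * y ^ (p + q)| with hm | hm
    · left; rw [hT, hm]; push_cast; exact le_rfl
    · right; rw [hT, hm]; push_cast; exact le_rfl
  have hE := h.le_logDeriv hp hq ha hc hirr hbH hH1 ((le_abs_self _).trans hTAR) hTCR hTor
    (by rw [← hR]; exact hnR1)
  have hT1 : (1 : ℝ) ≤ T := by
    refine le_trans ?_ hQTR
    apply one_le_pow₀
    exact_mod_cast (le_trans (by norm_num) h.two_le_max)
  rw [← hR] at hE ⊢
  obtain ⟨E, hEdef⟩ : ∃ E : ℝ, E = p * (a * x ^ (p + q)) - q * (c * y ^ (p + q)) := ⟨_, rfl⟩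
  rw [← hEdef] at hE
  have hE0 : 0 < E := by
    by_contra! hneg
    nlinarith
  have hE2 : 4 * ((p : ℝ) + q) ^ 2 * T ≤ E ^ 2 := by
    have h1 : (2 * (T : ℝ)) ^ 2 ≤ (R * E) ^ 2 := pow_le_pow_left₀ (by linarith) hE 2
    have h2 : 4 * ((p : ℝ) + q) ^ 2 * T * R ^ 2 ≤ E ^ 2 * R ^ 2 := by
      push_cast at hnR
      have h3 := mul_le_mul_of_nonneg_right hnR (by linarith : (0 : ℝ) ≤ T)
      linarith
    exact le_of_mul_le_mul_right h2 (by positivity)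
  obtain ⟨s, hs1, hs2, hs3, hs4⟩ := exists_exp_root (M := b * (x ^ q * y ^ p)) (p := p) (q := q)
    (by exact_mod_cast hp) (by exact_mod_cast hq) hT1 hTAR hTCR hF1 hF2
    (by rw [← hEdef]; exact hE0) (by rw [← hEdef]; exact hE2)
  rw [← hEdef] at hs1
  have e1 : Real.exp (p * s) = Real.exp s ^ p := Real.exp_nat_mul ..
  have e2 : Real.exp (-(q * s)) = (Real.exp s ^ q)⁻¹ := by rw [Real.exp_neg, Real.exp_nat_mul]
  rw [e1, e2] at hs3 hs4
  have hes := Real.exp_pos s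
  refine ⟨x / y * Real.exp s, by positivity, ?_, ?_, ?_⟩
  · have : (y : ℝ) ^ (p + q) * (a * (x / y * Real.exp s) ^ (p + q)
        + b * (x / y * Real.exp s) ^ q + c) = Real.exp s ^ q *
        (a * x ^ (p + q) * Real.exp s ^ p + b * (x ^ q * y ^ p)
          + c * y ^ (p + q) * (Real.exp s ^ q)⁻¹) := by
      simp only [mul_pow, div_pow, pow_add]
      field_simp
    rw [hs3, mul_zero] at this
    exact (mul_eq_zero.1 this).resolve_left (by positivity)
  · have h1 := mul_le_mul_of_nonneg_right hs4 (by positivity : 0 ≤ Real.exp s ^ q / y ^ (p + q))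
    have h2 : q * (c * y ^ (p + q) * (Real.exp s ^ q)⁻¹) * (Real.exp s ^ q / y ^ (p + q))
        = (q * c : ℝ) := by field_simp
    have h3 : p * (a * x ^ (p + q) * Real.exp s ^ p) * (Real.exp s ^ q / y ^ (p + q))
        = p * (a * (x / y * Real.exp s) ^ (p + q)) := by
      simp only [mul_pow, div_pow, pow_add]
      field_simp
    rwa [h2, h3] at h1
  · rw [Real.log_mul (by positivity) hes.ne', Real.log_exp]
    have : Real.log (x / y) - (Real.log (x / y) + s) = -s := by ring
    rw [this, abs_neg]
    refine hs1.trans ?_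
    calc 2 / E ≤ R / T := by
          rw [div_le_div_iff₀ hE0 (by linarith)]; exact hE
      _ ≤ _ := by
          gcongr
          have : (0 : ℝ) < (max x y : ℤ) := by
            exact_mod_cast (lt_of_lt_of_le (by norm_num) h.two_le_max)
          positivity

theorem pow_le_of_near (hp : 0 < p) (hq : 0 < q) {R l : ℝ}
    (h : IsBranchSolution a b c p q x y) (h' : IsBranchSolution a b c p q x' y')
    (hne : ¬ (x = x' ∧ y = y')) (hle : max x y ≤ max x' y') (hR : 0 ≤ R)
    (h1 : |Real.log (x / y) - l| ≤ R / (max x y : ℤ) ^ (p + q))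
    (h2 : |Real.log (x' / y') - l| ≤ R / (max x' y' : ℤ) ^ (p + q)) :
    ((max x y : ℤ) : ℝ) ^ (p + q - 1) ≤ 2 * R * (max x' y' : ℤ) := by
  have hx : (0 : ℝ) < x := by exact_mod_cast h.x_pos
  have hy : (0 : ℝ) < y := by exact_mod_cast h.y_pos
  have hx' : (0 : ℝ) < x' := by exact_mod_cast h'.x_pos
  have hy' : (0 : ℝ) < y' := by exact_mod_cast h'.y_pos
  have h3 := one_div_le_abs_log hp hq h h' hne
  have hQ : (0 : ℝ) < (max x y : ℤ) := by
    exact_mod_cast (lt_of_lt_of_le (by norm_num) h.two_le_max)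
  have hQ' : ((max x y : ℤ) : ℝ) ≤ (max x' y' : ℤ) := by exact_mod_cast hle
  have e : Real.log ((x' * y : ℝ) / (y' * x)) = Real.log (x' / y') - Real.log (x / y) := by
    rw [← Real.log_div (by positivity) (by positivity)]
    congr 1
    field_simp
  rw [e, Int.cast_mul] at h3
  obtain ⟨Q, hQd⟩ : ∃ Q : ℝ, Q = (max x y : ℤ) := ⟨_, rfl⟩
  obtain ⟨Q', hQd'⟩ : ∃ Q' : ℝ, Q' = (max x' y' : ℤ) := ⟨_, rfl⟩
  simp only [← hQd, ← hQd'] at h1 h2 h3 hQ hQ' ⊢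
  have h4 : |Real.log (x' / y') - Real.log (x / y)| ≤ 2 * R / Q ^ (p + q) := by
    have h5 : R / Q' ^ (p + q) ≤ R / Q ^ (p + q) := by gcongr
    have h6 : |Real.log (x' / y') - Real.log (x / y)|
        ≤ |Real.log (x' / y') - l| + |Real.log (x / y) - l| := by
      rw [← abs_neg (Real.log (x / y) - l)]
      refine le_trans (le_of_eq ?_) (abs_add_le _ _)
      congr 1
      ring
    have h7 : 2 * R / Q ^ (p + q) = R / Q ^ (p + q) + R / Q ^ (p + q) := by ring
    linarith
  have h5 := h3.trans h4
  have hQ'0 : 0 < Q' := hQ.trans_le hQ'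
  rw [div_le_div_iff₀ (by positivity) (by positivity)] at h5
  obtain ⟨m, hm⟩ : ∃ m, p + q = m + 1 := ⟨p + q - 1, by omega⟩
  rw [hm, pow_succ] at h5
  rw [hm, Nat.add_sub_cancel]
  refine le_of_mul_le_mul_right ?_ hQ
  linarith

theorem abs_div_sub_le {R α H : ℝ} {n : ℕ} (hx : 0 < x) (hy : 0 < y) (hα : 0 < α)
    (hαH : α ≤ 2 * H) (hH : 0 ≤ H) {Q : ℝ} (hR1 : R / Q ^ n ≤ 1)
    (h : |Real.log (x / y) - Real.log α| ≤ R / Q ^ n) :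
    |(x / y : ℝ) - α| ≤ 4 * H * (R / Q ^ n) := by
  have hx : (0 : ℝ) < x := by exact_mod_cast hx
  have hy : (0 : ℝ) < y := by exact_mod_cast hy
  obtain ⟨t, ht⟩ : ∃ t, t = Real.log (x / y) - Real.log α := ⟨_, rfl⟩
  rw [← ht] at h
  have e : (x / y : ℝ) = α * Real.exp t := by
    rw [ht, Real.exp_sub, Real.exp_log (by positivity), Real.exp_log hα]
    field_simp
  have e2 : (x / y : ℝ) - α = α * (Real.exp t - 1) := by rw [e]; ring
  rw [e2, abs_mul, abs_of_pos hα]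
  have h1 := Real.abs_exp_sub_one_le (h.trans hR1)
  calc α * |Real.exp t - 1| ≤ 2 * H * (2 * |t|) := by gcongr
    _ ≤ 2 * H * (2 * (R / Q ^ n)) := by gcongr
    _ = _ := by ring

end IsBranchSolution

/-- The growth conditions on the binary logarithms of the heights of an ordered list of
solutions. -/
structure GapChain (n : ℝ) (Z : ℕ) (h w : ℝ) (l : ℕ → ℝ) : Prop where
  one_le : 1 ≤ l 0
  height_le : h ≤ 2 * (l 0 + l 1) + 3
  le_height : ∀ m : ℕ, w ≤ h + m + 1.45 * (6 * n / 2 ^ m - 1) + 0.01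
  five_le : 5 ≤ w
  small : ∀ i < Z, (n - 2) * l i ≤ 2 * l (i + 1) + 3
  large : ∀ i < Z, 2 * w + 1 ≤ l i → (n - 1) * l i - 1 - n * w ≤ l (i + 1)

namespace GapChain

variable {n h w : ℝ} {Z : ℕ} {l : ℕ → ℝ}

theorem small_step (H : GapChain n Z h w l) {n₀ c d : ℝ} {i : ℕ} (hi : i < Z) (hn : n₀ ≤ n)
    (hn₀ : 6 ≤ n₀) (hc : 1 ≤ c) (hl : c ≤ l i) (hd : 2 * d + 3 ≤ (n₀ - 2) * c) :
    d ≤ l (i + 1) := by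
  have h1 := H.small i hi
  have h2 : (n₀ - 2) * c ≤ (n - 2) * l i :=
    mul_le_mul (by linarith) hl (by linarith) (by linarith)
  linarith

theorem large_step (H : GapChain n Z h w l) {n₀ c d : ℝ} {i : ℕ} (hi : i < Z) (hn : n₀ ≤ n)
    (hn₀ : 6 ≤ n₀) (hc : 2.2 ≤ c) (hl : c * w ≤ l i) (hd : d ≤ n₀ * (c - 1) - c - 0.2) :
    d * w ≤ l (i + 1) := by
  have h5 := H.five_le
  have h1 := H.large i hi (by nlinarith)
  have h2 : (n - 1) * (c * w) ≤ (n - 1) * l i := mul_le_mul_of_nonneg_left hl (by linarith)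
  have h3 : d * w ≤ (n₀ * (c - 1) - c - 0.2) * w := mul_le_mul_of_nonneg_right hd (by linarith)
  have h4 : n₀ * ((c - 1) * w) ≤ n * ((c - 1) * w) :=
    mul_le_mul_of_nonneg_right hn (mul_nonneg (by linarith) (by linarith))
  linarith

theorem last_step (H : GapChain n Z h w l) {i : ℕ} (hi : i < Z) (hn : 6 ≤ n)
    (hl : 53 * w ≤ l i) : 42 * n * w < l (i + 1) := by
  have h5 := H.five_le
  have h1 := H.large i hi (by linarith)
  have h2 : (n - 1) * (53 * w) ≤ (n - 1) * l i := mul_le_mul_of_nonneg_left hl (by linarith)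
  nlinarith

theorem last_step' (H : GapChain n Z h w l) {i : ℕ} (hi : i < Z) (hn : 200 ≤ n)
    (hl : 45 * w ≤ l i) : 42 * n * w < l (i + 1) := by
  have h5 := H.five_le
  have h1 := H.large i hi (by linarith)
  have h2 : (n - 1) * (45 * w) ≤ (n - 1) * l i := mul_le_mul_of_nonneg_left hl (by linarith)
  nlinarith

theorem lt_of_219 (H : GapChain n 4 h w l) (hn : 219 ≤ n) : 42 * n * w < l 3 := by
  have h0 := H.one_le
  have hh := H.height_le
  have hw := H.le_height 10
  have s0 := H.small 0 (by norm_num)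
  norm_num at s0 hw
  have h0' : 217 * l 0 ≤ (n - 2) * l 0 := mul_le_mul_of_nonneg_right (by linarith) (by linarith)
  have hn1 : n ≤ 2 * l 1 + 5 := by nlinarith
  have h2 : 107 * l 1 ≤ l 2 := H.small_step (i := 1) (by norm_num) hn (by norm_num)
    (by linarith) le_rfl (by linarith)
  exact H.last_step' (i := 2) (by norm_num) (by linarith) (by linarith)

theorem lt_of_39 (H : GapChain n 5 h w l) (hn : 39 ≤ n) : 42 * n * w < l 4 := by
  have h0 := H.one_le
  have hh := H.height_le
  have hw := H.le_height 8
  have s0 := H.small 0 (by norm_num)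
  norm_num at s0 hw
  have h0' : 37 * l 0 ≤ (n - 2) * l 0 := mul_le_mul_of_nonneg_right (by linarith) (by linarith)
  have hn1 : n ≤ 2 * l 1 + 5 := by nlinarith
  have h2 : 18 * l 1 ≤ l 2 := H.small_step (i := 1) (by norm_num) hn (by norm_num)
    (by linarith) le_rfl (by linarith)
  have h3 : 100 * w ≤ l 3 := H.large_step (i := 2) (c := 5) (by norm_num) hn (by norm_num)
    (by norm_num) (by linarith) (by norm_num)
  exact H.last_step (i := 3) (by norm_num) (by linarith) (by linarith [H.five_le])

theorem lt_of_17 (H : GapChain n 6 h w l) (hn : 17 ≤ n) : 42 * n * w < l 5 := by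
  have h0 := H.one_le
  have hh := H.height_le
  have hw := H.le_height 7
  have s0 := H.small 0 (by norm_num)
  norm_num at s0 hw
  have h0' : 15 * l 0 ≤ (n - 2) * l 0 := mul_le_mul_of_nonneg_right (by linarith) (by linarith)
  have hn1 : n ≤ 2 * l 1 + 5 := by nlinarith
  have h2 : 7 * l 1 ≤ l 2 := H.small_step (i := 1) (by norm_num) hn (by norm_num)
    (by linarith) le_rfl (by linarith)
  have h3 : 49 * l 1 ≤ l 3 := H.small_step (i := 2) (by norm_num) hn (by norm_num)
    (by linarith) h2 (by linarith)
  have h4 : 100 * w ≤ l 4 := H.large_step (i := 3) (c := 10) (by norm_num) hn (by norm_num)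
    (by norm_num) (by linarith) (by norm_num)
  exact H.last_step (i := 4) (by norm_num) (by linarith) (by linarith [H.five_le])

theorem lt_of_12 (H : GapChain n 7 h w l) (hn : 12 ≤ n) : 42 * n * w < l 6 := by
  have h0 := H.one_le
  have hh := H.height_le
  have hw := H.le_height 6
  have s0 := H.small 0 (by norm_num)
  norm_num at s0 hw
  have h0' : 10 * l 0 ≤ (n - 2) * l 0 := mul_le_mul_of_nonneg_right (by linarith) (by linarith)
  have hn1 : n ≤ 2 * l 1 + 5 := by nlinarith
  have h2 : 4.5 * l 1 ≤ l 2 := H.small_step (i := 1) (by norm_num) hn (by norm_num)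
    (by linarith) le_rfl (by linarith)
  have h3 : 22 * l 1 ≤ l 3 := H.small_step (i := 2) (by norm_num) hn (by norm_num)
    (by linarith) h2 (by linarith)
  have h4 : 30 * w ≤ l 4 := H.large_step (i := 3) (c := 4) (by norm_num) hn (by norm_num)
    (by norm_num) (by linarith) (by norm_num)
  have h5 : 100 * w ≤ l 5 := H.large_step (i := 4) (c := 30) (by norm_num) hn (by norm_num)
    (by norm_num) (by linarith) (by norm_num)
  exact H.last_step (i := 5) (by norm_num) (by linarith) (by linarith [H.five_le])

theorem lt_of_10 (H : GapChain n 8 h w l) (hn : 10 ≤ n) : 42 * n * w < l 7 := by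
  have h0 := H.one_le
  have hh := H.height_le
  have hw := H.le_height 6
  have s0 := H.small 0 (by norm_num)
  norm_num at s0 hw
  have h0' : 8 * l 0 ≤ (n - 2) * l 0 := mul_le_mul_of_nonneg_right (by linarith) (by linarith)
  have hn1 : n ≤ 2 * l 1 + 5 := by nlinarith
  have h2 : 3.4 * l 1 ≤ l 2 := H.small_step (i := 1) (by norm_num) hn (by norm_num)
    (by linarith) le_rfl (by linarith)
  have h3 : 13 * l 1 ≤ l 3 := H.small_step (i := 2) (by norm_num) hn (by norm_num)
    (by linarith) h2 (by linarith)
  have h4 : 51 * l 1 ≤ l 4 := H.small_step (i := 3) (by norm_num) hn (by norm_num)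
    (by linarith) h3 (by linarith)
  have h5 : 50 * w ≤ l 5 := H.large_step (i := 4) (c := 7) (by norm_num) hn (by norm_num)
    (by norm_num) (by linarith) (by norm_num)
  have h6 : 100 * w ≤ l 6 := H.large_step (i := 5) (c := 50) (by norm_num) hn (by norm_num)
    (by norm_num) (by linarith) (by norm_num)
  exact H.last_step (i := 6) (by norm_num) (by linarith) (by linarith [H.five_le])

theorem lt_of_9 (H : GapChain n 9 h w l) (hn : 9 ≤ n) : 42 * n * w < l 8 := by
  have h0 := H.one_le
  have hh := H.height_le
  have hw := H.le_height 6
  have s0 := H.small 0 (by norm_num)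
  norm_num at s0 hw
  have h0' : 7 * l 0 ≤ (n - 2) * l 0 := mul_le_mul_of_nonneg_right (by linarith) (by linarith)
  have hn1 : n ≤ 2 * l 1 + 5 := by nlinarith
  have h2 : 2.75 * l 1 ≤ l 2 := H.small_step (i := 1) (by norm_num) hn (by norm_num)
    (by linarith) le_rfl (by linarith)
  have h3 : 8.5 * l 1 ≤ l 3 := H.small_step (i := 2) (by norm_num) hn (by norm_num)
    (by linarith) h2 (by linarith)
  have h4 : 29 * l 1 ≤ l 4 := H.small_step (i := 3) (by norm_num) hn (by norm_num)
    (by linarith) h3 (by linarith)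
  have h5 : 100 * l 1 ≤ l 5 := H.small_step (i := 4) (by norm_num) hn (by norm_num)
    (by linarith) h4 (by linarith)
  have h6 : 60 * w ≤ l 6 := H.large_step (i := 5) (c := 10) (by norm_num) hn (by norm_num)
    (by norm_num) (by linarith) (by norm_num)
  have h7 : 100 * w ≤ l 7 := H.large_step (i := 6) (c := 60) (by norm_num) hn (by norm_num)
    (by norm_num) (by linarith) (by norm_num)
  exact H.last_step (i := 7) (by norm_num) (by linarith) (by linarith [H.five_le])

theorem lt_of_8 (H : GapChain n 11 h w l) (hn : 8 ≤ n) : 42 * n * w < l 9 := by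
  have h0 := H.one_le
  have hh := H.height_le
  have hw := H.le_height 6
  have s0 := H.small 0 (by norm_num)
  norm_num at s0 hw
  have h0' : 6 * l 0 ≤ (n - 2) * l 0 := mul_le_mul_of_nonneg_right (by linarith) (by linarith)
  have hn1 : n ≤ 2 * l 1 + 5 := by nlinarith
  have h2 : 2 * l 1 ≤ l 2 := H.small_step (i := 1) (by norm_num) hn (by norm_num)
    (by linarith) le_rfl (by linarith)
  have h3 : 5 * l 1 ≤ l 3 := H.small_step (i := 2) (by norm_num) hn (by norm_num)
    (by linarith) h2 (by linarith)
  have h4 : 14 * l 1 ≤ l 4 := H.small_step (i := 3) (by norm_num) hn (by norm_num)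
    (by linarith) h3 (by linarith)
  have h5 : 41 * l 1 ≤ l 5 := H.small_step (i := 4) (by norm_num) hn (by norm_num)
    (by linarith) h4 (by linarith)
  have h6 : 122 * l 1 ≤ l 6 := H.small_step (i := 5) (by norm_num) hn (by norm_num)
    (by linarith) h5 (by linarith)
  have h7 : 60 * w ≤ l 7 := H.large_step (i := 6) (c := 11) (by norm_num) hn (by norm_num)
    (by norm_num) (by linarith) (by norm_num)
  have h8 : 100 * w ≤ l 8 := H.large_step (i := 7) (c := 60) (by norm_num) hn (by norm_num)
    (by norm_num) (by linarith) (by norm_num)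
  exact H.last_step (i := 8) (by norm_num) (by linarith) (by linarith [H.five_le])

theorem lt_of_7 (H : GapChain 7 12 h w l) (hl : 1.5 ≤ l 1) : 42 * 7 * w < l 10 := by
  have h0 := H.one_le
  have hh := H.height_le
  have hw := H.le_height 5
  have s0 := H.small 0 (by norm_num)
  norm_num at s0 hw
  have hn : (7 : ℝ) ≤ 7 := le_rfl
  have h2 : 1.5 * l 1 ≤ l 2 := H.small_step (i := 1) (by norm_num) hn (by norm_num)
    (by linarith) le_rfl (by linarith)
  have h3 : 2.75 * l 1 ≤ l 3 := H.small_step (i := 2) (by norm_num) hn (by norm_num)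
    (by linarith) h2 (by linarith)
  have h4 : 5.875 * l 1 ≤ l 4 := H.small_step (i := 3) (by norm_num) hn (by norm_num)
    (by linarith) h3 (by linarith)
  have h5 : 13 * l 1 ≤ l 5 := H.small_step (i := 4) (by norm_num) hn (by norm_num)
    (by linarith) h4 (by linarith)
  have h6 : 31 * l 1 ≤ l 6 := H.small_step (i := 5) (by norm_num) hn (by norm_num)
    (by linarith) h5 (by linarith)
  have h7 : 76 * l 1 ≤ l 7 := H.small_step (i := 6) (by norm_num) hn (by norm_num)
    (by linarith) h6 (by linarith)
  have h8 : 40 * w ≤ l 8 := H.large_step (i := 7) (c := 8) (by norm_num) hn (by norm_num)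
    (by norm_num) (by linarith) (by norm_num)
  have h9 : 100 * w ≤ l 9 := H.large_step (i := 8) (c := 40) (by norm_num) hn (by norm_num)
    (by norm_num) (by linarith) (by norm_num)
  exact H.last_step (i := 9) (by norm_num) (by linarith) (by linarith [H.five_le])

theorem lt_of_6 (H : GapChain 6 15 h w l) (hl : 2 ≤ l 2) : 42 * 6 * w < l 13 := by
  have h0 := H.one_le
  have hh := H.height_le
  have hw := H.le_height 5
  have s0 := H.small 0 (by norm_num)
  have s1 := H.small 1 (by norm_num)
  norm_num at s0 s1 hw
  have hn : (6 : ℝ) ≤ 6 := le_rfl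
  have h3 : 1.25 * l 2 ≤ l 3 := H.small_step (i := 2) (by norm_num) hn (by norm_num)
    (by linarith) le_rfl (by linarith)
  have h4 : 1.75 * l 2 ≤ l 4 := H.small_step (i := 3) (by norm_num) hn (by norm_num)
    (by linarith) h3 (by linarith)
  have h5 : 2.75 * l 2 ≤ l 5 := H.small_step (i := 4) (by norm_num) hn (by norm_num)
    (by linarith) h4 (by linarith)
  have h6 : 4.75 * l 2 ≤ l 6 := H.small_step (i := 5) (by norm_num) hn (by norm_num)
    (by linarith) h5 (by linarith)
  have h7 : 8.75 * l 2 ≤ l 7 := H.small_step (i := 6) (by norm_num) hn (by norm_num)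
    (by linarith) h6 (by linarith)
  have h8 : 16.75 * l 2 ≤ l 8 := H.small_step (i := 7) (by norm_num) hn (by norm_num)
    (by linarith) h7 (by linarith)
  have h9 : 32 * l 2 ≤ l 9 := H.small_step (i := 8) (by norm_num) hn (by norm_num)
    (by linarith) h8 (by linarith)
  have h10 : 13 * w ≤ l 10 := H.large_step (i := 9) (c := 4) (by norm_num) hn (by norm_num)
    (by norm_num) (by linarith) (by norm_num)
  have h11 : 55 * w ≤ l 11 := H.large_step (i := 10) (c := 13) (by norm_num) hn (by norm_num)
    (by norm_num) (by linarith) (by norm_num)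
  have h12 : 100 * w ≤ l 12 := H.large_step (i := 11) (c := 55) (by norm_num) hn (by norm_num)
    (by norm_num) (by linarith) (by norm_num)
  exact H.last_step (i := 12) (by norm_num) (by linarith) (by linarith [H.five_le])

end GapChain

theorem exists_multiplier {m : ℕ} (hm : 0 < m) {D L Λ : ℝ} (hL : 0 < L) (h : 7.5 * m * L ≤ Λ)
    (hD : 7.5 * (m + 1) ≤ D * m) :
    ∃ s : ℕ, 0 < s ∧ 7.5 * s * L ≤ Λ ∧ Λ ≤ D * s * L := by
  have hm' : (0 : ℝ) < m := by exact_mod_cast hm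
  have hms : m ≤ ⌊Λ / (7.5 * L)⌋₊ := by
    apply Nat.le_floor
    rw [le_div_iff₀ (by positivity)]
    linarith
  refine ⟨⌊Λ / (7.5 * L)⌋₊, hm.trans_le hms, ?_, ?_⟩
  · have h1 := Nat.floor_le (a := Λ / (7.5 * L))
      (div_nonneg (le_trans (by positivity) h) (by positivity))
    rw [le_div_iff₀ (by positivity)] at h1
    linarith
  · have h2 := (Nat.lt_floor_add_one (Λ / (7.5 * L))).le
    rw [div_le_iff₀ (by positivity)] at h2
    obtain ⟨s, hs⟩ : ∃ s : ℝ, s = (⌊Λ / (7.5 * L)⌋₊ : ℕ) := ⟨_, rfl⟩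
    rw [← hs] at h2 ⊢
    have h3 : (m : ℝ) ≤ s := by rw [hs]; exact_mod_cast hms
    have hD' : 7.5 ≤ D := by
      by_contra! hlt
      nlinarith [mul_lt_mul_of_pos_right hlt hm']
    have h4 : 7.5 * (s + 1) ≤ D * s := by
      nlinarith [mul_le_mul_of_nonneg_left h3 (sub_nonneg.2 hD')]
    nlinarith [mul_le_mul_of_nonneg_right h4 hL.le]

namespace GapChain

variable {h w : ℝ} {Z : ℕ} {l : ℕ → ℝ}

theorem ratio_step {n : ℝ} (H : GapChain n Z h w l) {i : ℕ} (hi : i < Z) (hn : 6 ≤ n)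
    (hl : 42 * n * w < l i) : (n - 1.03) * l i ≤ l (i + 1) ∧ 42 * n * w < l (i + 1) := by
  have h5 := H.five_le
  have h6 : 30 ≤ n * w := by nlinarith
  have h1 := H.large i hi (by nlinarith)
  have h2 : (n - 1.03) * l i ≤ l (i + 1) := by nlinarith
  refine ⟨h2, ?_⟩
  nlinarith

theorem exists_pair {n : ℕ} (H : GapChain n (z n) h w l) (hn : 6 ≤ n)
    (h7 : n = 7 → 1.5 ≤ l 1) (h6 : n = 6 → 2 ≤ l 2) :
    ∃ i j s : ℕ, i < j ∧ j ≤ z n ∧ 0 < s ∧ 42 * n * w < l i ∧ 7.5 * s * l i ≤ l j ∧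
      l j ≤ (2 * n - 0.8) * s * l i := by
  have h5 := H.five_le
  have hn' : (6 : ℝ) ≤ n := by exact_mod_cast hn
  have hw : 30 ≤ n * w := by nlinarith
  have single : ∀ i < z n, 9 ≤ n → 42 * n * w < l i → ∃ i j s : ℕ, i < j ∧ j ≤ z n ∧ 0 < s ∧
      42 * n * w < l i ∧ 7.5 * s * l i ≤ l j ∧ l j ≤ (2 * n - 0.8) * s * l i := by
    intro i hi h9 hl
    have h9' : (9 : ℝ) ≤ n := by exact_mod_cast h9
    have h1 := (H.ratio_step hi hn' hl).1
    obtain ⟨s, hs⟩ := exists_multiplier (m := 1) one_pos (D := 2 * n - 0.8) (L := l i)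
      (Λ := l (i + 1)) (by linarith) (by push_cast; nlinarith) (by push_cast; linarith)
    exact ⟨i, i + 1, s, by omega, by omega, hs.1, hl, hs.2⟩
  have double : ∀ i, i + 1 < z n → 42 * n * w < l i → ∃ i j s : ℕ, i < j ∧ j ≤ z n ∧ 0 < s ∧
      42 * n * w < l i ∧ 7.5 * s * l i ≤ l j ∧ l j ≤ (2 * n - 0.8) * s * l i := by
    intro i hi hl
    have h1 := H.ratio_step (by omega) hn' hl
    have h2 := (H.ratio_step hi hn' h1.2).1
    have h3 : 4.97 * l i ≤ l (i + 1) := by nlinarith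
    have h4 : 4.97 * l (i + 1) ≤ l (i + 2) := by nlinarith
    obtain ⟨s, hs⟩ := exists_multiplier (m := 3) (by norm_num) (D := 2 * n - 0.8) (L := l i)
      (Λ := l (i + 2)) (by linarith) (by push_cast; linarith) (by push_cast; linarith)
    exact ⟨i, i + 2, s, by omega, by omega, hs.1, hl, hs.2⟩
  rcases (by omega : n = 6 ∨ n = 7 ∨ n = 8 ∨ n = 9 ∨ (10 ≤ n ∧ n ≤ 11) ∨ (12 ≤ n ∧ n ≤ 16) ∨
    (17 ≤ n ∧ n ≤ 38) ∨ (39 ≤ n ∧ n ≤ 218) ∨ 219 ≤ n) with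
    rfl | rfl | rfl | rfl | hr | hr | hr | hr | hr
  · have e : z 6 = 15 := by simp [z]
    rw [e] at H double
    exact e ▸ double 13 (by norm_num) (by exact_mod_cast lt_of_6 (by exact_mod_cast H) (h6 rfl))
  · have e : z 7 = 12 := by simp [z]
    rw [e] at H double
    exact e ▸ double 10 (by norm_num) (by exact_mod_cast lt_of_7 (by exact_mod_cast H) (h7 rfl))
  · have e : z 8 = 11 := by simp [z]
    rw [e] at H double
    exact e ▸ double 9 (by norm_num) (H.lt_of_8 (by norm_num))
  · have e : z 9 = 9 := by simp [z]
    rw [e] at H single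
    exact e ▸ single 8 (by norm_num) le_rfl (H.lt_of_9 (by norm_num))
  · have e : z n = 8 := by simp only [z]; split_ifs <;> omega
    rw [e] at H single ⊢
    exact single 7 (by norm_num) (by omega) (H.lt_of_10 (by exact_mod_cast hr.1))
  · have e : z n = 7 := by simp only [z]; split_ifs <;> omega
    rw [e] at H single ⊢
    exact single 6 (by norm_num) (by omega) (H.lt_of_12 (by exact_mod_cast hr.1))
  · have e : z n = 6 := by simp only [z]; split_ifs <;> omega
    rw [e] at H single ⊢
    exact single 5 (by norm_num) (by omega) (H.lt_of_17 (by exact_mod_cast hr.1))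
  · have e : z n = 5 := by simp only [z]; split_ifs <;> omega
    rw [e] at H single ⊢
    exact single 4 (by norm_num) (by omega) (H.lt_of_39 (by exact_mod_cast hr.1))
  · have e : z n = 4 := by simp only [z]; split_ifs <;> omega
    rw [e] at H single ⊢
    exact single 3 (by norm_num) (by omega) (H.lt_of_219 (by exact_mod_cast hr))

end GapChain

theorem logb_le_degree_bound {n : ℝ} (hn : 0 < n) (m : ℕ) :
    Real.logb 2 (6 * n) ≤ m + 1.45 * (6 * n / 2 ^ m - 1) + 0.01 := by
  obtain ⟨r, hr⟩ : ∃ r, r = 6 * n / 2 ^ m := ⟨_, rfl⟩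
  have hr0 : 0 < r := by rw [hr]; positivity
  have e : 6 * n = 2 ^ m * r := by rw [hr]; field_simp
  rw [← hr, e, Real.logb_mul (by positivity) hr0.ne', Real.logb_pow, Real.logb_self_eq_one
    (by norm_num), Real.logb]
  have h1 := Real.log_le_sub_one_of_pos hr0
  have h2 := Real.log_two_gt_d9
  have h3 := Real.log_two_lt_d9
  have h4 : Real.log r / Real.log 2 ≤ 1.45 * (r - 1) + 0.01 := by
    rw [div_le_iff₀ (by linarith)]
    rcases le_total 1 r with h | h
    · nlinarith
    · nlinarith
  linarith

/-- A list of `Z + 1` distinct solutions on a branch, ordered by the size of the middle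
monomial. -/
structure SolutionChain (a b c : ℤ) (p q Z : ℕ) (x y : ℕ → ℤ) : Prop where
  sol : ∀ i ≤ Z, IsBranchSolution a b c p q (x i) (y i)
  ne : ∀ i j, i < j → j ≤ Z → ¬ (x i = x j ∧ y i = y j)
  mono : ∀ i j, i < j → j ≤ Z → x i ^ q * y i ^ p ≤ x j ^ q * y j ^ p

theorem logb_max_facts {Q : ℤ} (hQ : 2 ≤ Q) : 1 ≤ Real.logb 2 Q ∧ (0 : ℝ) < Q := by
  have hQ' : (2 : ℝ) ≤ Q := by exact_mod_cast hQ
  refine ⟨?_, by linarith⟩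
  rw [Real.le_logb_iff_rpow_le (by norm_num) (by linarith)]
  simpa using hQ'

theorem logb_pow_le {Q Q' : ℤ} {n : ℕ} (hQ : 2 ≤ Q) (hQ' : 2 ≤ Q')
    (h : Q ^ n ≤ 8 * (Q * Q') ^ 2) :
    (n - 2) * Real.logb 2 Q ≤ 2 * Real.logb 2 Q' + 3 := by
  obtain ⟨-, h0⟩ := logb_max_facts hQ
  obtain ⟨-, h0'⟩ := logb_max_facts hQ'
  have h1 : (Q : ℝ) ^ n ≤ 2 ^ 3 * ((Q : ℝ) * Q') ^ 2 := by
    have : (Q : ℝ) ^ n ≤ 8 * ((Q : ℝ) * Q') ^ 2 := by exact_mod_cast h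
    linarith
  have h2 := Real.logb_le_logb_of_le (b := 2) (by norm_num) (by positivity) h1
  rw [Real.logb_mul (by positivity) (by positivity), Real.logb_pow, Real.logb_pow, Real.logb_pow,
    Real.logb_mul (by positivity) (by positivity), Real.logb_self_eq_one (by norm_num)] at h2
  push_cast at h2
  linarith

namespace SolutionChain

variable {a b c : ℤ} {p q Z : ℕ} {x y : ℕ → ℤ}

theorem two_le (S : SolutionChain a b c p q Z x y) {i : ℕ} (hi : i ≤ Z) : 2 ≤ max (x i) (y i) :=
  (S.sol i hi).two_le_max

theorem pow_max_le (hp : 0 < p) (hq : 0 < q) (hn : 6 ≤ p + q) (ha : 0 < a) (hc : c ≠ 0)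
    (S : SolutionChain a b c p q Z x y) {i j : ℕ} (hij : i < j) (hj : j ≤ Z) :
    max (x i) (y i) ^ (p + q) ≤ 8 * (max (x i) (y i) * max (x j) (y j)) ^ 2 := by
  have hi := S.sol i (by omega)
  obtain ⟨h1, h2⟩ := hi.gap_le hp hq hn ha hc (S.sol j hj) (S.ne i j hij hj) (S.mono i j hij hj)
  exact hi.max_pow_le ha.ne' hc h1 h2

theorem logb_height_le (hp : 0 < p) (hq : 0 < q) (hn : 6 ≤ p + q) (ha : 0 < a) (hc : c ≠ 0)
    (S : SolutionChain a b c p q Z x y) (hZ : 1 ≤ Z) :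
    Real.logb 2 ((max (max |a| |b|) |c| : ℤ) : ℝ) ≤
      2 * (Real.logb 2 (max (x 0) (y 0) : ℤ) + Real.logb 2 (max (x 1) (y 1) : ℤ)) + 3 := by
  have h0 := S.sol 0 (by omega)
  obtain ⟨h1, h2⟩ := h0.gap_le hp hq hn ha hc (S.sol 1 hZ) (S.ne 0 1 one_pos hZ)
    (S.mono 0 1 one_pos hZ)
  obtain ⟨h3, h4, h5⟩ := h0.coeff_le hp hq h1 h2
  have h6 := max_le (max_le h3 h4) h5
  obtain ⟨-, e0⟩ := logb_max_facts (S.two_le (Nat.zero_le Z))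
  obtain ⟨-, e1⟩ := logb_max_facts (S.two_le hZ)
  generalize max (x 0) (y 0) = Q at *
  generalize max (x 1) (y 1) = Q' at *
  have h7 : 0 < max (max |a| |b|) |c| :=
    lt_max_of_lt_left (lt_max_of_lt_left (abs_pos.2 ha.ne'))
  generalize max (max |a| |b|) |c| = H at *
  have h8 : (H : ℝ) ≤ 2 ^ 3 * ((Q : ℝ) * Q') ^ 2 := by
    have : (H : ℝ) ≤ 8 * ((Q : ℝ) * Q') ^ 2 := by exact_mod_cast h6
    linarith
  have h9 := Real.logb_le_logb_of_le (b := 2) (by norm_num) (by exact_mod_cast h7) h8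
  rw [Real.logb_mul (by positivity) (by positivity), Real.logb_pow, Real.logb_pow,
    Real.logb_mul (by positivity) (by positivity), Real.logb_self_eq_one (by norm_num)] at h9
  push_cast at h9
  linarith

theorem three_le_second (hp : 0 < p) (hq : 0 < q) (hn : 6 ≤ p + q) (ha : 0 < a) (hc : c ≠ 0)
    (S : SolutionChain a b c p q Z x y) (hZ : 1 ≤ Z) : 3 ≤ max (x 1) (y 1) := by
  have h2 := (S.sol 0 (by omega)).max_ne_two hp hq hn ha hc (S.sol 1 hZ) (S.ne 0 1 one_pos hZ)
    (S.mono 0 1 one_pos hZ)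
  have h3 := S.pow_max_le hp hq hn ha hc one_pos hZ
  have h4 := S.two_le (Nat.zero_le Z)
  have h5 := S.two_le hZ
  generalize max (x 0) (y 0) = Q at *
  generalize max (x 1) (y 1) = Q' at *
  by_contra! h6
  have h7 : Q' = 2 := by omega
  subst h7
  have h8 : 3 ≤ Q := by omega
  have h9 : Q ^ 6 ≤ Q ^ (p + q) := pow_le_pow_right₀ (by omega) hn
  have h10 : 81 * Q ^ 2 ≤ Q ^ 6 := by
    have h11 : (9 : ℤ) ≤ Q ^ 2 := by nlinarith
    have h12 : (81 : ℤ) ≤ Q ^ 4 := by nlinarith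
    nlinarith [mul_le_mul_of_nonneg_right h12 (sq_nonneg Q)]
  nlinarith

theorem four_le_third (hp : 0 < p) (hq : 0 < q) (hn : 6 ≤ p + q) (ha : 0 < a) (hc : c ≠ 0)
    (S : SolutionChain a b c p q Z x y) (hZ : 2 ≤ Z) : 4 ≤ max (x 2) (y 2) := by
  have h8 := S.three_le_second hp hq hn ha hc (by omega)
  have h3 := S.pow_max_le hp hq hn ha hc one_lt_two hZ
  have h5 := S.two_le hZ
  generalize max (x 1) (y 1) = Q at *
  generalize max (x 2) (y 2) = Q' at *
  by_contra! h6
  have h9 : Q ^ 6 ≤ Q ^ (p + q) := pow_le_pow_right₀ (by omega) hn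
  have h10 : 81 * Q ^ 2 ≤ Q ^ 6 := by
    have h11 : (9 : ℤ) ≤ Q ^ 2 := by nlinarith
    have h12 : (81 : ℤ) ≤ Q ^ 4 := by nlinarith
    nlinarith [mul_le_mul_of_nonneg_right h12 (sq_nonneg Q)]
  have h13 : Q' ^ 2 ≤ 9 := by nlinarith
  nlinarith [mul_le_mul_of_nonneg_left h13 (sq_nonneg Q), mul_pow Q Q' 2]

end SolutionChain

theorem large_of_logb {N : ℝ} (hN : 0 < N) {Q : ℤ} (hQ : 2 ≤ Q)
    (h : 2 * Real.logb 2 N + 1 ≤ Real.logb 2 Q) : 2 * N ^ 2 ≤ Q := by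
  obtain ⟨-, h0⟩ := logb_max_facts hQ
  rw [← Real.logb_le_logb (b := 2) (by norm_num) (by positivity) h0,
    Real.logb_mul (by positivity) (by positivity), Real.logb_pow,
    Real.logb_self_eq_one (by norm_num)]
  push_cast
  linarith

theorem logb_step_le {N : ℝ} (hN : 0 < N) {Q Q' : ℤ} (hQ : 2 ≤ Q) (hQ' : 2 ≤ Q') {n : ℕ}
    (hn : 1 ≤ n) (h : (Q : ℝ) ^ (n - 1) ≤ 2 * N ^ n * Q') :
    (n - 1) * Real.logb 2 Q - 1 - n * Real.logb 2 N ≤ Real.logb 2 Q' := by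
  obtain ⟨-, h0⟩ := logb_max_facts hQ
  obtain ⟨-, h0'⟩ := logb_max_facts hQ'
  have h2 := Real.logb_le_logb_of_le (b := 2) (by norm_num) (by positivity) h
  rw [Real.logb_mul (by positivity) (by positivity), Real.logb_mul (by positivity)
    (by positivity), Real.logb_pow, Real.logb_pow, Real.logb_self_eq_one (by norm_num),
    Nat.cast_sub hn] at h2
  push_cast at h2
  linarith

namespace IsBranchSolution

variable {a b c : ℤ} {p q : ℕ} {x y x' y' : ℤ}

/-- Two large solutions on a branch approximate the same root. -/
theorem exists_common_root (hp : 0 < p) (hq : 0 < q) (hn : 6 ≤ p + q) (ha : 0 < a) (hc : c ≠ 0)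
    (hirr : Irreducible (C a * X ^ (p + q) + C b * X ^ q + C c : ℤ[X]))
    (h : IsBranchSolution a b c p q x y) (h' : IsBranchSolution a b c p q x' y') {H : ℝ}
    (hbH : |(b : ℝ)| ≤ H) (hcH : |(c : ℝ)| ≤ H) (hH1 : 1 ≤ H)
    (hl : 2 * (6 * (p + q : ℕ) * H) ^ 2 ≤ max x y)
    (hl' : 2 * (6 * (p + q : ℕ) * H) ^ 2 ≤ max x' y') :
    ∃ α : ℝ, 0 < α ∧ α ≤ 2 * H ∧ a * α ^ (p + q) + b * α ^ q + c = 0 ∧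
      |Real.log (x / y) - Real.log α|
        ≤ (6 * (p + q : ℕ) * H) ^ (p + q) / (max x y : ℤ) ^ (p + q) ∧
      |Real.log (x' / y') - Real.log α|
        ≤ (6 * (p + q : ℕ) * H) ^ (p + q) / (max x' y' : ℤ) ^ (p + q) := by
  obtain ⟨α, hα, h1, h2, h3⟩ := h.exists_root_near hp hq hn ha hc hirr hbH hH1 hl
  obtain ⟨β, hβ, h4, h5, h6⟩ := h'.exists_root_near hp hq hn ha hc hirr hbH hH1 hl'
  have e : α = β := root_unique (by exact_mod_cast ha) hp hα hβ h1 h4 h2 h5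
  subst e
  exact ⟨α, hα, root_le (by exact_mod_cast ha) hp hα h1 hH1 hbH hcH, h1, h3, h6⟩

/-- The approximation to a root, with heights expressed through exponentials. -/
theorem abs_div_sub_le_exp (h : IsBranchSolution a b c p q x y) {H α w L : ℝ} (hn : 1 ≤ p + q)
    (hH1 : 1 ≤ H) (hα : 0 < α) (hαH : α ≤ 2 * H) (hw : 6 * (p + q : ℕ) * H = Real.exp w)
    (hL : ((max x y : ℤ) : ℝ) = Real.exp L) (hwL : w ≤ L)
    (h1 : |Real.log (x / y) - Real.log α|
        ≤ (6 * (p + q : ℕ) * H) ^ (p + q) / (max x y : ℤ) ^ (p + q)) :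
    |(x : ℝ) / y - α| ≤ Real.exp (((p + q : ℕ) + 1) * w - (p + q : ℕ) * L) := by
  have hn' : (1 : ℝ) ≤ (p + q : ℕ) := by exact_mod_cast hn
  have h2 := abs_div_sub_le (Q := (max x y : ℤ)) (n := p + q) h.x_pos h.y_pos hα hαH (by linarith)
    (by
      rw [hw, hL, ← div_pow]
      exact pow_le_one₀ (by positivity)
        ((div_le_one (Real.exp_pos _)).2 (Real.exp_le_exp.2 hwL))) h1
  refine h2.trans ?_
  have e : Real.exp (((p + q : ℕ) + 1) * w - (p + q : ℕ) * L) =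
      Real.exp w * (Real.exp w ^ (p + q) / Real.exp L ^ (p + q)) := by
    rw [← Real.exp_nat_mul, ← Real.exp_nat_mul, ← Real.exp_sub, ← Real.exp_add]
    congr 1
    ring
  rw [e, hw, hL, ← hw]
  refine mul_le_mul_of_nonneg_right ?_ (by positivity)
  nlinarith

end IsBranchSolution

namespace SolutionChain

variable {a b c : ℤ} {p q Z : ℕ} {x y : ℕ → ℤ}

theorem gapChain (hp : 0 < p) (hq : 0 < q) (hn : 6 ≤ p + q) (ha : 0 < a) (hc : c ≠ 0)
    (hirr : Irreducible (C a * X ^ (p + q) + C b * X ^ q + C c : ℤ[X]))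
    (S : SolutionChain a b c p q Z x y) (hZ : 1 ≤ Z) {H : ℝ}
    (hH : H = (max (max |a| |b|) |c| : ℤ)) :
    GapChain (p + q : ℕ) Z (Real.logb 2 H) (Real.logb 2 (6 * (p + q : ℕ) * H))
      (fun i => Real.logb 2 (max (x i) (y i) : ℤ)) := by
  have hn' : (6 : ℝ) ≤ (p + q : ℕ) := by exact_mod_cast hn
  have hbH : |(b : ℝ)| ≤ H := by
    rw [hH]; exact_mod_cast (le_max_right _ _).trans (le_max_left _ _)
  have hcH : |(c : ℝ)| ≤ H := by
    rw [hH]; exact_mod_cast le_max_right _ _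
  have hH1 : 1 ≤ H := by
    rw [hH]
    exact_mod_cast (Int.one_le_abs ha.ne').trans ((le_max_left |a| |b|).trans (le_max_left _ _))
  have h5 : 5 ≤ Real.logb 2 (6 * (p + q : ℕ) * H) := by
    rw [Real.le_logb_iff_rpow_le (by norm_num) (by positivity)]
    have e : (2 : ℝ) ^ (5 : ℝ) = 32 := by norm_num
    rw [e]
    nlinarith
  refine ⟨(logb_max_facts (S.two_le (Nat.zero_le Z))).1, ?_, ?_, h5, ?_, ?_⟩
  · rw [hH]
    exact S.logb_height_le hp hq hn ha hc hZ
  · intro m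
    rw [Real.logb_mul (by positivity) (by positivity)]
    linarith [logb_le_degree_bound (n := (p + q : ℕ)) (by linarith) m]
  · intro i hi
    exact logb_pow_le (S.two_le hi.le) (S.two_le hi)
      (S.pow_max_le hp hq hn ha hc (Nat.lt_succ_self i) hi)
  · intro i hi hl
    have hsm := logb_pow_le (S.two_le hi.le) (S.two_le hi)
      (S.pow_max_le hp hq hn ha hc (Nat.lt_succ_self i) hi)
    have hQ := S.two_le hi.le
    have hQ' := S.two_le (show i + 1 ≤ Z from hi)
    change 2 * _ + 1 ≤ Real.logb 2 (max (x i) (y i) : ℤ) at hl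
    have hll : Real.logb 2 (max (x i) (y i) : ℤ) ≤
        Real.logb 2 (max (x (i + 1)) (y (i + 1)) : ℤ) := by nlinarith
    have hle : max (x i) (y i) ≤ max (x (i + 1)) (y (i + 1)) := by
      rw [Real.logb_le_logb (by norm_num) (logb_max_facts hQ).2 (logb_max_facts hQ').2] at hll
      exact_mod_cast hll
    have hl1 := large_of_logb (by positivity) hQ hl
    have hl2 := large_of_logb (by positivity) hQ' (hl.trans hll)
    obtain ⟨α, -, -, -, h1, h2⟩ := (S.sol i hi.le).exists_common_root hp hq hn ha hc hirr
      (S.sol (i + 1) hi) hbH hcH hH1 (by exact_mod_cast hl1) (by exact_mod_cast hl2)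
    have h3 := IsBranchSolution.pow_le_of_near hp hq (S.sol i hi.le) (S.sol (i + 1) hi)
      (S.ne i (i + 1) (Nat.lt_succ_self i) hi) hle (by positivity) h1 h2
    exact logb_step_le (by positivity) hQ hQ' (by omega) h3

theorem not_of_le (hp : 0 < p) (hq : 0 < q) (hn : 6 ≤ p + q) (ha : 0 < a) (hc : c ≠ 0)
    (hirr : Irreducible (C a * X ^ (p + q) + C b * X ^ q + C c : ℤ[X])) :
    ¬ SolutionChain a b c p q (z (p + q)) x y := by
  intro S
  obtain ⟨H, hH⟩ : ∃ H : ℝ, H = (max (max |a| |b|) |c| : ℤ) := ⟨_, rfl⟩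
  have hz : 2 ≤ z (p + q) := by simp only [z]; split_ifs <;> omega
  have G := S.gapChain hp hq hn ha hc hirr (by omega) hH
  have hn' : (6 : ℝ) ≤ (p + q : ℕ) := by exact_mod_cast hn
  have haH : |(a : ℝ)| ≤ H := by
    rw [hH]; exact_mod_cast (le_max_left _ _).trans (le_max_left _ _)
  have hbH : |(b : ℝ)| ≤ H := by
    rw [hH]; exact_mod_cast (le_max_right _ _).trans (le_max_left _ _)
  have hcH : |(c : ℝ)| ≤ H := by
    rw [hH]; exact_mod_cast le_max_right _ _
  have hH1 : 1 ≤ H := by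
    rw [hH]
    exact_mod_cast (Int.one_le_abs ha.ne').trans ((le_max_left |a| |b|).trans (le_max_left _ _))
  obtain ⟨i, j, s, hij, hj, hs, h1, h2, h3⟩ := G.exists_pair hn
    (fun _ => by
      have h3 := S.three_le_second hp hq hn ha hc (by omega)
      have h3' : (3 : ℝ) ≤ (max (x 1) (y 1) : ℤ) := by exact_mod_cast h3
      rw [Real.le_logb_iff_rpow_le (by norm_num) (by linarith)]
      refine le_trans ?_ h3'
      have e : ((2 : ℝ) ^ (1.5 : ℝ)) ^ 2 = 8 := by
        rw [← Real.rpow_natCast, ← Real.rpow_mul (by norm_num)]; norm_num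
      nlinarith)
    (fun _ => by
      have h3 := S.four_le_third hp hq hn ha hc hz
      have h3' : (4 : ℝ) ≤ (max (x 2) (y 2) : ℤ) := by exact_mod_cast h3
      rw [Real.le_logb_iff_rpow_le (by norm_num) (by linarith)]
      refine le_trans ?_ h3'
      norm_num)
  have h5 := G.five_le
  have hi : i ≤ z (p + q) := by omega
  have hl : Real.logb 2 (max (x i) (y i) : ℤ) ≤ Real.logb 2 (max (x j) (y j) : ℤ) := by
    have hs1 : (1 : ℝ) ≤ s := by exact_mod_cast hs
    have hpos : 0 ≤ Real.logb 2 (max (x i) (y i) : ℤ) := by nlinarith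
    nlinarith [mul_le_mul_of_nonneg_right hs1 hpos]
  have hwl : 2 * Real.logb 2 (6 * (p + q : ℕ) * H) + 1 ≤ Real.logb 2 (max (x i) (y i) : ℤ) := by
    nlinarith
  have hl1 := large_of_logb (by positivity) (S.two_le hi) hwl
  have hl2 := large_of_logb (by positivity) (S.two_le hj) (hwl.trans hl)
  obtain ⟨α, hα, hαH, hroot, hi1, hj1⟩ := (S.sol i hi).exists_common_root hp hq hn ha hc hirr
    (S.sol j hj) hbH hcH hH1 (by exact_mod_cast hl1) (by exact_mod_cast hl2)
  have t : 0 < Real.log 2 := Real.log_pos (by norm_num)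
  have toLog : ∀ r : ℝ, Real.log r = Real.logb 2 r * Real.log 2 := fun r => by
    rw [Real.logb, div_mul_cancel₀ _ t.ne']
  obtain ⟨-, qi⟩ := logb_max_facts (S.two_le hi)
  obtain ⟨-, qj⟩ := logb_max_facts (S.two_le hj)
  have ew := (Real.exp_log (show 0 < 6 * (p + q : ℕ) * H by positivity)).symm
  have ei := (Real.exp_log qi).symm
  have ej := (Real.exp_log qj).symm
  have kw := toLog (6 * (p + q : ℕ) * H)
  have ki := toLog (max (x i) (y i) : ℤ)
  have kj := toLog (max (x j) (y j) : ℤ)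
  have n1 := (S.sol i hi).abs_div_sub_le_exp (by omega) hH1 hα hαH ew ei
    (by rw [kw, ki]; exact mul_le_mul_of_nonneg_right (by linarith) t.le) hi1
  have n2 := (S.sol j hj).abs_div_sub_le_exp (by omega) hH1 hα hαH ew ej
    (by rw [kw, kj]; exact mul_le_mul_of_nonneg_right (by linarith) t.le) hj1
  refine thue_gap (k := q) hq (by omega) hn hirr hroot ha.ne' haH hbH hcH
    (by rwa [abs_of_pos hα]) ew hs (S.sol i hi).x_pos (S.sol i hi).y_pos (S.sol j hj).y_pos
    ((S.sol i hi).isCoprime hp hq) ?_ ?_ ?_ n1 n2 ?_ ?_ ?_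
  · rw [← ei]
    rcases max_choice (x i) (y i) with hm | hm
    · left; rw [hm]
    · right; rw [hm]
  · rw [← ei]; exact_mod_cast le_max_right _ _
  · rw [← ej]; exact_mod_cast le_max_right _ _
  · rw [kw, ki]; linarith [mul_lt_mul_of_pos_right h1 t]
  · rw [ki, kj]; linarith [mul_le_mul_of_nonneg_right h2 t.le]
  · rw [ki, kj]; linarith [mul_le_mul_of_nonneg_right h3 t.le]

end SolutionChain

/-- A branch carries at most `z (p + q)` solutions. -/
theorem IsBranchSolution.encard_le {a b c : ℤ} {p q : ℕ} (hp : 0 < p) (hq : 0 < q)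
    (hn : 6 ≤ p + q) (ha : 0 < a) (hc : c ≠ 0)
    (hirr : Irreducible (C a * X ^ (p + q) + C b * X ^ q + C c : ℤ[X])) :
    {w : ℤ × ℤ | IsBranchSolution a b c p q w.1 w.2}.encard ≤ z (p + q) := by
  by_contra! hlt
  obtain ⟨t, hts, ht⟩ := Set.exists_subset_encard_eq (Order.add_one_le_of_lt hlt)
  generalize hZ : z (p + q) = Z at ht
  have htf : t.Finite := Set.finite_of_encard_eq_coe (k := Z + 1) (by rw [ht]; rfl)
  have hcard : htf.toFinset.card = Z + 1 := by
    have := htf.encard_eq_coe_toFinset_card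
    rw [ht] at this
    exact_mod_cast this.symm
  obtain ⟨e⟩ : Nonempty (Fin (Z + 1) ≃ htf.toFinset) :=
    ⟨(Fintype.equivFinOfCardEq (by simpa using hcard)).symm⟩
  obtain ⟨f, hf⟩ : ∃ f : Fin (Z + 1) → ℤ, f = fun i => (e i).1.1 ^ q * (e i).1.2 ^ p := ⟨_, rfl⟩
  have hmono := Tuple.monotone_sort f
  obtain ⟨g, hg⟩ : ∃ g : ℕ → ℤ × ℤ, g = fun i => (e (Tuple.sort f (Fin.ofNat (Z + 1) i))).1 :=
    ⟨_, rfl⟩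
  have hval : ∀ i j, i < j → j ≤ Z → Fin.ofNat (Z + 1) i < Fin.ofNat (Z + 1) j := by
    intro i j hij hj
    rw [Fin.lt_def, Fin.val_ofNat, Fin.val_ofNat, Nat.mod_eq_of_lt (by omega),
      Nat.mod_eq_of_lt (by omega)]
    exact hij
  refine SolutionChain.not_of_le (x := fun i => (g i).1) (y := fun i => (g i).2) hp hq hn ha hc
    hirr (hZ ▸ ⟨?_, ?_, ?_⟩)
  · intro i _
    rw [hg]
    exact hts (htf.mem_toFinset.1 (e (Tuple.sort f (Fin.ofNat (Z + 1) i))).2)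
  · intro i j hij hj h
    have h1 : g i = g j := Prod.ext h.1 h.2
    rw [hg] at h1
    exact (hval i j hij hj).ne ((Tuple.sort f).injective (e.injective (Subtype.ext h1)))
  · intro i j hij hj
    have := hmono (hval i j hij hj).le
    rw [hg]
    simpa [hf] using this

/-- The trinomial form `a X ^ (p + q) + b X ^ q Y ^ p + c Y ^ (p + q)`. -/
noncomputable def trinomialForm (a b c : ℤ) (p q : ℕ) : MvPolynomial (Fin 2) ℤ :=
  MvPolynomial.C a * MvPolynomial.X 0 ^ (p + q)
    + MvPolynomial.C b * MvPolynomial.X 0 ^ q * MvPolynomial.X 1 ^ p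
    + MvPolynomial.C c * MvPolynomial.X 1 ^ (p + q)

section Counting

variable {a b c : ℤ} {p q : ℕ}

theorem irreducible_trinomialForm_neg (h : Irreducible (trinomialForm a b c p q)) :
    Irreducible (trinomialForm (-a) (-b) (-c) p q) := by
  have e : trinomialForm (-a) (-b) (-c) p q = -trinomialForm a b c p q := by
    simp only [trinomialForm, map_neg]; ring
  rw [e]
  exact (Associated.neg_left (Associated.refl _)).symm.irreducible h

theorem irreducible_trinomialForm_swap (h : Irreducible (trinomialForm a b c p q)) :
    Irreducible (trinomialForm c b a q p) := by
  have e : trinomialForm c b a q p =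
      MvPolynomial.renameEquiv ℤ (Equiv.swap (0 : Fin 2) 1) (trinomialForm a b c p q) := by
    simp only [trinomialForm, map_add, map_mul, map_pow, MvPolynomial.renameEquiv_apply,
      MvPolynomial.rename_C, MvPolynomial.rename_X, Equiv.swap_apply_left, Equiv.swap_apply_right]
    ring
  rw [e]
  exact (MulEquiv.irreducible_iff (MvPolynomial.renameEquiv ℤ (Equiv.swap (0 : Fin 2) 1))).2 h

/-- The automorphism of `ℤ[X, Y]` that changes the sign of `Y`. -/
noncomputable def negSecond : MvPolynomial (Fin 2) ℤ ≃ₐ[ℤ] MvPolynomial (Fin 2) ℤ :=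
  AlgEquiv.ofAlgHom (MvPolynomial.aeval ![MvPolynomial.X 0, -MvPolynomial.X 1])
    (MvPolynomial.aeval ![MvPolynomial.X 0, -MvPolynomial.X 1])
    (by ext i; fin_cases i <;> simp) (by ext i; fin_cases i <;> simp)

theorem irreducible_trinomialForm_reflect (h : Irreducible (trinomialForm a b c p q)) :
    Irreducible (trinomialForm a (b * (-1) ^ p) (c * (-1) ^ (p + q)) p q) := by
  have e : trinomialForm a (b * (-1) ^ p) (c * (-1) ^ (p + q)) p q =
      negSecond (trinomialForm a b c p q) := by
    simp only [trinomialForm, negSecond, AlgEquiv.ofAlgHom_apply, map_add, map_mul, map_pow,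
      MvPolynomial.aeval_X, map_neg, map_one, MvPolynomial.algHom_C, MvPolynomial.algebraMap_eq]
    simp only [Matrix.cons_val_zero, Matrix.cons_val_one]
    rw [neg_pow (MvPolynomial.X 1 : MvPolynomial (Fin 2) ℤ) p,
      neg_pow (MvPolynomial.X 1 : MvPolynomial (Fin 2) ℤ) (p + q)]
    ring
  rw [e]
  exact (MulEquiv.irreducible_iff negSecond).2 h

theorem irreducible_of_trinomialForm (ha : a ≠ 0) (hp : 0 < p)
    (h : Irreducible (trinomialForm a b c p q)) :
    Irreducible (C a * X ^ (p + q) + C b * X ^ q + C c : ℤ[X]) := by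
  obtain ⟨f, hf⟩ : ∃ f : ℤ[X], f = C a * X ^ (p + q) + C b * X ^ q + C c := ⟨_, rfl⟩
  have hdeg : f.natDegree = p + q := by
    rw [hf]
    compute_degree!
    rw [if_neg (by omega), if_neg (by omega)]
    simpa using ha
  have hF : f.homogenize (p + q) = trinomialForm a b c p q := by
    rw [hf, trinomialForm]
    simp only [homogenize_add, homogenize_C_mul, homogenize_C]
    rw [homogenize_X_pow le_rfl, homogenize_X_pow (by omega : q ≤ p + q)]
    simp [mul_assoc]
  rw [← hf]
  have hf0 : f ≠ 0 := by
    rintro rfl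
    simp at hdeg
    omega
  refine ⟨fun hu => ?_, fun g g' hgg => ?_⟩
  · have := natDegree_eq_zero_of_isUnit hu
    omega
  · have hg : g ≠ 0 := by rintro rfl; exact hf0 (by simp [hgg])
    have hg' : g' ≠ 0 := by rintro rfl; exact hf0 (by simp [hgg])
    have hd : p + q = g.natDegree + g'.natDegree := by
      rw [← hdeg, hgg, natDegree_mul hg hg']
    rw [hgg, hd, homogenize_mul _ _ le_rfl le_rfl] at hF
    refine (h.isUnit_or_isUnit hF.symm).imp (fun hu => ?_) (fun hu => ?_)
    · have := hu.map (MvPolynomial.aeval ![(X : ℤ[X]), 1])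
      rwa [aeval_homogenize_X_one _ le_rfl] at this
    · have := hu.map (MvPolynomial.aeval ![(X : ℤ[X]), 1])
      rwa [aeval_homogenize_X_one _ le_rfl] at this

/-- The solutions in the open positive quadrant, other than `(1, 1)`. -/
def positiveSolutions (a b c : ℤ) (p q : ℕ) : Set (ℤ × ℤ) :=
  {w | 0 < w.1 ∧ 0 < w.2 ∧ ¬ (w.1 = 1 ∧ w.2 = 1) ∧
    |a * w.1 ^ (p + q) + b * (w.1 ^ q * w.2 ^ p) + c * w.2 ^ (p + q)| = 1}

theorem positiveSolutions_neg :
    positiveSolutions (-a) (-b) (-c) p q = positiveSolutions a b c p q := by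
  ext w
  simp only [positiveSolutions, Set.mem_ofPred_eq]
  rw [← abs_neg (a * w.1 ^ (p + q) + b * (w.1 ^ q * w.2 ^ p) + c * w.2 ^ (p + q))]
  ring_nf

theorem positiveSolutions_encard_le_of_neg (hp : 0 < p) (hq : 0 < q) (hn : 6 ≤ p + q) (ha : 0 < a)
    (hc : c < 0) (h : Irreducible (trinomialForm a b c p q)) :
    (positiveSolutions a b c p q).encard ≤ z (p + q) := by
  refine le_trans (Set.encard_le_encard ?_) (IsBranchSolution.encard_le hp hq hn ha hc.ne
    (irreducible_of_trinomialForm ha.ne' hp h))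
  rintro w ⟨hx, hy, h1, hF⟩
  refine ⟨hx, hy, h1, hF, ?_⟩
  have e1 : (q : ℤ) * (c * w.2 ^ (p + q)) ≤ 0 :=
    mul_nonpos_of_nonneg_of_nonpos (by positivity)
      (mul_nonpos_of_nonpos_of_nonneg hc.le (by positivity))
  exact e1.trans (by positivity)

theorem positiveSolutions_encard_le_of_pos (hp : 0 < p) (hq : 0 < q) (hn : 6 ≤ p + q) (ha : 0 < a)
    (hc : 0 < c) (h : Irreducible (trinomialForm a b c p q)) :
    (positiveSolutions a b c p q).encard ≤ z (p + q) + z (p + q) := by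
  have h1 := IsBranchSolution.encard_le hp hq hn ha hc.ne'
    (irreducible_of_trinomialForm ha.ne' hp h)
  have h2 := IsBranchSolution.encard_le hq hp (by omega) hc ha.ne'
    (irreducible_of_trinomialForm hc.ne' hq (irreducible_trinomialForm_swap h))
  rw [add_comm q p] at h2
  refine le_trans (Set.encard_le_encard ?_) ((Set.encard_union_le _ _).trans
    (add_le_add h1 ((Set.encard_image_le Prod.swap _).trans h2)))
  rintro w ⟨hx, hy, h1, hF⟩
  rcases le_total ((q : ℤ) * (c * w.2 ^ (p + q))) (p * (a * w.1 ^ (p + q))) with hle | hle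
  · exact Or.inl ⟨hx, hy, h1, hF, hle⟩
  · refine Or.inr ⟨w.swap, ⟨hy, hx, fun hh => h1 ⟨hh.2, hh.1⟩, ?_, ?_⟩, Prod.swap_swap w⟩
    · rw [← hF, Prod.fst_swap, Prod.snd_swap, add_comm q p]
      ring_nf
    · simpa [add_comm q p] using hle

theorem positiveSolutions_encard_le (hp : 0 < p) (hq : 0 < q) (hn : 6 ≤ p + q) (ha : a ≠ 0)
    (hc : c ≠ 0) (h : Irreducible (trinomialForm a b c p q)) :
    (positiveSolutions a b c p q).encard ≤
      (if 0 < a * c then 2 * z (p + q) else z (p + q) : ℕ) := by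
  wlog ha0 : 0 < a generalizing a b c
  · have := this (neg_ne_zero.2 ha) (neg_ne_zero.2 hc) (irreducible_trinomialForm_neg h) (by omega)
    rwa [positiveSolutions_neg, neg_mul_neg] at this
  rcases lt_or_gt_of_ne hc with hc0 | hc0
  · rw [if_neg (by nlinarith)]
    exact positiveSolutions_encard_le_of_neg hp hq hn ha0 hc0 h
  · rw [if_pos (by positivity), two_mul]
    exact_mod_cast positiveSolutions_encard_le_of_pos hp hq hn ha0 hc0 h

theorem sign_cases_le (ha : a ≠ 0) (hc : c ≠ 0) (n Z : ℕ) :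
    (if 0 < a * c then 2 * Z else Z) + (if 0 < a * (c * (-1) ^ n) then 2 * Z else Z) ≤ v n * Z := by
  have hac : a * c ≠ 0 := mul_ne_zero ha hc
  rcases Nat.even_or_odd n with hn | hn
  · rw [v, if_neg (Nat.not_odd_iff_even.2 hn), hn.neg_one_pow, mul_one]
    split_ifs <;> omega
  · rw [v, if_pos hn, hn.neg_one_pow, mul_neg_one, mul_neg]
    split_ifs <;> omega

theorem solutions_subset (hp : 0 < p) (hq : 0 < q) (hc : c ≠ 0) (ha : a ≠ 0) :
    {w : ℤ × ℤ | |a * w.1 ^ (p + q) + b * w.1 ^ q * w.2 ^ p + c * w.2 ^ (p + q)| = 1} ⊆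
      (positiveSolutions a b c p q ∪ (fun w => (-w.1, -w.2)) '' positiveSolutions a b c p q) ∪
      ((fun w => (w.1, -w.2)) '' positiveSolutions a (b * (-1) ^ p) (c * (-1) ^ (p + q)) p q ∪
        (fun w => (-w.1, w.2)) '' positiveSolutions a (b * (-1) ^ p) (c * (-1) ^ (p + q)) p q) ∪
      ((Finset.Icc (-1) 1 ×ˢ Finset.Icc (-1) 1).erase (0, 0) : Finset (ℤ × ℤ)) := by
  rintro ⟨x, y⟩ hF
  simp only [Set.mem_ofPred_eq] at hF
  by_cases hsmall : |x| ≤ 1 ∧ |y| ≤ 1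
  · right
    rw [abs_le, abs_le] at hsmall
    simp only [Finset.mem_coe, Finset.mem_erase, Finset.mem_product, Finset.mem_Icc]
    refine ⟨fun h0 => ?_, hsmall⟩
    obtain ⟨rfl, rfl⟩ := Prod.mk.inj h0
    rw [zero_pow (show p + q ≠ 0 by omega), zero_pow hq.ne'] at hF
    simp at hF
  have hunit : ∀ {d t : ℤ}, d ≠ 0 → |d * t ^ (p + q)| = 1 → |t| ≤ 1 := by
    intro d t hd h1
    have h2 : IsUnit (d * t ^ (p + q)) := Int.isUnit_iff_abs_eq.2 h1
    have h3 : IsUnit t := (isUnit_pow_iff (by omega)).1 (isUnit_of_mul_isUnit_right h2)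
    exact (Int.isUnit_iff_abs_eq.1 h3).le
  have hx0 : x ≠ 0 := by
    rintro rfl
    rw [zero_pow (show p + q ≠ 0 by omega), zero_pow hq.ne'] at hF
    exact hsmall ⟨by simp, hunit hc (by simpa using hF)⟩
  have hy0 : y ≠ 0 := by
    rintro rfl
    rw [zero_pow (show p + q ≠ 0 by omega), zero_pow hp.ne'] at hF
    exact hsmall ⟨hunit ha (by simpa using hF), by simp⟩
  left
  have sq1 : ∀ m : ℕ, ((-1 : ℤ) ^ m) * (-1) ^ m = 1 := fun m => by
    rw [← mul_pow]; simp
  rcases lt_or_gt_of_ne hx0 with hx | hx <;> rcases lt_or_gt_of_ne hy0 with hy | hy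
  · refine Or.inl (Or.inr ⟨(-x, -y), ⟨by simpa using hx, by simpa using hy, ?_, ?_⟩, by simp⟩)
    · rintro ⟨h1, h2⟩
      simp only at h1 h2
      exact hsmall ⟨by rw [abs_of_neg hx]; omega, by rw [abs_of_neg hy]; omega⟩
    · refine Eq.trans ?_ hF
      simp only
      rw [neg_pow x (p + q), neg_pow x q, neg_pow y p, neg_pow y (p + q)]
      rw [show a * ((-1) ^ (p + q) * x ^ (p + q)) + b * ((-1) ^ q * x ^ q * ((-1) ^ p * y ^ p)) +
        c * ((-1) ^ (p + q) * y ^ (p + q)) = (-1) ^ (p + q) * (a * x ^ (p + q) +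
          b * x ^ q * y ^ p + c * y ^ (p + q)) by ring, abs_mul, abs_neg_one_pow, one_mul]
  · refine Or.inr (Or.inr ⟨(-x, y), ⟨by simpa using hx, hy, ?_, ?_⟩, by simp⟩)
    · rintro ⟨h1, h2⟩
      simp only at h1 h2
      exact hsmall ⟨by rw [abs_of_neg hx]; omega, by rw [abs_of_pos hy]; omega⟩
    · refine Eq.trans ?_ hF
      simp only
      rw [neg_pow x (p + q), neg_pow x q]
      rw [show a * ((-1) ^ (p + q) * x ^ (p + q)) + b * (-1) ^ p * ((-1) ^ q * x ^ q * y ^ p) +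
        c * (-1) ^ (p + q) * y ^ (p + q) = (-1) ^ (p + q) * (a * x ^ (p + q) +
          b * x ^ q * y ^ p + c * y ^ (p + q)) by ring, abs_mul, abs_neg_one_pow, one_mul]
  · refine Or.inr (Or.inl ⟨(x, -y), ⟨hx, by simpa using hy, ?_, ?_⟩, by simp⟩)
    · rintro ⟨h1, h2⟩
      simp only at h1 h2
      exact hsmall ⟨by rw [abs_of_pos hx]; omega, by rw [abs_of_neg hy]; omega⟩
    · refine Eq.trans ?_ hF
      simp only
      rw [neg_pow y (p + q), neg_pow y p]
      rw [show a * x ^ (p + q) + b * (-1) ^ p * (x ^ q * ((-1) ^ p * y ^ p)) +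
        c * (-1) ^ (p + q) * ((-1) ^ (p + q) * y ^ (p + q)) = a * x ^ (p + q) +
          b * x ^ q * y ^ p * ((-1) ^ p * (-1) ^ p) +
          c * y ^ (p + q) * ((-1) ^ (p + q) * (-1) ^ (p + q)) by ring, sq1, sq1, mul_one, mul_one]
  · refine Or.inl (Or.inl ⟨hx, hy, ?_, ?_⟩)
    · rintro ⟨h1, h2⟩
      simp only at h1 h2
      exact hsmall ⟨by rw [h1]; simp, by rw [h2]; simp⟩
    · refine Eq.trans ?_ hF
      simp only [mul_assoc]

end Counting

theorem stmt0 (hn hk h0 : ℤ) (n k : ℕ) (hk0 : 0 < k) (hkn : k < n) (hn6 : 6 ≤ n)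
    (hhn : hn ≠ 0) (hhk : hk ≠ 0) (hh0 : h0 ≠ 0)
    (hirr : Irreducible
      (MvPolynomial.C hn * MvPolynomial.X 0 ^ n
        + MvPolynomial.C hk * MvPolynomial.X 0 ^ k * MvPolynomial.X 1 ^ (n - k)
        + MvPolynomial.C h0 * MvPolynomial.X 1 ^ n : MvPolynomial (Fin 2) ℤ)) :
    {p : ℤ × ℤ | |hn * p.1 ^ n + hk * p.1 ^ k * p.2 ^ (n - k) + h0 * p.2 ^ n| = 1}.encard
      ≤ ((2 * v n * z n + 8 : ℕ) : ℕ∞) := by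
  obtain ⟨p, rfl⟩ : ∃ p, n = p + k := ⟨n - k, by omega⟩
  have hp : 0 < p := by omega
  rw [Nat.add_sub_cancel] at hirr
  simp only [Nat.add_sub_cancel]
  have h1 := positiveSolutions_encard_le hp hk0 hn6 hhn hh0 hirr
  have h2 := positiveSolutions_encard_le hp hk0 hn6 hhn
    (mul_ne_zero hh0 (pow_ne_zero (p + k) (by norm_num : (-1 : ℤ) ≠ 0)))
    (irreducible_trinomialForm_reflect hirr)
  have h3 := sign_cases_le hhn hh0 (p + k) (z (p + k))
  refine (Set.encard_le_encard (solutions_subset hp hk0 hh0 hhn)).trans ?_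
  refine (Set.encard_union_le _ _).trans ?_
  rw [Set.encard_coe_eq_coe_finsetCard]
  have h4 : ((Finset.Icc (-1) 1 ×ˢ Finset.Icc (-1) 1).erase (0, 0) : Finset (ℤ × ℤ)).card = 8 := by
    decide
  rw [h4]
  refine le_trans (add_le_add (((Set.encard_union_le _ _).trans (add_le_add
    ((Set.encard_union_le _ _).trans (add_le_add h1 ((Set.encard_image_le _ _).trans h1)))
    ((Set.encard_union_le _ _).trans (add_le_add ((Set.encard_image_le _ _).trans h2)
      ((Set.encard_image_le _ _).trans h2)))))) le_rfl) ?_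
  generalize (if 0 < hn * h0 then 2 * z (p + k) else z (p + k)) = e₁ at *
  generalize (if 0 < hn * (h0 * (-1) ^ (p + k)) then 2 * z (p + k) else z (p + k)) = e₂ at *
  norm_cast
  linarith
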